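/- Let M be an n-dimensional Alexandrov space, E ⊆ M an extremal subset, p ∈ E, and let {(aᵢ,bᵢ)}ᵢ₌₁^m be an (m,δ)-strainer at p with δ sufficiently small, such that m is the local δ-strainer number of E at p. Then the distance map f = (dist_{a₁}, …, dist_{a_m}) restricted to a sufficiently small neighborhood of p in E is a κ(δ)-almost isometry onto an open subset of ℝ^m, with respect to both the extrinsic (restricted) metric and the intrinsic (induced length) metric of E; here κ(δ) → 0 as δ → 0, depending only on n and the lower curvature bound. -/

import Mathlib

open Real Metric Set
open scoped ENNReal NNReal

noncomputable section

/-- The comparison angle in the `κ`-plane at the vertex between sides of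
lengths `s` and `t`, opposite side of length `d`. -/
def cangleK (κ s t d : ℝ) : ℝ :=
  if 0 < κ then
    Real.arccos ((Real.cos (Real.sqrt κ * d) - Real.cos (Real.sqrt κ * s) * Real.cos (Real.sqrt κ * t)) /
      (Real.sin (Real.sqrt κ * s) * Real.sin (Real.sqrt κ * t)))
  else if κ < 0 then
    Real.arccos ((Real.cosh (Real.sqrt (-κ) * s) * Real.cosh (Real.sqrt (-κ) * t) -
      Real.cosh (Real.sqrt (-κ) * d)) /
      (Real.sinh (Real.sqrt (-κ) * s) * Real.sinh (Real.sqrt (-κ) * t)))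
  else Real.arccos ((s ^ 2 + t ^ 2 - d ^ 2) / (2 * s * t))

/-- The comparison angle `∠̃ q p r` at `p` in the `κ`-plane. -/
def cangle {X : Type*} [MetricSpace X] (κ : ℝ) (q p r : X) : ℝ :=
  cangleK κ (dist p q) (dist p r) (dist q r)

/-- A `(k,δ)`-strainer at `p` (comparison angles taken in the `κ`-plane). -/
def IsStrainer {X : Type*} [MetricSpace X] (κ : ℝ) {k : ℕ} (a b : Fin k → X) (p : X)
    (δ : ℝ) : Prop :=
  (∀ i, π - δ < cangle κ (a i) p (b i)) ∧
  ∀ i j, i ≠ j →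
    π / 2 - δ < cangle κ (a i) p (a j) ∧
    π / 2 - δ < cangle κ (a i) p (b j) ∧
    π / 2 - δ < cangle κ (b i) p (b j)

/-- A `(k,δ)`-strained point. -/
def IsStrainedPt {X : Type*} [MetricSpace X] (κ : ℝ) (k : ℕ) (δ : ℝ) (p : X) : Prop :=
  ∃ a b : Fin k → X, IsStrainer κ a b p δ

/-- An Alexandrov space of curvature `≥ κ`: complete, geodesic (via midpoints), and the
sum of the three `κ`-comparison angles of any quadruple is at most `2π`. -/
def IsAlexandrov (X : Type*) [MetricSpace X] (κ : ℝ) : Prop :=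
  CompleteSpace X ∧
  (∀ x y : X, ∃ z : X, dist x z = dist x y / 2 ∧ dist z y = dist x y / 2) ∧
  ∀ p q r s : X, q ≠ p → r ≠ p → s ≠ p →
    cangle κ q p r + cangle κ r p s + cangle κ s p q ≤ 2 * π

/-- `p` is a critical point of `dist q`. -/
def IsCriticalPt {X : Type*} [MetricSpace X] (κ : ℝ) (q p : X) : Prop :=
  ∀ x : X, x ≠ p → cangle κ q p x ≤ π / 2

/-- An extremal subset: closed, and every local minimum point `p ∈ E` of `dist q|_E`
with `q ∉ E` is a critical point of `dist q`. -/
def IsExtremal {X : Type*} [MetricSpace X] (κ : ℝ) (E : Set X) : Prop :=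
  IsClosed E ∧
  ∀ q ∉ E, ∀ p ∈ E, IsLocalMinOn (fun x => dist q x) E p → IsCriticalPt κ q p

/-- A primitive extremal subset: an extremal subset containing no proper extremal
subset with nonempty relative interior. -/
def IsPrimitiveExtremal {X : Type*} [MetricSpace X] (κ : ℝ) (E : Set X) : Prop :=
  IsExtremal κ E ∧
  ∀ F : Set X, IsExtremal κ F → F ⊆ E → F ≠ E →
    ∀ x ∈ F, ¬ ∃ r > (0:ℝ), Metric.ball x r ∩ E ⊆ F

/-- `p` is a regular point of `E` of dimension `m`: the tangent cone of `E` at `p`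
(with the extrinsic metric) is isometric to `ℝ^m`, expressed through blow-ups:
balls of `E` around `p` at scale `r` are `εr`-approximated by `r`-balls of `ℝ^m`. -/
def IsRegularPt {X : Type*} [MetricSpace X] (E : Set X) (m : ℕ) (p : X) : Prop :=
  ∀ ε > (0:ℝ), ∃ r₀ > (0:ℝ), ∀ r, 0 < r → r < r₀ →
    ∃ f : X → EuclideanSpace ℝ (Fin m),
      f p = 0 ∧
      (∀ x ∈ E ∩ Metric.closedBall p r, ∀ y ∈ E ∩ Metric.closedBall p r,
        |dist (f x) (f y) - dist x y| ≤ ε * r) ∧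
      (∀ v ∈ Metric.closedBall (0 : EuclideanSpace ℝ (Fin m)) r,
        ∃ x ∈ E ∩ Metric.closedBall p r, dist (f x) v ≤ ε * r)

/-- The intrinsic (induced length) extended distance on a subset `E`. -/
def intrinsicEDist {X : Type*} [MetricSpace X] (E : Set X) (x y : X) : ℝ≥0∞ :=
  ⨅ (γ : ℝ → X) (_ : ContinuousOn γ (Set.Icc 0 1)) (_ : γ 0 = x) (_ : γ 1 = y)
    (_ : ∀ t ∈ Set.Icc (0:ℝ) 1, γ t ∈ E), eVariationOn γ (Set.Icc 0 1)

/-- Diameter of a set with respect to an abstract extended distance. -/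
def ediamOn {X : Type*} (ρ : X → X → ℝ≥0∞) (s : Set X) : ℝ≥0∞ :=
  ⨆ x ∈ s, ⨆ y ∈ s, ρ x y

/-- The `m`-dimensional Hausdorff measure of `S` with respect to an abstract
extended distance `ρ`. -/
def hMeas {X : Type*} (ρ : X → X → ℝ≥0∞) (m : ℝ) (S : Set X) : ℝ≥0∞ :=
  ⨆ (ε : ℝ≥0∞) (_ : 0 < ε),
    ⨅ (t : ℕ → Set X) (_ : S ⊆ ⋃ n, t n) (_ : ∀ n, ediamOn ρ (t n) ≤ ε),
      ∑' n, ediamOn ρ (t n) ^ m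

end

/-! ### Trigonometry of the model plane -/

/-- Generalized sine. -/
noncomputable def sn (κ s : ℝ) : ℝ :=
  if 0 < κ then sin (√κ * s) / √κ else if κ < 0 then sinh (√(-κ) * s) / √(-κ) else s

/-- Antiderivative of the generalized sine. -/
noncomputable def md (κ s : ℝ) : ℝ :=
  if 0 < κ then (1 - cos (√κ * s)) / κ
  else if κ < 0 then (1 - cosh (√(-κ) * s)) / κ else s ^ 2 / 2

noncomputable def cosK (κ s t d : ℝ) : ℝ :=
  (md κ s + md κ t - κ * md κ s * md κ t - md κ d) / (sn κ s * sn κ t)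

lemma cangleK_eq (κ s t d : ℝ) : cangleK κ s t d = arccos (cosK κ s t d) := by
  unfold cangleK cosK sn md
  split_ifs with h1 h2
  · congr 1
    have : √κ ≠ 0 := (sqrt_pos.2 h1).ne'
    have e : κ = √κ * √κ := (mul_self_sqrt h1.le).symm
    have hN : (1 - cos (√κ * s)) / κ + (1 - cos (√κ * t)) / κ -
        κ * ((1 - cos (√κ * s)) / κ) * ((1 - cos (√κ * t)) / κ) - (1 - cos (√κ * d)) / κ
        = (cos (√κ * d) - cos (√κ * s) * cos (√κ * t)) / κ := by
      field_simp; ring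
    rw [hN, div_mul_div_comm, ← e, div_div_div_cancel_right₀ h1.ne']
  · congr 1
    have h3 : 0 < -κ := by linarith
    have e : -κ = √(-κ) * √(-κ) := (mul_self_sqrt h3.le).symm
    have hN : (1 - cosh (√(-κ) * s)) / κ + (1 - cosh (√(-κ) * t)) / κ -
        κ * ((1 - cosh (√(-κ) * s)) / κ) * ((1 - cosh (√(-κ) * t)) / κ) -
          (1 - cosh (√(-κ) * d)) / κ
        = (cosh (√(-κ) * s) * cosh (√(-κ) * t) - cosh (√(-κ) * d)) / (-κ) := by
      have := h2.ne
      field_simp; ring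
    rw [hN, div_mul_div_comm, ← e, div_div_div_cancel_right₀ h3.ne']
  · congr 1
    have : κ = 0 := le_antisymm (not_lt.1 h1) (not_lt.1 h2)
    subst this
    by_cases h : s * t = 0
    · rw [h, mul_assoc, h]; simp
    · have := left_ne_zero_of_mul h
      have := right_ne_zero_of_mul h
      field_simp; ring

lemma sn_zero (κ : ℝ) : sn κ 0 = 0 := by unfold sn; split_ifs <;> simp

lemma md_zero (κ : ℝ) : md κ 0 = 0 := by unfold md; split_ifs <;> simp

lemma hasDerivAt_md (κ s : ℝ) : HasDerivAt (md κ) (sn κ s) s := by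
  unfold sn
  split_ifs with h1 h2
  · have : md κ = fun s => (1 - cos (√κ * s)) / κ := by funext; simp [md, h1]
    rw [this]
    have h := (((hasDerivAt_id s).const_mul (√κ)).cos.const_sub 1).div_const κ
    refine h.congr_deriv ?_
    have e : κ = √κ * √κ := (mul_self_sqrt h1.le).symm
    have : √κ ≠ 0 := (sqrt_pos.2 h1).ne'
    simp only [id]
    rw [div_eq_div_iff h1.ne' this]
    linear_combination (-sin (√κ * s)) * e
  · have : md κ = fun s => (1 - cosh (√(-κ) * s)) / κ := by funext; simp [md, h1, h2]
    rw [this]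
    have h := (((hasDerivAt_id s).const_mul (√(-κ))).cosh.const_sub 1).div_const κ
    refine h.congr_deriv ?_
    have h3 : 0 < -κ := by linarith
    have e : -κ = √(-κ) * √(-κ) := (mul_self_sqrt h3.le).symm
    have : √(-κ) ≠ 0 := (sqrt_pos.2 h3).ne'
    have := h2.ne
    simp only [id]
    rw [div_eq_div_iff h2.ne ‹√(-κ) ≠ 0›]
    linear_combination (sinh (√(-κ) * s)) * e
  · have : md κ = fun s => s ^ 2 / 2 := by funext; simp [md, h1, h2]
    rw [this]
    have h := ((hasDerivAt_id s).pow 2).div_const 2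
    refine h.congr_deriv ?_
    simp

lemma hasDerivAt_sn (κ s : ℝ) : HasDerivAt (sn κ) (1 - κ * md κ s) s := by
  unfold md
  split_ifs with h1 h2
  · have : sn κ = fun s => sin (√κ * s) / √κ := by funext; simp [sn, h1]
    rw [this]
    have h := (((hasDerivAt_id s).const_mul (√κ)).sin).div_const (√κ)
    refine h.congr_deriv ?_
    have : √κ ≠ 0 := (sqrt_pos.2 h1).ne'
    simp only [id]
    field_simp
    ring
  · have : sn κ = fun s => sinh (√(-κ) * s) / √(-κ) := by funext; simp [sn, h1, h2]
    rw [this]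
    have h := (((hasDerivAt_id s).const_mul (√(-κ))).sinh).div_const (√(-κ))
    refine h.congr_deriv ?_
    have h3 : 0 < -κ := by linarith
    have : √(-κ) ≠ 0 := (sqrt_pos.2 h3).ne'
    have := h2.ne
    simp only [id]
    field_simp
    ring
  · have h0 : κ = 0 := le_antisymm (not_lt.1 h1) (not_lt.1 h2)
    have : sn κ = fun s => s := by funext; simp [sn, h1, h2]
    rw [this]
    refine (hasDerivAt_id s).congr_deriv ?_
    rw [h0]; simp

lemma continuous_md (κ : ℝ) : Continuous (md κ) :=
  continuous_iff_continuousAt.2 fun s => (hasDerivAt_md κ s).continuousAt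

lemma continuous_sn (κ : ℝ) : Continuous (sn κ) :=
  continuous_iff_continuousAt.2 fun s => (hasDerivAt_sn κ s).continuousAt

/-- Mean value estimates on a fixed interval. -/
lemma sn_md_bounds (κ s₀ : ℝ) : ∃ B : ℝ, 1 ≤ B ∧
    (∀ s ∈ Icc (s₀ - 1) (s₀ + 1), |md κ s| ≤ B ∧ |sn κ s| ≤ B ∧ |1 - κ * md κ s| ≤ B) ∧
    (∀ s ∈ Icc (s₀ - 1) (s₀ + 1), ∀ d ∈ Icc (s₀ - 1) (s₀ + 1),
      |sn κ s - sn κ d| ≤ B * |s - d| ∧ |md κ s - md κ d| ≤ B * |s - d| ∧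
      |md κ s - md κ d - sn κ s * (s - d)| ≤ B * |s - d| ^ 2) := by
  obtain ⟨B1, hB1⟩ := (isCompact_Icc (a := s₀ - 1) (b := s₀ + 1)).exists_bound_of_continuousOn
    (continuous_md κ).continuousOn
  obtain ⟨B2, hB2⟩ := (isCompact_Icc (a := s₀ - 1) (b := s₀ + 1)).exists_bound_of_continuousOn
    (continuous_sn κ).continuousOn
  obtain ⟨B3, hB3⟩ := (isCompact_Icc (a := s₀ - 1) (b := s₀ + 1)).exists_bound_of_continuousOn
    (continuous_const.sub ((continuous_const (y := κ)).mul (continuous_md κ))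
      : Continuous fun s => 1 - κ * md κ s).continuousOn
  set B := max 1 (max B1 (max B2 B3)) with hB
  have b1 : B1 ≤ B := by simp [hB]
  have b2 : B2 ≤ B := by simp [hB]
  have b3 : B3 ≤ B := by simp [hB]
  have hsn : ∀ s ∈ Icc (s₀ - 1) (s₀ + 1), ∀ d ∈ Icc (s₀ - 1) (s₀ + 1),
      |sn κ s - sn κ d| ≤ B * |s - d| := fun s hs d hd => by
    have := (convex_Icc (s₀ - 1) (s₀ + 1)).norm_image_sub_le_of_norm_hasDerivWithin_le
      (f := sn κ) (C := B) (fun x hx => (hasDerivAt_sn κ x).hasDerivWithinAt)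
      (fun x hx => (hB3 x hx).trans b3) hd hs
    simpa [Real.norm_eq_abs] using this
  have hmd : ∀ s ∈ Icc (s₀ - 1) (s₀ + 1), ∀ d ∈ Icc (s₀ - 1) (s₀ + 1),
      |md κ s - md κ d| ≤ B * |s - d| := fun s hs d hd => by
    have := (convex_Icc (s₀ - 1) (s₀ + 1)).norm_image_sub_le_of_norm_hasDerivWithin_le
      (f := md κ) (C := B) (fun x hx => (hasDerivAt_md κ x).hasDerivWithinAt)
      (fun x hx => (hB2 x hx).trans b2) hd hs
    simpa [Real.norm_eq_abs] using this
  refine ⟨B, le_max_left _ _, fun s hs => ⟨(hB1 s hs).trans b1, (hB2 s hs).trans b2,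
    (hB3 s hs).trans b3⟩, fun s hs d hd => ⟨hsn s hs d hd, hmd s hs d hd, ?_⟩⟩
  have hsub : uIcc s d ⊆ Icc (s₀ - 1) (s₀ + 1) := ordConnected_Icc.uIcc_subset hs hd
  have := (convex_uIcc s d).norm_image_sub_le_of_norm_hasDerivWithin_le
    (f := fun x => md κ x - sn κ s * x) (f' := fun x => sn κ x - sn κ s) (C := B * |s - d|)
    (fun x hx => ((hasDerivAt_md κ x).sub
      (by simpa using (hasDerivAt_id x).const_mul (sn κ s))).hasDerivWithinAt)
    (fun x hx => by
      rw [Real.norm_eq_abs]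
      refine (hsn x (hsub hx) s hs).trans ?_
      have : |x - s| ≤ |s - d| := by
        rw [abs_sub_comm s d]; exact abs_sub_left_of_mem_uIcc hx
      gcongr) right_mem_uIcc left_mem_uIcc
  simp only [Real.norm_eq_abs] at this
  calc _ = |md κ s - sn κ s * s - (md κ d - sn κ s * d)| := by ring_nf
    _ ≤ _ := this
    _ = _ := by ring

lemma abs_cos_arccos_sub_le {A A₀ : ℝ} (h : |A₀| ≤ 1) : |cos (arccos A) - A₀| ≤ |A - A₀| := by
  have h' := abs_le.1 h
  rcases le_total A (-1) with h1 | h1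
  · rw [arccos_of_le_neg_one h1, cos_pi, abs_le]
    constructor
    · rw [abs_of_nonpos (by linarith)]; linarith
    · rw [abs_of_nonpos (by linarith)]; linarith
  rcases le_total 1 A with h2 | h2
  · rw [arccos_of_one_le h2, cos_zero, abs_le]
    constructor
    · rw [abs_of_nonneg (by linarith)]; linarith
    · rw [abs_of_nonneg (by linarith)]; linarith
  · rw [cos_arccos h1 h2]

lemma md_sq_bound (κ : ℝ) : ∃ B : ℝ, 1 ≤ B ∧ ∀ t, 0 ≤ t → t ≤ 1 →
    |md κ t| ≤ B * t ^ 2 ∧ |sn κ t - t| ≤ B * t ^ 2 := by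
  obtain ⟨B, hB, h1, h2⟩ := sn_md_bounds κ 0
  have hmem : ∀ t, 0 ≤ t → t ≤ 1 → t ∈ Icc ((0:ℝ) - 1) (0 + 1) := fun t h0 h1 =>
    ⟨by linarith, by linarith⟩
  refine ⟨B * (1 + |κ|), ?_, fun t ht ht1 => ⟨?_, ?_⟩⟩
  · nlinarith [abs_nonneg κ]
  · have hs : |sn κ t| ≤ B * t := by
      have := (h2 t (hmem t ht ht1) 0 (hmem 0 le_rfl zero_le_one)).1
      simpa [sn_zero, abs_of_nonneg ht] using this
    have := (h2 0 (hmem 0 le_rfl zero_le_one) t (hmem t ht ht1)).2.2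
    simp only [md_zero, sn_zero, zero_sub, abs_neg, zero_mul, sub_zero, sq_abs] at this
    refine this.trans ?_
    nlinarith [mul_nonneg (mul_nonneg (zero_le_one.trans hB) (abs_nonneg κ)) (sq_nonneg t)]
  · have hmd : ∀ x, 0 ≤ x → x ≤ t → |md κ x| ≤ B * t := fun x hx hxt => by
      have := (h2 x (hmem x hx (hxt.trans ht1)) 0 (hmem 0 le_rfl zero_le_one)).2.1
      simp only [md_zero, sub_zero, abs_of_nonneg hx] at this
      refine this.trans (by gcongr)
    have := (convex_Icc 0 t).norm_image_sub_le_of_norm_hasDerivWithin_le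
      (f := fun x => sn κ x - x) (f' := fun x => 1 - κ * md κ x - 1) (C := |κ| * (B * t))
      (fun x hx => ((hasDerivAt_sn κ x).sub (hasDerivAt_id x)).hasDerivWithinAt)
      (fun x hx => by
        rw [Real.norm_eq_abs]
        have : 1 - κ * md κ x - 1 = -(κ * md κ x) := by ring
        rw [this, abs_neg, abs_mul]
        gcongr
        exact hmd x hx.1 hx.2) (left_mem_Icc.2 ht) (right_mem_Icc.2 ht)
    simp only [Real.norm_eq_abs, sn_zero, sub_zero, abs_of_nonneg ht] at this
    refine this.trans ?_
    nlinarith [mul_nonneg (zero_le_one.trans hB) (sq_nonneg t)]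

/-- `sn κ t` is comparable to `t` for small `t`. -/
lemma sn_small (κ : ℝ) : ∃ r : ℝ, 0 < r ∧ r ≤ 1 ∧ ∃ B : ℝ, 1 ≤ B ∧ ∀ t, 0 ≤ t → t < r →
    |md κ t| ≤ B * t ^ 2 ∧ |sn κ t - t| ≤ B * t ^ 2 ∧ t / 2 ≤ sn κ t ∧ B * t ≤ 1 / 2 := by
  obtain ⟨B, hB, h⟩ := md_sq_bound κ
  have hB0 : 0 < B := by linarith
  refine ⟨1 / (2 * B), by positivity, ?_, B, hB, fun t ht htr => ?_⟩
  · rw [div_le_one (by positivity)]; linarith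
  have h1 : t * (2 * B) < 1 := (lt_div_iff₀ (by positivity)).1 htr
  have ht1 : t ≤ 1 := by nlinarith
  obtain ⟨h2, h3⟩ := h t ht ht1
  refine ⟨h2, h3, ?_, by linarith⟩
  have := (abs_le.1 h3).1
  nlinarith

lemma cosK_thin (κ s₀ : ℝ) (h0 : sn κ s₀ ≠ 0) : ∃ r > 0, ∃ C ≥ 0, ∀ s t d : ℝ,
    |s - s₀| < r → 0 < t → t < r → |s - d| ≤ t →
      sn κ s ≠ 0 ∧ |cosK κ s t d - (s - d) / t| ≤ C * t := by
  obtain ⟨r1, hr1, hr1', B1, hB1, h1⟩ := sn_small κ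
  obtain ⟨B, hB, h2, h3⟩ := sn_md_bounds κ s₀
  have hc : ∀ᶠ s in nhds s₀, |sn κ s₀| / 2 < |sn κ s| :=
    (continuous_sn κ).abs.continuousAt.eventually (lt_mem_nhds (half_lt_self (abs_pos.2 h0)))
  obtain ⟨r2, hr2, h4⟩ := Metric.eventually_nhds_iff.1 hc
  set w := |sn κ s₀| / 2 with hw
  have hw0 : 0 < w := half_pos (abs_pos.2 h0)
  refine ⟨min (1/2) (min r1 r2), by positivity, 2 * B1 * B / w + 2 * B / w + 2 * B1,
    by positivity, fun s t d hs ht htr hd => ?_⟩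
  have hs1 : |s - s₀| < 1/2 := hs.trans_le (min_le_left _ _)
  have ht1 : t < 1/2 := htr.trans_le (min_le_left _ _)
  have htr1 : t < r1 := htr.trans_le ((min_le_right _ _).trans (min_le_left _ _))
  have hsr2 : |s - s₀| < r2 := hs.trans_le ((min_le_right _ _).trans (min_le_right _ _))
  have hsn : w < |sn κ s| := h4 (by rwa [Real.dist_eq])
  have hsn0 : sn κ s ≠ 0 := fun h => by rw [h, abs_zero] at hsn; linarith
  refine ⟨hsn0, ?_⟩
  have hsm : s ∈ Icc (s₀ - 1) (s₀ + 1) := by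
    have := abs_lt.1 hs1; constructor <;> linarith
  have hdm : d ∈ Icc (s₀ - 1) (s₀ + 1) := by
    have := abs_lt.1 hs1; have := abs_le.1 hd; constructor <;> linarith
  obtain ⟨e1, e2, e3, -⟩ := h1 t ht.le htr1
  have e4 := (h2 s hsm).2.2
  have e5 := (h3 s hsm d hdm).2.2
  have hst : 0 < sn κ t := by linarith
  have key : cosK κ s t d - (s - d) / t =
      md κ t * (1 - κ * md κ s) / (sn κ s * sn κ t) +
      (md κ s - md κ d - sn κ s * (s - d)) / (sn κ s * sn κ t) -
      (s - d) * (sn κ t - t) / (t * sn κ t) := by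
    unfold cosK; field_simp; ring
  rw [key]
  have hden : w * (t / 2) ≤ |sn κ s * sn κ t| := by
    rw [abs_mul, abs_of_pos hst]; gcongr
  have b1 : |md κ t * (1 - κ * md κ s) / (sn κ s * sn κ t)| ≤ 2 * B1 * B / w * t := by
    rw [abs_div, div_le_iff₀ (by positivity), abs_mul]
    calc _ ≤ (B1 * t ^ 2) * B := by gcongr
      _ = 2 * B1 * B / w * t * (w * (t / 2)) := by field_simp
      _ ≤ _ := by gcongr
  have b2 : |(md κ s - md κ d - sn κ s * (s - d)) / (sn κ s * sn κ t)| ≤ 2 * B / w * t := by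
    rw [abs_div, div_le_iff₀ (by positivity)]
    calc _ ≤ B * |s - d| ^ 2 := e5
      _ ≤ B * t ^ 2 := by gcongr
      _ = 2 * B / w * t * (w * (t / 2)) := by field_simp
      _ ≤ _ := by gcongr
  have b3 : |(s - d) * (sn κ t - t) / (t * sn κ t)| ≤ 2 * B1 * t := by
    rw [abs_div, div_le_iff₀ (by positivity), abs_mul, abs_of_pos (mul_pos ht hst)]
    calc _ ≤ t * (B1 * t ^ 2) := by gcongr
      _ = 2 * B1 * t * (t * (t / 2)) := by field_simp
      _ ≤ _ := by gcongr
  calc _ ≤ 2 * B1 * B / w * t + 2 * B / w * t + 2 * B1 * t :=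
        (abs_sub _ _).trans (add_le_add ((abs_add_le _ _).trans (add_le_add b1 b2)) b3)
    _ = _ := by ring

lemma cosK_comm (κ s t d : ℝ) : cosK κ s t d = cosK κ t s d := by
  unfold cosK; ring_nf

set_option maxHeartbeats 1000000 in
lemma cosK_small (κ : ℝ) : ∃ r > 0, ∃ C ≥ 0, ∀ s t d : ℝ, 0 < s → 0 < t → s < r → t < r →
    |s - t| ≤ d → d ≤ s + t →
      |cosK κ s t d - (s ^ 2 + t ^ 2 - d ^ 2) / (2 * s * t)| ≤ C * (s + t) := by
  obtain ⟨r, hr, hr', B, hB, h⟩ := sn_small κ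
  refine ⟨r / 2, by positivity, 100 * B * (1 + B * |κ|) + 100 * B, by positivity, ?_⟩
  have main : ∀ s t d : ℝ, 0 < s → 0 < t → s ≤ t → t < r / 2 →
    |s - t| ≤ d → d ≤ s + t →
      |cosK κ s t d - (s ^ 2 + t ^ 2 - d ^ 2) / (2 * s * t)| ≤
        (100 * B * (1 + B * |κ|) + 100 * B) * (s + t) := by
    intro s t d hs ht hst htr hd1 hd2
    have hd0 : 0 ≤ d := (abs_nonneg _).trans hd1
    obtain ⟨s1, s2, s3, -⟩ := h s hs.le (by linarith)
    obtain ⟨t1, t2, t3, t4⟩ := h t ht.le (by linarith)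
    obtain ⟨d1, d2, d3, -⟩ := h d hd0 (by linarith)
    have hd1' := abs_le.1 hd1
    -- the function md x - x^2/2 is Lipschitz with small constant
    have hM : ∀ x ∈ Icc 0 (s + t), ∀ y ∈ Icc 0 (s + t),
        |(md κ x - x ^ 2 / 2) - (md κ y - y ^ 2 / 2)| ≤ B * (s + t) ^ 2 * |x - y| := by
      intro x hx y hy
      have := (convex_Icc 0 (s + t)).norm_image_sub_le_of_norm_hasDerivWithin_le
        (f := fun x => md κ x - x ^ 2 / 2) (f' := fun x => sn κ x - x) (C := B * (s + t) ^ 2)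
        (fun x hx => by
          have h2 : HasDerivAt (fun x : ℝ => x ^ 2 / 2) x x := by
            refine (((hasDerivAt_id x).pow 2).div_const 2).congr_deriv ?_
            simp
          exact ((hasDerivAt_md κ x).sub h2).hasDerivWithinAt)
        (fun x hx => by
          rw [Real.norm_eq_abs]
          refine (h x hx.1 (by linarith [hx.2])).2.1.trans ?_
          have := hx.1; have := hx.2
          gcongr) hy hx
      simpa only [Real.norm_eq_abs] using this
    have m1 := hM s ⟨hs.le, by linarith⟩ 0 ⟨le_rfl, by linarith⟩
    have m2 := hM t ⟨ht.le, by linarith⟩ d ⟨hd0, hd2⟩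
    simp only [md_zero, sub_zero, abs_of_pos hs] at m1
    have m1' : |md κ s - s ^ 2 / 2| ≤ B * (s + t) ^ 2 * s := by simpa using m1
    have htd : |t - d| ≤ s := by rw [abs_le]; constructor <;> linarith
    have m2' : |(md κ t - t ^ 2 / 2) - (md κ d - d ^ 2 / 2)| ≤ B * (s + t) ^ 2 * s :=
      m2.trans (by gcongr)
    have hsp : 0 < sn κ s := by linarith
    have htp : 0 < sn κ t := by linarith
    set A := (s ^ 2 + t ^ 2 - d ^ 2) / (2 * s * t) with hA
    have hA1 : |A| ≤ 1 := by
      rw [hA, abs_div, div_le_one (by positivity), abs_of_pos (by positivity : 0 < 2 * s * t),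
        abs_le]
      constructor <;> nlinarith
    have hAe : A * (s * t) = (s ^ 2 + t ^ 2 - d ^ 2) / 2 := by rw [hA]; field_simp
    have key : cosK κ s t d - A =
        ((md κ s - s ^ 2 / 2) + ((md κ t - t ^ 2 / 2) - (md κ d - d ^ 2 / 2))
          - κ * md κ s * md κ t - A * ((sn κ s - s) * sn κ t + s * (sn κ t - t)))
          / (sn κ s * sn κ t) := by
      unfold cosK
      rw [eq_div_iff (by positivity), sub_mul, div_mul_cancel₀ _ (by positivity)]
      linear_combination -hAe
    rw [key, abs_div, div_le_iff₀ (by positivity), abs_of_pos (mul_pos hsp htp)]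
    have hts : sn κ t ≤ 2 * t := by
      have := (abs_le.1 t2).2
      nlinarith
    have hst0 : 0 < s * t := mul_pos hs ht
    have hsum : 0 < s + t := by linarith
    have n1 : B * (s + t) ^ 2 * s ≤ 2 * B * ((s + t) * (s * t)) := by
      have : 0 ≤ B * (s + t) * s * (t - s) := by
        have := sub_nonneg.2 hst; positivity
      linarith
    have n2 : |κ * md κ s * md κ t| ≤ B ^ 2 * |κ| * ((s + t) * (s * t)) := by
      rw [abs_mul, abs_mul]
      calc _ ≤ |κ| * (B * s ^ 2) * (B * t ^ 2) := by gcongr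
        _ = B ^ 2 * |κ| * ((s * t) * (s * t)) := by ring
        _ ≤ _ := by gcongr; nlinarith [mul_nonneg hs.le ht.le]
    have n3 : |A * ((sn κ s - s) * sn κ t + s * (sn κ t - t))| ≤
        3 * B * ((s + t) * (s * t)) := by
      rw [abs_mul]
      calc _ ≤ 1 * ((B * s ^ 2) * (2 * t) + s * (B * t ^ 2)) := by
            refine mul_le_mul hA1 ((abs_add_le _ _).trans ?_) (abs_nonneg _) zero_le_one
            rw [abs_mul, abs_mul, abs_of_pos htp, abs_of_pos hs]
            gcongr
        _ ≤ _ := by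
            have : 0 ≤ B * s * s * t ∧ 0 ≤ B * s * t * t := ⟨by positivity, by positivity⟩
            linarith
    have n4 : s * t ≤ 4 * (sn κ s * sn κ t) := by nlinarith
    calc _ ≤ B * (s + t) ^ 2 * s + B * (s + t) ^ 2 * s + B ^ 2 * |κ| * ((s + t) * (s * t)) +
          3 * B * ((s + t) * (s * t)) :=
          (abs_sub _ _).trans (add_le_add ((abs_sub _ _).trans (add_le_add
            ((abs_add_le _ _).trans (add_le_add m1' m2')) n2)) n3)
      _ ≤ (7 * B + B ^ 2 * |κ|) * ((s + t) * (s * t)) := by linarith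
      _ ≤ (7 * B + B ^ 2 * |κ|) * ((s + t) * (4 * (sn κ s * sn κ t))) := by gcongr
      _ = (28 * B + 4 * B ^ 2 * |κ|) * (s + t) * (sn κ s * sn κ t) := by ring
      _ ≤ _ := by
        have : 28 * B + 4 * B ^ 2 * |κ| ≤ 100 * B * (1 + B * |κ|) + 100 * B := by
          nlinarith [mul_nonneg (sq_nonneg B) (abs_nonneg κ)]
        exact mul_le_mul_of_nonneg_right (mul_le_mul_of_nonneg_right this hsum.le) (by positivity)
  intro s t d hs ht hsr htr hd1 hd2
  rcases le_total s t with hst | hst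
  · exact main s t d hs ht hst htr hd1 hd2
  · have := main t s d ht hs hst hsr (by rwa [abs_sub_comm]) (by linarith)
    rw [cosK_comm, show s ^ 2 + t ^ 2 = t ^ 2 + s ^ 2 by ring,
      show 2 * s * t = 2 * t * s by ring, add_comm s t]
    exact this

/-! ### Comparison angles in metric spaces -/

lemma cosK_collinear {κ s t : ℝ} (hs : sn κ s ≠ 0) (ht : sn κ t ≠ 0) :
    cosK κ s t (s + t) = -1 := by
  unfold cosK
  rw [div_eq_iff (mul_ne_zero hs ht)]
  revert hs ht
  unfold sn md
  split_ifs with h1 h2 <;> intro hs ht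
  · have e : κ = √κ * √κ := (mul_self_sqrt h1.le).symm
    have : √κ ≠ 0 := (sqrt_pos.2 h1).ne'
    have : κ ≠ 0 := h1.ne'
    rw [div_mul_div_comm, ← e, mul_add, cos_add]
    field_simp
    ring
  · have h3 : 0 < -κ := by linarith
    have e : -κ = √(-κ) * √(-κ) := (mul_self_sqrt h3.le).symm
    have := h2.ne
    rw [div_mul_div_comm, ← e, mul_add, cosh_add]
    field_simp
    ring
  · have : κ = 0 := le_antisymm (not_lt.1 h1) (not_lt.1 h2)
    rw [this]; ring

lemma continuousAt_cosK {κ s t d : ℝ} (hs : sn κ s ≠ 0) (ht : sn κ t ≠ 0) :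
    ContinuousAt (fun q : ℝ × ℝ × ℝ => cosK κ q.1 q.2.1 q.2.2) (s, t, d) := by
  unfold cosK
  have h1 := continuous_md κ
  have h2 := continuous_sn κ
  refine ContinuousAt.div (by fun_prop) (by fun_prop) (mul_ne_zero hs ht)

/-- Cosine of the comparison angle. -/
noncomputable def ca {X : Type*} [MetricSpace X] (κ : ℝ) (x z y : X) : ℝ := cos (cangle κ x z y)

/-- Cosine of the Euclidean comparison angle. -/
noncomputable def ec {X : Type*} [MetricSpace X] (x z y : X) : ℝ :=
  (dist z x ^ 2 + dist z y ^ 2 - dist x y ^ 2) / (2 * dist z x * dist z y)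

section
variable {X : Type*} [MetricSpace X] {κ : ℝ}

lemma cangle_comm (x z y : X) : cangle κ x z y = cangle κ y z x := by
  unfold cangle
  rw [cangleK_eq, cangleK_eq, cosK_comm, dist_comm x y]

lemma ca_comm (x z y : X) : ca κ x z y = ca κ y z x := by
  unfold ca; rw [cangle_comm]

lemma ec_comm (x z y : X) : ec x z y = ec y z x := by
  unfold ec; rw [dist_comm x y]; ring

lemma cangle_nonneg (x z y : X) : 0 ≤ cangle κ x z y := by
  unfold cangle; rw [cangleK_eq]; exact arccos_nonneg _

lemma cangle_le_pi (x z y : X) : cangle κ x z y ≤ π := by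
  unfold cangle; rw [cangleK_eq]; exact arccos_le_pi _

lemma cangle_collinear {x z y : X} (h : dist x z + dist z y = dist x y)
    (hx : sn κ (dist z x) ≠ 0) (hy : sn κ (dist z y) ≠ 0) : cangle κ x z y = π := by
  unfold cangle
  rw [cangleK_eq, ← h, dist_comm x z, cosK_collinear hx hy, arccos_neg_one]

lemma abs_ec_le_one {x z y : X} : |ec x z y| ≤ 1 := by
  unfold ec
  rcases eq_or_ne (2 * dist z x * dist z y) 0 with h | h
  · rw [h]; simp
  have hp : 0 < 2 * dist z x * dist z y := lt_of_le_of_ne (by positivity) h.symm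
  rw [abs_div, abs_of_pos hp, div_le_one hp, abs_le]
  have h1 := dist_triangle x z y
  have h2 := dist_triangle z x y
  have h3 := dist_triangle z y x
  rw [dist_comm x z] at h1
  rw [dist_comm y x] at h3
  have := dist_nonneg (x := x) (y := y)
  constructor
  · nlinarith
  · have : |dist z x - dist z y| ≤ |dist x y| := by
      rw [abs_of_nonneg this, abs_le]; constructor <;> linarith
    nlinarith [sq_le_sq.2 this]

/-- Uniform Euclidean approximation of small comparison angles. -/
def KC (κ C R : ℝ) : Prop := 0 < R ∧ 0 ≤ C ∧ (∀ t, 0 < t → t < R → sn κ t ≠ 0) ∧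
  ∀ s t d : ℝ, 0 < s → 0 < t → s < R → t < R → |s - t| ≤ d → d ≤ s + t →
      |cosK κ s t d - (s ^ 2 + t ^ 2 - d ^ 2) / (2 * s * t)| ≤ C * (s + t)

lemma exists_KC (κ : ℝ) : ∃ C R, KC κ C R := by
  obtain ⟨r1, h1, -, B, -, h2⟩ := sn_small κ
  obtain ⟨r, hr, C, hC, h⟩ := cosK_small κ
  refine ⟨C, min r1 r, lt_min h1 hr, hC, fun t ht htr => ?_, fun s t d hs ht hsr htr => ?_⟩
  · have := (h2 t ht.le (htr.trans_le (min_le_left _ _))).2.2.1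
    intro h0; linarith
  · exact h s t d hs ht (hsr.trans_le (min_le_right _ _)) (htr.trans_le (min_le_right _ _))

lemma KC.ca_approx {C R : ℝ} (h : KC κ C R) {x z y : X} (hx : x ≠ z) (hy : y ≠ z)
    (hxR : dist z x < R) (hyR : dist z y < R) :
    |ca κ x z y - ec x z y| ≤ C * (dist z x + dist z y) := by
  unfold ca cangle
  rw [cangleK_eq]
  refine (abs_cos_arccos_sub_le abs_ec_le_one).trans ?_
  have h1 := dist_triangle x z y
  have h2 := dist_triangle z x y
  have h3 := dist_triangle z y x
  rw [dist_comm x z] at h1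
  rw [dist_comm y x] at h3
  exact h.2.2.2 _ _ _ (dist_pos.2 hx.symm) (dist_pos.2 hy.symm) hxR hyR
    (by rw [abs_le]; constructor <;> linarith) h1

/-- The point `c` is far from all points of the ball: comparison angles at points of the ball
between `c` and nearby points are computed by difference quotients of `dist c`. -/
def Far (κ : ℝ) (c p : X) (r C : ℝ) : Prop := 0 < r ∧ 0 ≤ C ∧
  (∀ x ∈ ball p r, sn κ (dist x c) ≠ 0) ∧
  ∀ x ∈ ball p r, ∀ y ∈ ball p r, y ≠ x →
    |ca κ c x y - (dist c x - dist c y) / dist x y| ≤ C * dist x y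

lemma Far.mono {c p p' : X} {r r' C C' : ℝ} (h : Far κ c p r C) (hr : 0 < r')
    (hC : C ≤ C') (hb : ball p' r' ⊆ ball p r) : Far κ c p' r' C' :=
  ⟨hr, h.2.1.trans hC, fun x hx => h.2.2.1 x (hb hx), fun x hx y hy hxy =>
    (h.2.2.2 x (hb hx) y (hb hy) hxy).trans (by gcongr)⟩

lemma Far.ne {c p : X} {r C : ℝ} (h : Far κ c p r C) {x : X} (hx : x ∈ ball p r) : c ≠ x := by
  rintro rfl
  exact h.2.2.1 _ hx (by rw [dist_self, sn_zero])

lemma exists_far {c p : X} (h : sn κ (dist p c) ≠ 0) : ∃ r > 0, ∃ C ≥ 0, Far κ c p r C := by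
  obtain ⟨r, hr, C, hC, h1⟩ := cosK_thin κ _ h
  have hd : ∀ x ∈ ball p (r / 2), |dist x c - dist p c| < r := fun x hx =>
    (abs_dist_sub_le _ _ _).trans_lt (by rw [mem_ball] at hx; linarith)
  refine ⟨r / 2, by positivity, C, hC, by positivity, hC, fun x hx => ?_, fun x hx y hy hxy => ?_⟩
  · exact (h1 _ (r/2) (dist x c) (hd x hx) (by positivity) (by linarith) (by simp; positivity)).1
  · unfold ca cangle
    rw [cangleK_eq]
    have hxy' : 0 < dist x y := dist_pos.2 hxy.symm
    have hlt : dist x y < r := by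
      have := dist_triangle_right x y p
      rw [mem_ball] at hx hy; linarith
    have hle : |dist x c - dist c y| ≤ dist x y := by
      rw [dist_comm c y]; exact abs_dist_sub_le _ _ _
    have := (h1 (dist x c) (dist x y) (dist c y) (hd x hx) hxy' hlt hle).2
    rw [dist_comm c x]
    refine (abs_cos_arccos_sub_le ?_).trans this
    rw [abs_div, abs_of_pos hxy', div_le_one hxy']
    exact hle

lemma neg_le_cos_add_cos {α β η : ℝ} (hα : 0 ≤ α) (hβ : 0 ≤ β)
    (hη : 0 ≤ η) (h : α + β ≤ π + η) : -η ≤ cos α + cos β := by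
  rcases le_total (α + β) π with h1 | h1
  · have : cos (π - β) ≤ cos α := cos_le_cos_of_nonneg_of_le_pi hα (by linarith) (by linarith)
    rw [cos_pi_sub] at this; linarith
  · have h2 : |cos (π - β) - cos α| ≤ |π - β - α| := abs_cos_sub_cos_le _ _
    rw [cos_pi_sub, abs_sub_comm (π - β), abs_of_nonneg (by linarith : 0 ≤ α - (π - β))] at h2
    have := (abs_le.1 h2).2
    linarith

lemma pi_sub_le_of_cos_le {α η : ℝ} (hα : 0 ≤ α) (hα' : α ≤ π) (hη : 0 ≤ η)
    (h : cos α ≤ -1 + η ^ 2 / 5) : π - η ≤ α := by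
  have h1 := cos_le_one_sub_mul_cos_sq (x := π - α) (by rw [abs_le]; constructor <;> linarith)
  rw [cos_pi_sub] at h1
  by_contra hc
  push Not at hc
  have h2 : η ^ 2 < (π - α) ^ 2 := by gcongr; linarith
  have h3 : 1 / 5 < 2 / π ^ 2 := by
    rw [div_lt_div_iff₀ (by norm_num) (by positivity)]
    nlinarith [pi_lt_d2, pi_pos]
  have h4 : 1 / 5 * (π - α) ^ 2 ≤ 2 / π ^ 2 * (π - α) ^ 2 := by gcongr
  linarith

lemma pi_div_two_sub_lt_of_cos_le {α η : ℝ} (hα' : 0 ≤ α) (hη : 0 < η)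
    (h : cos α ≤ η / 2) : π / 2 - η < α := by
  by_contra hc
  push Not at hc
  have h1 : sin (π / 2 - α) ≤ η / 2 := by rwa [sin_pi_div_two_sub]
  have h2 := mul_le_sin (x := π / 2 - α) (by linarith) (by linarith)
  have h3 : 2 / π * η ≤ 2 / π * (π / 2 - α) := by gcongr; linarith
  have h4 : 1 / 2 < 2 / π := by
    rw [div_lt_div_iff₀ (by norm_num) pi_pos]; linarith [pi_lt_four]
  nlinarith

lemma cos_lt_of_pi_div_two_sub_lt {α η : ℝ} (hα' : α ≤ π) (hη : 0 ≤ η)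
    (h : π / 2 - η < α) : cos α ≤ η := by
  by_cases h0 : π / 2 ≤ α
  · exact (cos_nonpos_of_pi_div_two_le_of_le h0 (by linarith)).trans hη
  · push Not at h0
    rw [← sin_pi_div_two_sub]
    exact (sin_le (by linarith)).trans (by linarith)

variable (hA : IsAlexandrov X κ)
include hA

lemma quad_cos {p q r s : X} (hq : q ≠ p) (hr : r ≠ p) (hs : s ≠ p) {η : ℝ} (hη : 0 ≤ η)
    (h : π - η ≤ cangle κ q p r) : -η ≤ ca κ q p s + ca κ r p s := by
  have := hA.2.2 p q r s hq hr hs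
  unfold ca
  rw [cangle_comm q p s]
  exact neg_le_cos_add_cos (cangle_nonneg _ _ _) (cangle_nonneg _ _ _) hη (by linarith)

lemma quad_cos' {p q r s : X} (hq : q ≠ p) (hr : r ≠ p) (hs : s ≠ p) {η : ℝ} (hη : 0 ≤ η)
    (h : ca κ q p r ≤ -1 + η ^ 2 / 5) : -η ≤ ca κ q p s + ca κ r p s :=
  quad_cos hA hq hr hs hη
    (pi_sub_le_of_cos_le (cangle_nonneg _ _ _) (cangle_le_pi _ _ _) hη h)

omit hA in
/-- Iterating a step relation. -/
lemma exists_seq_step {α : Type*} {P : ℕ → α → Prop} {R : ℕ → α → α → Prop} {x₀ : α}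
    (h0 : P 0 x₀) (hs : ∀ n x, P n x → ∃ y, P (n + 1) y ∧ R n x y) :
    ∃ f : ℕ → α, f 0 = x₀ ∧ (∀ n, P n (f n)) ∧ ∀ n, R n (f n) (f (n + 1)) := by
  choose! g hg using hs
  let F : ∀ n, α := fun n => Nat.rec x₀ (fun n x => g n x) n
  have hP : ∀ n, P n (F n) := fun n => by
    induction n with
    | zero => exact h0
    | succ n ih => exact (hg n _ ih).1
  exact ⟨F, rfl, hP, fun n => (hg n _ (hP n)).2⟩

lemma exists_pt_between (x y : X) {t : ℝ} (h0 : 0 ≤ t) (h1 : t ≤ 1) :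
    ∃ z, dist x z = t * dist x y ∧ dist z y = (1 - t) * dist x y := by
  have := hA.1
  set D := dist x y with hD
  have hD0 : 0 ≤ D := dist_nonneg
  let P : ℕ → X × X → Prop := fun n w => ∃ α β : ℝ, α ≤ t ∧ t ≤ β ∧ β - α = (1 / 2) ^ n ∧
    dist x w.1 = α * D ∧ dist w.1 w.2 = (β - α) * D ∧ dist w.2 y = (1 - β) * D
  obtain ⟨f, -, hP, hR⟩ := exists_seq_step (P := P)
    (R := fun n w w' => dist w.1 w'.1 ≤ D * (1 / 2) ^ n) (x₀ := (x, y))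
    ⟨0, 1, h0, h1, by norm_num, by simp, by simp [hD], by simp⟩ (by
      rintro n ⟨u, v⟩ ⟨α, β, hα, hβ, hαβ, e1, e2, e3⟩
      obtain ⟨w, hw1, hw2⟩ := hA.2.1 u v
      simp only at e1 e2 e3
      have t1 := dist_triangle x u w
      have t2 := dist_triangle x w y
      have t3 := dist_triangle w v y
      rw [e2] at hw1 hw2
      have e4 : dist x w = (α + β) / 2 * D := by
        apply le_antisymm <;> linarith
      have e5 : dist w y = (1 - (α + β) / 2) * D := by
        apply le_antisymm <;> linarith
      have hD2 : 0 ≤ D * (1/2) ^ n := by positivity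
      rcases le_total t ((α + β) / 2) with ht | ht
      · refine ⟨(u, w), ⟨α, (α + β) / 2, hα, ht, ?_, e1, ?_, e5⟩, ?_⟩
        · rw [pow_succ, ← hαβ]; ring
        · rw [hw1]; ring
        · simpa using hD2
      · refine ⟨(w, v), ⟨(α + β) / 2, β, ht, hβ, ?_, e4, ?_, e3⟩, ?_⟩
        · rw [pow_succ, ← hαβ]; ring
        · rw [hw2]; ring
        · simp only
          rw [hw1, hαβ]; linarith)
  have hc : CauchySeq (fun n => (f n).1) := cauchySeq_of_le_geometric (1/2) D (by norm_num) hR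
  obtain ⟨z, hz⟩ := cauchySeq_tendsto_of_complete hc
  have hlim : Filter.Tendsto (fun n : ℕ => D * (1/2 : ℝ) ^ n) Filter.atTop (nhds 0) := by
    simpa using (tendsto_pow_atTop_nhds_zero_of_lt_one (by norm_num : (0:ℝ) ≤ 1/2)
      (by norm_num)).const_mul D
  have k1 : dist x z = t * D := by
    refine tendsto_nhds_unique (tendsto_const_nhds.dist hz) ?_
    have : Filter.Tendsto (fun n : ℕ => dist x (f n).1 - t * D) Filter.atTop (nhds 0) := by
      refine squeeze_zero_norm (fun n => ?_) hlim
      obtain ⟨α, β, hα, hβ, hαβ, e1, e2, e3⟩ := hP n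
      rw [e1, Real.norm_eq_abs, ← sub_mul, abs_mul, abs_of_nonneg hD0, mul_comm]
      gcongr
      rw [abs_le]; constructor <;> linarith
    simpa using this.add_const (t * D)
  have k2 : dist z y ≤ (1 - t) * D := by
    have : Filter.Tendsto (fun n : ℕ => (1 - t) * D + D * (1/2 : ℝ) ^ n) Filter.atTop
        (nhds ((1 - t) * D + 0)) := hlim.const_add _
    rw [add_zero] at this
    refine le_of_tendsto_of_tendsto (hz.dist tendsto_const_nhds) this
      (Filter.Eventually.of_forall fun n => ?_)
    obtain ⟨α, β, hα, hβ, hαβ, e1, e2, e3⟩ := hP n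
    have := dist_triangle (f n).1 (f n).2 y
    have h4 : (t - α) * D ≤ (β - α) * D := by gcongr
    show dist (f n).1 y ≤ (1 - t) * D + D * (1/2 : ℝ) ^ n
    rw [← hαβ]
    linarith
  refine ⟨z, k1, le_antisymm k2 ?_⟩
  have := dist_triangle x z y
  linarith

/-- Concavity estimate for `dist c`. -/
lemma Far.concave {c p : X} {r C C₀ R : ℝ} (h : Far κ c p r C) (hK : KC κ C₀ R)
    (hr : 2 * r ≤ R) {w v M : X} (hw : w ∈ ball p r) (hv : v ∈ ball p r) (hM : M ∈ ball p r)
    {θ : ℝ} (hθ : 0 ≤ θ) (hθ1 : θ ≤ 1) (h1 : dist w M = θ * dist w v)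
    (h2 : dist M v = (1 - θ) * dist w v) :
    (1 - θ) * dist c w + θ * dist c v - C * (θ * (1 - θ)) * dist w v ^ 2 ≤ dist c M := by
  rcases eq_or_ne w M with rfl | hwM
  · rw [dist_self] at h1
    rcases eq_or_ne w v with rfl | hwv
    · rw [dist_self]; apply le_of_eq; ring
    · have : θ = 0 := (mul_eq_zero.1 h1.symm).resolve_right (dist_ne_zero.2 hwv)
      rw [this]; simp
  rcases eq_or_ne v M with rfl | hvM
  · rw [dist_self] at h2
    have : 1 - θ = 0 := (mul_eq_zero.1 h2.symm).resolve_right (dist_ne_zero.2 hwM)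
    have : θ = 1 := by linarith
    rw [this]; simp
  have hw0 := dist_pos.2 hwM
  have hv0 := dist_pos.2 hvM.symm
  have hsm : ∀ x ∈ ball p r, dist M x < R := fun x hx => by
    have := dist_triangle_right M x p; rw [mem_ball] at hx hM; linarith
  have hcol : cangle κ w M v = π := cangle_collinear (by rw [h1, h2]; ring)
    (hK.2.2.1 _ (by rwa [dist_comm]) (hsm w hw)) (hK.2.2.1 _ hv0 (hsm v hv))
  have q := quad_cos hA hwM hvM (h.ne hM) le_rfl (by rw [hcol]; simp)
  rw [ca_comm w, ca_comm v] at q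
  have a1 := (abs_le.1 (h.2.2.2 M hM w hw hwM)).2
  have a2 := (abs_le.1 (h.2.2.2 M hM v hv hvM)).2
  rw [dist_comm M w] at a1
  have b1 : (dist c M - dist c w) / dist w M * dist w M = dist c M - dist c w :=
    div_mul_cancel₀ _ hw0.ne'
  have b2 : (dist c M - dist c v) / dist M v * dist M v = dist c M - dist c v :=
    div_mul_cancel₀ _ hv0.ne'
  set A := (dist c M - dist c w) / dist w M
  set B := (dist c M - dist c v) / dist M v
  have hL : 0 < dist w v := by
    rcases (dist_nonneg (x := w) (y := v)).lt_or_eq with hl | hl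
    · exact hl
    · rw [← hl] at h1; simp at h1; exact absurd h1 hwM
  have hAB : -(C * dist w v) ≤ A + B := by
    have : dist w M + dist M v = dist w v := by rw [h1, h2]; ring
    nlinarith [h.2.1]
  have : -(C * dist w v) * (θ * (1 - θ) * dist w v) ≤ (A + B) * (θ * (1 - θ) * dist w v) := by
    apply mul_le_mul_of_nonneg_right hAB
    have := sub_nonneg.2 hθ1; positivity
  have e1 : A * (θ * (1 - θ) * dist w v) = (1 - θ) * (dist c M - dist c w) := by
    rw [← b1, h1]; ring
  have e2 : B * (θ * (1 - θ) * dist w v) = θ * (dist c M - dist c v) := by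
    rw [← b2, h2]; ring
  rw [add_mul, e1, e2] at this
  nlinarith

/-- Stewart type inequality. -/
lemma stewart {C R : ℝ} (hK : KC κ C R) {w v M u : X} (hw : dist M w < R) (hv : dist M v < R)
    (hu : dist M u < R) {θ : ℝ} (hθ : 0 ≤ θ) (hθ1 : θ ≤ 1) (h1 : dist w M = θ * dist w v)
    (h2 : dist M v = (1 - θ) * dist w v) :
    (1 - θ) * dist u w ^ 2 + θ * dist u v ^ 2 - θ * (1 - θ) * dist w v ^ 2 ≤
      dist M u ^ 2 + 2 * C * dist M u * (θ * (1 - θ) * dist w v) * (2 * dist M u + dist w v) := by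
  have hC := hK.2.1
  rcases eq_or_ne u M with rfl | huM
  · rw [h2, dist_comm u w, h1, dist_self]; apply le_of_eq; ring
  rcases eq_or_ne w M with rfl | hwM
  · rw [dist_self] at h1
    rcases eq_or_ne w v with rfl | hwv
    · simp only [dist_self, dist_comm u w]; nlinarith
    · have : θ = 0 := (mul_eq_zero.1 h1.symm).resolve_right (dist_ne_zero.2 hwv)
      rw [this, dist_comm u w]; simp
  rcases eq_or_ne v M with rfl | hvM
  · rw [dist_self] at h2
    have : 1 - θ = 0 := (mul_eq_zero.1 h2.symm).resolve_right (dist_ne_zero.2 hwM)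
    have : θ = 1 := by linarith
    rw [this, dist_comm v u]; simp
  have hw0 := dist_pos.2 hwM
  have hv0 := dist_pos.2 hvM.symm
  have hu0 := dist_pos.2 huM.symm
  have hcol : cangle κ w M v = π := cangle_collinear (by rw [h1, h2]; ring)
    (hK.2.2.1 _ (by rwa [dist_comm]) hw) (hK.2.2.1 _ hv0 hv)
  have q := quad_cos hA hwM hvM huM le_rfl (by rw [hcol]; simp)
  have a1 := (abs_le.1 (hK.ca_approx hwM huM hw hu)).2
  have a2 := (abs_le.1 (hK.ca_approx hvM huM hv hu)).2
  have hL : 0 < dist w v := by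
    rcases (dist_nonneg (x := w) (y := v)).lt_or_eq with hl | hl
    · exact hl
    · rw [← hl] at h1; simp at h1; exact absurd h1 hwM
  have hθ0 : 0 < θ := by
    by_contra hh; have : θ = 0 := le_antisymm (not_lt.1 hh) hθ
    rw [this, zero_mul] at h1; exact hwM (dist_eq_zero.1 h1)
  have hθ2 : 0 < 1 - θ := by
    by_contra hh; have : 1 - θ = 0 := le_antisymm (not_lt.1 hh) (by linarith)
    rw [this, zero_mul] at h2; exact hvM (dist_eq_zero.1 h2).symm
  have e1 : ec w M u * (2 * dist M u * (θ * (1 - θ) * dist w v)) =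
      (1 - θ) * (dist M u ^ 2 + θ ^ 2 * dist w v ^ 2 - dist u w ^ 2) := by
    unfold ec
    rw [dist_comm M w, h1, dist_comm w u]
    field_simp
    ring
  have e2 : ec v M u * (2 * dist M u * (θ * (1 - θ) * dist w v)) =
      θ * (dist M u ^ 2 + (1 - θ) ^ 2 * dist w v ^ 2 - dist u v ^ 2) := by
    unfold ec
    rw [h2, dist_comm v u]
    field_simp
    ring
  have hAB : -(C * (2 * dist M u + dist w v)) ≤ ec w M u + ec v M u := by
    have : dist M w + dist M v = dist w v := by rw [dist_comm M w, h1, h2]; ring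
    rw [← this]
    nlinarith
  have := mul_le_mul_of_nonneg_right hAB
    (by positivity : 0 ≤ 2 * dist M u * (θ * (1 - θ) * dist w v))
  rw [add_mul, e1, e2] at this
  nlinarith

omit hA in
/-- Distance to a far point grows when moving to a critical point. -/
lemma Far.crit {c p q y : X} {r C : ℝ} (h : Far κ c p r C) (hq : q ∈ ball p r)
    (hy : y ∈ ball p r) (hcr : IsCriticalPt κ q y) :
    dist c q - C * dist q y ^ 2 ≤ dist c y := by
  rcases eq_or_ne q y with rfl | hqy
  · simp
  have h1 : 0 ≤ ca κ c y q := by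
    rw [ca_comm]
    exact cos_nonneg_of_neg_pi_div_two_le_of_le
      (by linarith [cangle_nonneg (κ := κ) q y c, pi_pos]) (hcr c (h.ne hy))
  have h2 := (abs_le.1 (h.2.2.2 y hy q hq hqy)).2
  have hd := dist_pos.2 hqy
  rw [dist_comm y q] at h2
  have h3 : -(C * dist q y) ≤ (dist c y - dist c q) / dist q y := by linarith
  rw [le_div_iff₀ hd] at h3
  nlinarith

end

section
variable {X : Type*} [MetricSpace X] {κ : ℝ}

/-! ### Strainers -/

lemma sn_ne_zero_of_cangle {x z y : X} (h : cangle κ x z y ≠ π / 2) :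
    sn κ (dist z x) ≠ 0 ∧ sn κ (dist z y) ≠ 0 := by
  unfold cangle at h
  rw [cangleK_eq] at h
  constructor <;> intro h0 <;> apply h <;> unfold cosK <;> rw [h0] <;> simp

lemma continuousAt_cangle {c c' p : X} (h : sn κ (dist p c) ≠ 0) (h' : sn κ (dist p c') ≠ 0) :
    ContinuousAt (fun x => cangle κ c x c') p := by
  unfold cangle
  simp_rw [cangleK_eq]
  refine continuous_arccos.continuousAt.comp ?_
  exact ContinuousAt.comp (f := fun x => (dist x c, dist x c', dist c c'))
    (continuousAt_cosK h h') (by fun_prop)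

lemma IsStrainer.mono {k : ℕ} {a b : Fin k → X} {p : X} {δ δ' : ℝ} (h : IsStrainer κ a b p δ)
    (hδ : δ ≤ δ') : IsStrainer κ a b p δ' :=
  ⟨fun i => by linarith [h.1 i], fun i j hij => by
    obtain ⟨h1, h2, h3⟩ := h.2 i j hij
    exact ⟨by linarith, by linarith, by linarith⟩⟩

lemma IsStrainedPt.mono_left {k l : ℕ} {p : X} {δ : ℝ} (h : IsStrainedPt κ k δ p)
    (hl : l ≤ k) : IsStrainedPt κ l δ p := by
  obtain ⟨a, b, h⟩ := h
  exact ⟨a ∘ Fin.castLE hl, b ∘ Fin.castLE hl, fun i => h.1 _,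
    fun i j hij => h.2 _ _ fun e => hij (Fin.castLE_injective hl e)⟩

lemma isStrainedPt_zero {p : X} {δ : ℝ} : IsStrainedPt κ 0 δ p :=
  ⟨Fin.elim0, Fin.elim0, fun i => i.elim0, fun i => i.elim0⟩

/-- A strainer together with a ball on which all comparison angles are controlled. -/
structure SData (κ C₀ R : ℝ) {m : ℕ} (a b : Fin m → X) (p : X) (r C δ : ℝ) : Prop where
  hr : 0 < r
  hC : 0 ≤ C
  hδ : 0 < δ
  kc : KC κ C₀ R
  hrR : 100 * r ≤ R
  hC₀ : C₀ ≤ C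
  hsm : 100 * C * r ≤ δ
  far_a : ∀ i, Far κ (a i) p r C
  far_b : ∀ i, Far κ (b i) p r C
  str : ∀ x ∈ ball p r, IsStrainer κ a b x δ

lemma SData.mono {C₀ R : ℝ} {m : ℕ} {a b : Fin m → X} {p : X} {r C δ : ℝ}
    (h : SData κ C₀ R a b p r C δ) {p' : X} {r' : ℝ} (hr' : 0 < r') (hrr : r' ≤ r)
    (hb : ball p' r' ⊆ ball p r) : SData κ C₀ R a b p' r' C δ where
  hr := hr'
  hC := h.hC
  hδ := h.hδ
  kc := h.kc
  hrR := by linarith [h.hrR]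
  hC₀ := h.hC₀
  hsm := le_trans (by have := h.hC; gcongr) h.hsm
  far_a i := (h.far_a i).mono hr' le_rfl hb
  far_b i := (h.far_b i).mono hr' le_rfl hb
  str x hx := h.str x (hb hx)

lemma exists_sdata {C₀ R : ℝ} (hK : KC κ C₀ R) {m : ℕ} {a b : Fin m → X} {p : X} {δ : ℝ}
    (hδ : 0 < δ) (hδ1 : δ ≤ 1) (h : IsStrainer κ a b p δ) :
    ∃ r C, SData κ C₀ R a b p r C δ := by
  have hs : ∀ i, sn κ (dist p (a i)) ≠ 0 ∧ sn κ (dist p (b i)) ≠ 0 := fun i =>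
    sn_ne_zero_of_cangle (by have := h.1 i; have := pi_gt_three; intro hh; linarith)
  choose ra hra Ca hCa hfa using fun i => exists_far (hs i).1
  choose rb hrb Cb hCb hfb using fun i => exists_far (hs i).2
  have hstr : ∀ᶠ x in nhds p, IsStrainer κ a b x δ := by
    unfold IsStrainer
    refine Filter.Eventually.and ?_ ?_
    · exact Filter.eventually_all.2 fun i =>
        (continuousAt_cangle (hs i).1 (hs i).2).eventually (lt_mem_nhds (h.1 i))
    · refine Filter.eventually_all.2 fun i => Filter.eventually_all.2 fun j => ?_
      by_cases hij : i = j
      · simp [hij]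
      · obtain ⟨h1, h2, h3⟩ := h.2 i j hij
        filter_upwards [(continuousAt_cangle (hs i).1 (hs j).1).eventually (lt_mem_nhds h1),
          (continuousAt_cangle (hs i).1 (hs j).2).eventually (lt_mem_nhds h2),
          (continuousAt_cangle (hs i).2 (hs j).2).eventually (lt_mem_nhds h3)] with x k1 k2 k3
        exact fun _ => ⟨k1, k2, k3⟩
  obtain ⟨r0, hr0, hb0⟩ := Metric.eventually_nhds_iff_ball.1 hstr
  obtain ⟨C, hC⟩ := (Set.finite_range (fun i => max (Ca i) (Cb i))).bddAbove
  set C' := max (max C C₀) 0 with hC'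
  have hCa' : ∀ i, Ca i ≤ C' := fun i => (le_max_left _ _).trans
    ((hC (mem_range_self i)).trans ((le_max_left _ _).trans (le_max_left _ _)))
  have hCb' : ∀ i, Cb i ≤ C' := fun i => (le_max_right _ _).trans
    ((hC (mem_range_self i)).trans ((le_max_left _ _).trans (le_max_left _ _)))
  have hev : ∀ᶠ r in nhdsWithin (0:ℝ) (Ioi 0), 0 < r ∧ r ≤ r0 ∧ 100 * r ≤ R ∧ 100 * C' * r ≤ δ ∧
      ∀ i, r ≤ ra i ∧ r ≤ rb i := by
    have h1 : ∀ ρ > 0, ∀ᶠ r in nhdsWithin (0:ℝ) (Ioi 0), r ≤ ρ := fun ρ hρ =>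
      mem_nhdsWithin_of_mem_nhds (Iic_mem_nhds hρ)
    have h2 : ∀ᶠ r in nhdsWithin (0:ℝ) (Ioi 0), 100 * C' * r ≤ δ := by
      refine mem_nhdsWithin_of_mem_nhds ?_
      have : Filter.Tendsto (fun r : ℝ => 100 * C' * r) (nhds 0) (nhds (100 * C' * 0)) :=
        Filter.tendsto_id.const_mul _
      rw [mul_zero] at this
      exact this.eventually (Iic_mem_nhds hδ)
    filter_upwards [h1 _ hr0, h1 (R / 100) (by have := hK.1; positivity), h2, self_mem_nhdsWithin,
      Filter.eventually_all.2 fun i => (h1 _ (hra i)).and (h1 _ (hrb i))] with r k1 k2 k3 k4 k5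
    exact ⟨k4, k1, by linarith, k3, k5⟩
  obtain ⟨r, hr, hrr, hrR, hrδ, hri⟩ := hev.exists
  exact ⟨r, C', hr, le_max_right _ _, hδ, hK, hrR, (le_max_right _ _).trans (le_max_left _ _), hrδ,
    fun i => (hfa i).mono hr (hCa' i) (ball_subset_ball (hri i).1),
    fun i => (hfb i).mono hr (hCb' i) (ball_subset_ball (hri i).2),
    fun x hx => hb0 x (ball_subset_ball hrr hx)⟩

section
variable {C₀ R : ℝ} {m : ℕ} {a b : Fin m → X} {p : X} {r C δ : ℝ}

lemma SData.swap (h : SData κ C₀ R a b p r C δ) : SData κ C₀ R b a p r C δ where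
  hr := h.hr
  hC := h.hC
  hδ := h.hδ
  kc := h.kc
  hrR := h.hrR
  hC₀ := h.hC₀
  hsm := h.hsm
  far_a := h.far_b
  far_b := h.far_a
  str x hx := ⟨fun i => by rw [cangle_comm]; exact (h.str x hx).1 i, fun i j hij => by
    obtain ⟨h1, h2, h3⟩ := (h.str x hx).2 i j hij
    obtain ⟨-, h2', -⟩ := (h.str x hx).2 j i hij.symm
    exact ⟨h3, by rwa [cangle_comm], h1⟩⟩

lemma dist_lt_of_mem_ball {x y p : X} {r : ℝ} (hx : x ∈ ball p r) (hy : y ∈ ball p r) :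
    dist x y < 2 * r := by
  have := dist_triangle_right x y p
  rw [mem_ball] at hx hy; linarith

/-- The sum of distances to a strainer pair is almost constant. -/
lemma SData.sum_le (hA : IsAlexandrov X κ) (h : SData κ C₀ R a b p r C δ) (i : Fin m) {x y : X}
    (hx : x ∈ ball p r) (hy : y ∈ ball p r) :
    |(dist (a i) x + dist (b i) x) - (dist (a i) y + dist (b i) y)| ≤ 2 * δ * dist x y := by
  have main : ∀ x ∈ ball p r, ∀ y ∈ ball p r,
      (dist (a i) y + dist (b i) y) - (dist (a i) x + dist (b i) x) ≤ 2 * δ * dist x y := by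
    intro x hx y hy
    rcases eq_or_ne y x with rfl | hyx
    · simp
    have hd := dist_pos.2 hyx.symm
    have q := quad_cos hA ((h.far_a i).ne hx) ((h.far_b i).ne hx) hyx h.hδ.le
      ((h.str x hx).1 i).le
    have a1 := (abs_le.1 ((h.far_a i).2.2.2 x hx y hy hyx)).2
    have a2 := (abs_le.1 ((h.far_b i).2.2.2 x hx y hy hyx)).2
    have hs : 2 * C * dist x y ≤ δ := by
      have := dist_lt_of_mem_ball hx hy
      have := h.hsm; have := h.hC; have := h.hr
      nlinarith
    have : -(2 * δ) ≤ ((dist (a i) x - dist (a i) y) + (dist (b i) x - dist (b i) y)) / dist x y := by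
      rw [add_div]; linarith
    rw [le_div_iff₀ hd] at this
    linarith
  rw [abs_le]
  have h1 := main x hx y hy
  have h2 := main y hy x hx
  rw [dist_comm y x] at h2
  constructor <;> linarith

/-- Moving towards a far point. -/
lemma Far.move (hA : IsAlexandrov X κ) {c : X} (hc : Far κ c p r C) (hK : KC κ C₀ R)
    (hrR : r ≤ R) {x : X} {s : ℝ} (hs : 0 < s) (hsr : dist x p + s < r) :
    ∃ q, dist x q = s ∧ q ∈ ball p r ∧ dist c q = dist c x - s ∧ ∀ c' C', Far κ c' p r C' →
      -(ca κ c' q c) * s - C' * s ^ 2 ≤ dist c' q - dist c' x := by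
  have hx : x ∈ ball p r := by rw [mem_ball]; linarith
  have hcx : s < dist x c := by
    by_contra hh
    push Not at hh
    have : c ∈ ball p r := by
      rw [mem_ball]; have := dist_triangle c x p; rw [dist_comm c x] at this; linarith
    exact hc.ne this rfl
  have hcx0 : 0 < dist x c := hs.trans hcx
  obtain ⟨q, h1, h2⟩ := exists_pt_between hA x c (t := s / dist x c) (by positivity)
    (by rw [div_le_one hcx0]; exact hcx.le)
  have e1 : s / dist x c * dist x c = s := div_mul_cancel₀ _ hcx0.ne'
  rw [e1] at h1
  rw [sub_mul, e1, one_mul] at h2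
  have hq : q ∈ ball p r := by
    rw [mem_ball]; have := dist_triangle q x p; rw [dist_comm q x] at this; linarith
  refine ⟨q, h1, hq, by rw [dist_comm c q, dist_comm c x, h2], fun c' C' hc' => ?_⟩
  have hxq : x ≠ q := by intro e; rw [e, dist_self] at h1; linarith
  have hcol : cangle κ x q c = π := cangle_collinear (by rw [h1, h2]; ring)
    (hK.2.2.1 _ (by rw [dist_comm, h1]; exact hs)
      (by rw [dist_comm, h1]; have := dist_nonneg (x := x) (y := p); linarith)) (hc.2.2.1 q hq)
  have q4 := quad_cos hA hxq (hc.ne hq) (hc'.ne hq) le_rfl (by rw [hcol]; simp)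
  have a1 := (abs_le.1 (hc'.2.2.2 q hq x hx hxq)).2
  rw [ca_comm c', ] at a1
  rw [dist_comm q x, h1] at a1
  rw [ca_comm c'] 
  have : -(ca κ c q c') - C' * s ≤ (dist c' q - dist c' x) / s := by linarith
  rw [le_div_iff₀ hs] at this
  nlinarith

/-- Coordinate moves: moving towards `a i` decreases the `i`-th distance and almost preserves
the others. -/
lemma SData.move_neg (hA : IsAlexandrov X κ) (h : SData κ C₀ R a b p r C δ) (i : Fin m) {x : X}
    {s : ℝ} (hs : 0 < s) (hsr : dist x p + s < r) :
    ∃ q, dist x q = s ∧ q ∈ ball p r ∧ dist (a i) q = dist (a i) x - s ∧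
      ∀ j, (j ≠ i → |dist (a j) q - dist (a j) x| ≤ 4 * δ * s ∧
        |dist (b j) q - dist (b j) x| ≤ 4 * δ * s) ∧
        (j = i → |dist (b j) q - dist (b j) x - s| ≤ 4 * δ * s) := by
  have hx : x ∈ ball p r := by rw [mem_ball]; linarith
  have hrR : r ≤ R := by have := h.hr; have := h.hrR; linarith
  obtain ⟨q, h1, hq, h2, h3⟩ := (h.far_a i).move hA h.kc hrR hs hsr
  refine ⟨q, h1, hq, h2, fun j => ?_⟩
  have hsum := abs_le.1 (h.sum_le hA j hq hx)
  rw [dist_comm q x, h1] at hsum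
  have hds : 0 < δ * s := mul_pos h.hδ hs
  constructor
  · intro hj
    have hst := h.str q hq
    have hc : C * s ^ 2 ≤ δ * s := by
      have := h.hC; have := h.hsm; have hr := h.hr
      have : C * s ≤ δ := by
        have : s ≤ r := by have := dist_nonneg (x := x) (y := p); linarith
        nlinarith
      nlinarith
    have ka : ca κ (a j) q (a i) ≤ δ := cos_lt_of_pi_div_two_sub_lt (cangle_le_pi _ _ _) h.hδ.le
      (hst.2 j i hj).1
    have kb : ca κ (b j) q (a i) ≤ δ := cos_lt_of_pi_div_two_sub_lt (cangle_le_pi _ _ _) h.hδ.le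
      (by rw [cangle_comm]; exact (hst.2 i j hj.symm).2.1)
    have la := h3 _ _ (h.far_a j)
    have lb := h3 _ _ (h.far_b j)
    have ka' : ca κ (a j) q (a i) * s ≤ δ * s := by gcongr
    have kb' : ca κ (b j) q (a i) * s ≤ δ * s := by gcongr
    rw [abs_le, abs_le]
    refine ⟨⟨?_, ?_⟩, ⟨?_, ?_⟩⟩ <;> linarith
  · rintro rfl
    rw [abs_le]
    constructor <;> linarith

/-- Both kinds of coordinate moves. -/
lemma SData.move (hA : IsAlexandrov X κ) (h : SData κ C₀ R a b p r C δ) (i : Fin m) {x : X}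
    {s : ℝ} (hs : 0 < s) (hsr : dist x p + s < r) (σ : ℝ) (hσ : σ = 1 ∨ σ = -1) :
    ∃ q, dist x q = s ∧ q ∈ ball p r ∧
      ∀ j, |dist (a j) q - dist (a j) x - (if j = i then σ * s else 0)| ≤ 4 * δ * s ∧
        |dist (b j) q - dist (b j) x + (if j = i then σ * s else 0)| ≤ 4 * δ * s := by
  have hds : 0 < δ * s := mul_pos h.hδ hs
  rcases hσ with rfl | rfl
  · obtain ⟨q, h1, h2, h3, h4⟩ := h.swap.move_neg hA i hs hsr
    refine ⟨q, h1, h2, fun j => ?_⟩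
    by_cases hj : j = i
    · subst hj
      have := (h4 j).2 rfl
      simp only [if_true, one_mul]
      refine ⟨this, ?_⟩
      rw [h3, abs_le]; constructor <;> linarith
    · have := (h4 j).1 hj
      simpa [hj] using this.symm
  · obtain ⟨q, h1, h2, h3, h4⟩ := h.move_neg hA i hs hsr
    refine ⟨q, h1, h2, fun j => ?_⟩
    by_cases hj : j = i
    · subst hj
      have := (h4 j).2 rfl
      simp only [if_true, neg_one_mul]
      refine ⟨?_, by rwa [← sub_eq_add_neg]⟩
      rw [h3, abs_le]; constructor <;> linarith
    · have := (h4 j).1 hj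
      simpa [hj] using this

/-- Adding a pair of nearby points to a strainer. -/
lemma SData.add_strainer (hA : IsAlexandrov X κ) (h : SData κ C₀ R a b p r C δ) {z u w : X}
    (hz : z ∈ ball p r) (hu : u ∈ ball p r) (hw : w ∈ ball p r) (huz : u ≠ z) (hwz : w ≠ z)
    {η c : ℝ} (hη : 0 < η) (hc : 0 ≤ c) (hcη : c + 3 * δ ≤ η / 2)
    (hang : ec u z w + C * (dist z u + dist z w) ≤ -1 + η ^ 2 / 20)
    (hfu : ∀ i, |dist (a i) u - dist (a i) z| ≤ c * dist z u)
    (hfw : ∀ i, |dist (a i) w - dist (a i) z| ≤ c * dist z w) :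
    IsStrainedPt κ (m + 1) η z := by
  have hδ := h.hδ
  have key : ∀ v ∈ ball p r, v ≠ z → (∀ i, |dist (a i) v - dist (a i) z| ≤ c * dist z v) →
      ∀ i, π / 2 - η < cangle κ (a i) z v ∧ π / 2 - η < cangle κ (b i) z v := by
    intro v hv hvz hf i
    have hd := dist_pos.2 hvz.symm
    have hs : C * dist z v ≤ δ := by
      have := dist_lt_of_mem_ball hz hv
      have := h.hsm; have := h.hC; have := h.hr
      nlinarith
    have hsum := abs_le.1 (h.sum_le hA i hz hv)
    have hfi := abs_le.1 (hf i)
    constructor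
    · refine pi_div_two_sub_lt_of_cos_le (cangle_nonneg _ _ _) hη ?_
      have a1 := (abs_le.1 ((h.far_a i).2.2.2 z hz v hv hvz)).2
      have : (dist (a i) z - dist (a i) v) / dist z v ≤ c := by
        rw [div_le_iff₀ hd]; linarith
      unfold ca at a1
      linarith
    · refine pi_div_two_sub_lt_of_cos_le (cangle_nonneg _ _ _) hη ?_
      have a1 := (abs_le.1 ((h.far_b i).2.2.2 z hz v hv hvz)).2
      have : (dist (b i) z - dist (b i) v) / dist z v ≤ c + 2 * δ := by
        rw [div_le_iff₀ hd]; linarith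
      unfold ca at a1
      linarith
  have ku := key u hu huz hfu
  have kw := key w hw hwz hfw
  have hRr := h.hrR
  have hr := h.hr
  have hwu : π - η < cangle κ u z w := by
    have h1 := (abs_le.1 (h.kc.ca_approx huz hwz
      (by linarith [dist_lt_of_mem_ball hz hu]) (by linarith [dist_lt_of_mem_ball hz hw]))).2
    have h2 : C₀ * (dist z u + dist z w) ≤ C * (dist z u + dist z w) := by
      have := h.hC₀; gcongr
    have := pi_sub_le_of_cos_le (cangle_nonneg (κ := κ) u z w) (cangle_le_pi _ _ _)
      (half_pos hη).le (by unfold ca at h1; linarith)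
    linarith
  have hst := (h.str z hz).mono (show δ ≤ η by linarith)
  refine ⟨Fin.snoc a u, Fin.snoc b w, fun i => ?_, fun i j => ?_⟩
  · refine Fin.lastCases ?_ (fun i => ?_) i
    · simpa using hwu
    · simpa using hst.1 i
  · refine Fin.lastCases ?_ (fun i => ?_) i
    · refine Fin.lastCases (fun hh => absurd rfl hh) (fun j _ => ?_) j
      simp only [Fin.snoc_last, Fin.snoc_castSucc]
      exact ⟨by rw [cangle_comm]; exact (ku j).1, by rw [cangle_comm]; exact (ku j).2,
        by rw [cangle_comm]; exact (kw j).2⟩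
    · refine Fin.lastCases (fun _ => ?_) (fun j hij => ?_) j
      · simp only [Fin.snoc_last, Fin.snoc_castSucc]
        exact ⟨(ku i).1, (kw i).1, (kw i).2⟩
      · simp only [Fin.snoc_castSucc]
        exact hst.2 i j (fun e => hij (by rw [e]))

end
end

section
variable {X : Type*} [MetricSpace X]

/-! ### Open maps -/

/-- Almost coordinate moves within `E`. -/
def HasMoves {ι : Type*} [DecidableEq ι] (G : X → ι → ℝ) (E : Set X) (z : X) (r μ : ℝ) : Prop :=
  ∀ x ∈ E ∩ ball z r, ∀ i, ∀ σ : ℝ, (σ = 1 ∨ σ = -1) → ∀ s, 0 < s → s < r →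
    ∃ y ∈ E, dist x y ≤ 2 * s ∧ ∀ j, |G y j - G x j - (if j = i then σ * s else 0)| ≤ μ * s

lemma HasMoves.exists_eq [CompleteSpace X] {ι : Type*} [Fintype ι] [DecidableEq ι]
    {G : X → ι → ℝ} (hG : Continuous G) {E : Set X} (hE : IsClosed E) {z : X} {r μ : ℝ}
    (h : HasMoves G E z r μ) (hμ : μ * Fintype.card ι ≤ 1 / 4) {x : X}
    (hx : x ∈ E) {T : ι → ℝ} (hT : dist x z + 4 * ∑ j, |T j - G x j| < r) :
    ∃ y ∈ E, G y = T ∧ dist x y ≤ 4 * ∑ j, |T j - G x j| := by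
  set φ : X → ℝ := fun y => ∑ j, |T j - G y j| with hφ
  have hφ0 : ∀ y, 0 ≤ φ y := fun y => Finset.sum_nonneg fun _ _ => abs_nonneg _
  have hT' : dist x z + 4 * φ x < r := hT
  change ∃ y ∈ E, G y = T ∧ dist x y ≤ 4 * φ x
  have hzero : ∀ y, φ y = 0 → G y = T := fun y hy => by
    funext j
    have := (Finset.sum_eq_zero_iff_of_nonneg fun _ _ => abs_nonneg _).1 hy j (Finset.mem_univ j)
    rw [abs_eq_zero] at this; linarith
  rcases isEmpty_or_nonempty ι with hι | hι
  · refine ⟨x, hx, by funext j; exact isEmptyElim j, by rw [dist_self]; linarith [hφ0 x]⟩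
  set k : ℝ := ((Fintype.card ι : ℕ) : ℝ) with hk
  have hk1 : 1 ≤ k := by
    rw [hk]; exact_mod_cast Fintype.card_pos
  have hk0 : 0 < k := by linarith
  set lam : ℝ := 1 - 3 / (4 * k) with hlam
  have hlam0 : 0 ≤ lam := by
    rw [hlam, sub_nonneg, div_le_one (by positivity)]; linarith
  have hlam1 : lam < 1 := by rw [hlam]; have : 0 < 3 / (4 * k) := by positivity
                             linarith
  obtain ⟨f, hf0, hP, hR⟩ := exists_seq_step
    (P := fun n y => y ∈ E ∧ φ y ≤ φ x * lam ^ n ∧ dist x y ≤ 8 / 3 * (φ x - φ y))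
    (R := fun n y y' => dist y y' ≤ (8 / 3 * φ x) * lam ^ n) (x₀ := x)
    ⟨hx, by simp, by simp⟩ (by
      rintro n y ⟨hyE, hy1, hy2⟩
      have hln : 0 ≤ (8 / 3 * φ x) * lam ^ n := by have := hφ0 x; positivity
      rcases (hφ0 y).lt_or_eq with hpos | hz0
      swap
      · refine ⟨y, ⟨hyE, ?_, hy2⟩, by rwa [dist_self]⟩
        rw [← hz0]; have := hφ0 x; positivity
      have hyz : dist y z < r := by
        have := dist_triangle y x z; rw [dist_comm y x] at this; linarith [hφ0 x, hφ0 y]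
      obtain ⟨i, -, hi⟩ := Finset.exists_max_image Finset.univ (fun j => |T j - G y j|)
        Finset.univ_nonempty
      set s := |T i - G y i| with hs
      have hsφ : φ y ≤ k * s := by
        have := Finset.sum_le_card_nsmul Finset.univ (fun j => |T j - G y j|) s
          (fun j hj => hi j hj)
        simpa [hφ] using this
      have hsle : s ≤ φ y := Finset.single_le_sum (f := fun j => |T j - G y j|)
        (fun _ _ => abs_nonneg _) (Finset.mem_univ i)
      have hs0 : 0 < s := by
        by_contra hh
        have : s = 0 := le_antisymm (not_lt.1 hh) (abs_nonneg _)
        rw [this] at hsφ; linarith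
      have hsr : s < r := by
        have := dist_nonneg (x := x) (y := z)
        have := dist_nonneg (x := x) (y := y)
        linarith [hφ0 x]
      obtain ⟨σ, hσ, hσs⟩ : ∃ σ : ℝ, (σ = 1 ∨ σ = -1) ∧ σ * s = T i - G y i := by
        rcases abs_choice (T i - G y i) with h1 | h1
        · exact ⟨1, Or.inl rfl, by rw [hs, h1]; ring⟩
        · exact ⟨-1, Or.inr rfl, by rw [hs, h1]; ring⟩
      obtain ⟨y', hy'E, hyy', hmv⟩ := h y ⟨hyE, hyz⟩ i σ hσ s hs0 hsr
      have hdec : φ y' ≤ φ y - 3 / 4 * s := by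
        have : φ y' ≤ ∑ j, (|T j - G y j| - (if j = i then s else 0) + μ * s) := by
          refine Finset.sum_le_sum fun j _ => ?_
          have hj := abs_le.1 (hmv j)
          by_cases hji : j = i
          · subst hji
            simp only [if_true] at hj ⊢
            rw [hσs] at hj
            rw [← hs, abs_le]; constructor <;> linarith
          · simp only [hji, if_false] at hj ⊢
            have := abs_sub_abs_le_abs_sub (T j - G y' j) (T j - G y j)
            have h3 : |T j - G y' j - (T j - G y j)| ≤ μ * s := by
              rw [abs_le]; constructor <;> linarith
            linarith
        rw [Finset.sum_add_distrib, Finset.sum_sub_distrib] at this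
        simp only [Finset.sum_ite_eq', Finset.mem_univ, if_true, Finset.sum_const,
          Finset.card_univ, nsmul_eq_mul] at this
        have h4 : k * (μ * s) ≤ 1 / 4 * s := by
          have : k * (μ * s) = (μ * k) * s := by ring
          rw [this]; gcongr
        linarith
      refine ⟨y', ⟨hy'E, ?_, ?_⟩, ?_⟩
      · have h5 : φ y / k ≤ s := by rw [div_le_iff₀ hk0]; linarith
        calc φ y' ≤ φ y - 3 / 4 * s := hdec
          _ ≤ φ y - 3 / 4 * (φ y / k) := by gcongr
          _ = lam * φ y := by rw [hlam]; field_simp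
          _ ≤ lam * (φ x * lam ^ n) := by gcongr
          _ = _ := by rw [pow_succ]; ring
      · have := dist_triangle x y y'; linarith
      · have := hφ0 y'; linarith [hφ0 y, hsle])
  have hc : CauchySeq f := cauchySeq_of_le_geometric lam _ hlam1 hR
  obtain ⟨y, hy⟩ := cauchySeq_tendsto_of_complete hc
  have hφc : Continuous φ := by
    have := continuous_pi_iff.1 hG
    exact continuous_finsetSum _ fun j _ => (continuous_const.sub (this j)).abs
  refine ⟨y, hE.mem_of_tendsto hy (Filter.Eventually.of_forall fun n => (hP n).1), hzero y ?_, ?_⟩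
  · refine le_antisymm ?_ (hφ0 y)
    have h1 : Filter.Tendsto (fun n => φ x * lam ^ n) Filter.atTop (nhds (φ x * 0)) :=
      (tendsto_pow_atTop_nhds_zero_of_lt_one hlam0 hlam1).const_mul _
    rw [mul_zero] at h1
    exact le_of_tendsto_of_tendsto' ((hφc.tendsto y).comp hy) h1 fun n => (hP n).2.1
  · refine le_of_tendsto' (tendsto_const_nhds.dist hy) fun n => ?_
    have := (hP n).2.2
    linarith [hφ0 (f n), hφ0 x]

lemma HasMoves.image_mem_nhds [CompleteSpace X] {ι : Type*} [Fintype ι] [DecidableEq ι]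
    {G : X → ι → ℝ} (hG : Continuous G) {E : Set X} (hE : IsClosed E) {z : X} {r μ : ℝ}
    (h : HasMoves G E z r μ) (hμ : μ * Fintype.card ι ≤ 1 / 4) {x : X} (hxz : x ∈ ball z r)
    (hx : x ∈ E) {ρ : ℝ} (hρ : 0 < ρ) : G '' (E ∩ ball x ρ) ∈ nhds (G x) := by
  have hc : Continuous (fun T : ι → ℝ => 4 * ∑ j, |T j - G x j|) := by fun_prop
  have h0 : 4 * ∑ j, |G x j - G x j| = 0 := by simp
  have hr : 0 < min (r - dist x z) ρ := lt_min (by rw [mem_ball] at hxz; linarith) hρ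
  have := hc.continuousAt (x := G x) |>.eventually (gt_mem_nhds (h0.trans_lt hr))
  filter_upwards [this] with T hT
  obtain ⟨y, hyE, hy, hd⟩ := h.exists_eq hG hE hμ hx (T := T)
    (by have := hT.trans_le (min_le_left _ _); linarith)
  exact ⟨y, ⟨hyE, by rw [mem_ball, dist_comm]; exact hd.trans_lt (hT.trans_le (min_le_right _ _))⟩,
    hy⟩

/-! ### Hausdorff dimension -/

lemma card_le_dimH_of_image_mem_nhds {ι : Type*} [Fintype ι] {G : X → ι → ℝ} {K : ℝ≥0} {S : Set X}
    (hG : LipschitzOnWith K G S) {T : ι → ℝ} (h : G '' S ∈ nhds T) :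
    (Fintype.card ι : ℝ≥0∞) ≤ dimH S := by
  have h1 := Real.dimH_of_mem_nhds h
  rw [Module.finrank_fintype_fun_eq_card] at h1
  rw [← h1]
  exact hG.dimH_image_le

lemma dimH_le_card_of_antilipschitz {ι : Type*} [Fintype ι] {G : X → ι → ℝ} {K : ℝ≥0} {S : Set X}
    (hG : ∀ x ∈ S, ∀ y ∈ S, dist x y ≤ K * dist (G x) (G y)) :
    dimH S ≤ Fintype.card ι := by
  have h1 : AntilipschitzWith K (fun x : S => G x) :=
    AntilipschitzWith.of_le_mul_dist fun x y => hG x x.2 y y.2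
  have h2 := h1.le_dimH_image univ
  have h3 : dimH ((Subtype.val : S → X) '' univ) = dimH (univ : Set S) :=
    isometry_subtype_coe.dimH_image _
  rw [image_univ, Subtype.range_coe] at h3
  rw [h3]
  exact h2.trans ((dimH_mono (subset_univ _)).trans (Real.dimH_univ_pi ι).le)

end

section
variable {X : Type*} [MetricSpace X] {κ : ℝ}

/-! ### Strainer numbers and dimension -/

lemma continuous_distMap {ι : Type*} (a : ι → X) : Continuous fun x : X => fun i => dist (a i) x :=
  continuous_pi fun _ => continuous_const.dist continuous_id

lemma lipschitz_distMap {ι : Type*} [Fintype ι] (a : ι → X) :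
    LipschitzWith 1 fun x : X => fun i => dist (a i) x :=
  LipschitzWith.of_dist_le_mul fun x y => by
    rw [dist_pi_le_iff (by positivity)]
    intro i
    rw [Real.dist_eq, NNReal.coe_one, one_mul, dist_comm (a i) x, dist_comm (a i) y]
    exact abs_dist_sub_le _ _ _

lemma SData.hasMoves_univ (hA : IsAlexandrov X κ) {C₀ R : ℝ} {m : ℕ} {a b : Fin m → X} {p : X}
    {r C δ : ℝ} (h : SData κ C₀ R a b p r C δ) :
    HasMoves (fun x : X => fun i => dist (a i) x) univ p (r / 2) (4 * δ) := by
  intro x hx i σ hσ s hs hsr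
  have : dist x p < r / 2 := hx.2
  obtain ⟨q, h1, h2, h3⟩ := h.move hA i hs (by linarith) σ hσ
  exact ⟨q, mem_univ _, by linarith, fun j => (h3 j).1⟩

lemma IsStrainedPt.le_dim (hA : IsAlexandrov X κ) {n : ℕ} (hn : dimH (univ : Set X) = n) {k : ℕ}
    {δ : ℝ} (hδ : 0 < δ) (hδn : δ * (16 * (n + 1)) ≤ 1) {p : X} (h : IsStrainedPt κ k δ p) :
    k ≤ n := by
  by_contra hk
  push Not at hk
  have := hA.1
  obtain ⟨a, b, hab⟩ := h.mono_left (Nat.succ_le_of_lt hk)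
  obtain ⟨C₀, R, hK⟩ := exists_KC κ
  have hδ1 : δ ≤ 1 := by nlinarith [(Nat.cast_nonneg n : (0:ℝ) ≤ n)]
  obtain ⟨r, C, hS⟩ := exists_sdata hK hδ hδ1 hab
  have hm := (hS.hasMoves_univ hA).image_mem_nhds (continuous_distMap a) isClosed_univ
    (by rw [Fintype.card_fin]; push_cast; linarith) (mem_ball_self (by linarith [hS.hr]))
    (mem_univ p) zero_lt_one
  have := card_le_dimH_of_image_mem_nhds (lipschitz_distMap a).lipschitzOnWith hm
  have h2 := this.trans (dimH_mono (subset_univ _))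
  rw [hn, Fintype.card_fin] at h2
  have : n + 1 ≤ n := by exact_mod_cast h2
  omega

lemma exists_max_strained {n : ℕ} {η : ℕ → ℝ} {S : Set X}
    (htop : ∀ z ∈ S, ¬ IsStrainedPt κ (n + 1) (η (n + 1)) z) {k₀ : ℕ} (hk₀ : k₀ ≤ n) {z₀ : X}
    (hz₀ : z₀ ∈ S) (h0 : IsStrainedPt κ k₀ (η k₀) z₀) :
    ∃ k, k₀ ≤ k ∧ k ≤ n ∧ (∃ z ∈ S, IsStrainedPt κ k (η k) z) ∧
      ∀ z ∈ S, ¬ IsStrainedPt κ (k + 1) (η (k + 1)) z := by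
  by_contra hcon
  push Not at hcon
  have : ∀ j, k₀ + j ≤ n + 1 → ∃ z ∈ S, IsStrainedPt κ (k₀ + j) (η (k₀ + j)) z := by
    intro j
    induction j with
    | zero => exact fun _ => ⟨z₀, hz₀, h0⟩
    | succ j ih =>
      intro hj
      obtain ⟨z, hz, hzs⟩ := ih (by omega)
      exact hcon (k₀ + j) (by omega) (by omega) ⟨z, hz, hzs⟩
  obtain ⟨z, hz, hzs⟩ := this (n + 1 - k₀) (by omega)
  rw [show k₀ + (n + 1 - k₀) = n + 1 by omega] at hzs
  exact htop z hz hzs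

/-- Where no further strainer pair can be added, distance coordinates separate points. -/
lemma SData.separate (hA : IsAlexandrov X κ) {C₀ R : ℝ} {m : ℕ} {a b : Fin m → X} {p : X}
    {r C δ : ℝ} (h : SData κ C₀ R a b p r C δ) {η : ℝ} (hη : 0 < η) (hδη : 32 * δ ≤ η)
    (hno : ∀ z ∈ ball p r, ¬ IsStrainedPt κ (m + 1) η z) (hr : 80 * C * r ≤ η ^ 2) :
    ∀ x ∈ ball p (r / 2), ∀ y ∈ ball p (r / 2),
      dist x y ≤ (4 / η) * dist (fun i => dist (a i) x) (fun i => dist (a i) y) := by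
  intro x hx y hy
  by_contra hcon
  push Not at hcon
  rw [div_mul_eq_mul_div, div_lt_iff₀ hη] at hcon
  have hr0 := h.hr
  have hC := h.hC
  have hsm := h.hsm
  have hδ := h.hδ
  have hD : 0 < dist x y := by
    by_contra hh
    have : dist x y = 0 := le_antisymm (not_lt.1 hh) dist_nonneg
    rw [this] at hcon
    have := dist_nonneg (x := fun i => dist (a i) x) (y := fun i => dist (a i) y)
    linarith
  have hlt := dist_lt_of_mem_ball hx hy
  have hf : ∀ i, |dist (a i) x - dist (a i) y| ≤ η / 4 * dist x y := fun i => by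
    have := dist_le_pi_dist (fun i => dist (a i) x) (fun i => dist (a i) y) i
    rw [Real.dist_eq] at this
    linarith
  obtain ⟨M, h1, h2⟩ := exists_pt_between hA x y (t := 1 / 2) (by norm_num) (by norm_num)
  have hxr : x ∈ ball p r := ball_subset_ball (by linarith) hx
  have hyr : y ∈ ball p r := ball_subset_ball (by linarith) hy
  have hM : M ∈ ball p r := by
    rw [mem_ball] at hx hy ⊢
    have t1 := dist_triangle M x p
    have t2 := dist_triangle M y p
    rw [dist_comm M x] at t1
    linarith
  have hRr : 2 * r ≤ R := by have := h.hrR; linarith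
  have key : ∀ i, |dist (a i) x - dist (a i) M| ≤ (η / 4 + 5 * δ) * (dist x y / 2) ∧
      |dist (a i) y - dist (a i) M| ≤ (η / 4 + 5 * δ) * (dist x y / 2) := fun i => by
    have c1 := (h.far_a i).concave hA h.kc hRr hxr hyr hM (θ := 1/2) (by norm_num) (by norm_num)
      h1 h2
    have c2 := (h.far_b i).concave hA h.kc hRr hxr hyr hM (θ := 1/2) (by norm_num) (by norm_num)
      h1 h2
    have e1 := abs_le.1 (h.sum_le hA i hxr hyr)
    have e2 := abs_le.1 (h.sum_le hA i hxr hM)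
    have e3 := abs_le.1 (h.sum_le hA i hyr hM)
    rw [h1] at e2
    rw [dist_comm y M, h2] at e3
    have hf' := abs_le.1 (hf i)
    have hCD : C * dist x y ^ 2 ≤ δ * dist x y := by
      have : C * dist x y ≤ δ := by nlinarith
      nlinarith
    have hδD := mul_pos hδ hD
    constructor <;> rw [abs_le] <;> constructor <;> linarith
  have hxM : x ≠ M := by rintro rfl; rw [dist_self] at h1; linarith
  have hyM : y ≠ M := by rintro rfl; rw [dist_self] at h2; linarith
  have k1 : dist M x = dist x y / 2 := by rw [dist_comm, h1]; ring
  have k2 : dist M y = dist x y / 2 := by rw [h2]; ring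
  refine hno M hM (h.add_strainer hA hM hxr hyr hxM hyM hη (c := η / 4 + 5 * δ) (by positivity)
    (by linarith) ?_ (fun i => ?_) (fun i => ?_))
  · have : ec x M y = -1 := by
      unfold ec; rw [k1, k2]; field_simp; ring
    rw [this, k1, k2]
    have : C * dist x y ≤ η ^ 2 / 20 := by nlinarith
    linarith
  · rw [k1]; exact (key i).1
  · rw [k2]; exact (key i).2

/-! ### Packing and local compactness -/

lemma exists_card_le (k : ℕ) {θ : ℝ} (hθ : 0 < θ) : ∃ N : ℕ, ∀ {α : Type*} (s : Finset α)
    (g : α → Fin k → ℝ) (T : Fin k → ℝ) (A : ℝ), 0 < A → (∀ x ∈ s, dist (g x) T ≤ A) →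
    (∀ x ∈ s, ∀ y ∈ s, x ≠ y → θ * A ≤ dist (g x) (g y)) → s.card ≤ N := by
  obtain ⟨t, -, ht, hcov⟩ := (isCompact_closedBall (0 : Fin k → ℝ) 1).finite_cover_balls
    (half_pos hθ)
  refine ⟨ht.toFinset.card, fun s g T A hA h1 h2 => ?_⟩
  have hmem : ∀ x ∈ s, ∃ c ∈ t, dist (A⁻¹ • (g x - T)) c < θ / 2 := fun x hx => by
    have : A⁻¹ • (g x - T) ∈ closedBall (0 : Fin k → ℝ) 1 := by
      rw [mem_closedBall, dist_zero_right, norm_smul, norm_inv, Real.norm_eq_abs, abs_of_pos hA,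
        inv_mul_le_iff₀ hA, mul_one, ← dist_eq_norm]
      exact h1 x hx
    simpa using hcov this
  choose! c hc hcd using hmem
  refine Finset.card_le_card_of_injOn c (fun x hx => by simpa using hc x hx) ?_
  intro x hx y hy hxy
  by_contra hne
  have h3 := h2 x hx y hy hne
  have h4 : dist (A⁻¹ • (g x - T)) (A⁻¹ • (g y - T)) < θ := by
    have := dist_triangle_right (A⁻¹ • (g x - T)) (A⁻¹ • (g y - T)) (c x)
    have h5 := hcd x hx
    have h6 := hcd y hy
    rw [← hxy] at h6
    linarith
  rw [dist_smul₀, dist_sub_right, norm_inv, Real.norm_eq_abs, abs_of_pos hA,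
    inv_mul_lt_iff₀ hA] at h4
  linarith

/-- Contraction towards a point along geodesics. -/
lemma exists_contraction (hA : IsAlexandrov X κ) {C R : ℝ} (hK : KC κ C R) {z : X} {ρ : ℝ}
    (hρ : 0 < ρ) (hρR : 2 * ρ < R) (j : ℕ) : ∃ h : X → X, ∀ x, dist z x ≤ ρ →
      dist z (h x) = (1 / 2) ^ j * dist z x ∧ ∀ y, dist z y ≤ ρ →
        (1 / 4) ^ j * (dist x y ^ 2 - 80 * C * ρ ^ 3 * (1 - (1 / 2) ^ j)) ≤
          dist (h x) (h y) ^ 2 := by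
  have hC := hK.2.1
  choose mid hm1 hm2 using fun x => exists_pt_between hA z x (t := 1 / 2) (by norm_num)
    (by norm_num)
  have hmid : ∀ ρ' > 0, 2 * ρ' < R → ∀ x y, dist z x ≤ ρ' → dist z y ≤ ρ' →
      1 / 4 * dist x y ^ 2 - 10 * C * ρ' ^ 3 ≤ dist (mid x) (mid y) ^ 2 := by
    intro ρ' hρ' hR x y hx hy
    have d1 : dist (mid x) z ≤ ρ' / 2 := by rw [dist_comm, hm1]; linarith
    have d2 : dist (mid y) z ≤ ρ' / 2 := by rw [dist_comm, hm1]; linarith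
    have d3 : dist (mid x) y ≤ 2 * ρ' := by
      have := dist_triangle (mid x) z y; linarith
    have d4 : dist (mid y) (mid x) ≤ ρ' := by
      have := dist_triangle_right (mid y) (mid x) z; linarith
    have s1 := stewart hA hK (w := z) (v := x) (M := mid x) (u := y) (θ := 1/2) (by linarith)
      (by have := hm2 x; linarith) (by linarith) (by norm_num) (by norm_num) (hm1 x) (hm2 x)
    have s2 := stewart hA hK (w := z) (v := y) (M := mid y) (u := mid x) (θ := 1/2) (by linarith)
      (by have := hm2 y; linarith) (by linarith) (by norm_num) (by norm_num) (hm1 y) (hm2 y)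
    rw [dist_comm (mid x) z, hm1 x, dist_comm (mid y) (mid x)] at s2
    rw [dist_comm y z, dist_comm y x] at s1
    rw [dist_comm (mid y) (mid x)] at d4
    have e1 : 2 * C * dist (mid x) y * (1 / 2 * (1 - 1 / 2) * dist z x) *
        (2 * dist (mid x) y + dist z x) ≤ 2 * C * (2 * ρ') * (1 / 2 * (1 - 1 / 2) * ρ') *
        (2 * (2 * ρ') + ρ') := by
      gcongr
    have e2 : 2 * C * dist (mid x) (mid y) * (1 / 2 * (1 - 1 / 2) * dist z y) *
        (2 * dist (mid x) (mid y) + dist z y) ≤ 2 * C * ρ' * (1 / 2 * (1 - 1 / 2) * ρ') *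
        (2 * ρ' + ρ') := by
      gcongr
    have hp : 0 ≤ C * ρ' ^ 3 := by positivity
    nlinarith
  induction j with
  | zero => exact ⟨id, fun x _ => ⟨by simp, fun y _ => by simp⟩⟩
  | succ j ih =>
    obtain ⟨h, hh⟩ := ih
    refine ⟨mid ∘ h, fun x hx => ⟨?_, fun y hy => ?_⟩⟩
    · rw [Function.comp, hm1, (hh x hx).1, pow_succ]; ring
    · set e : ℝ := (1/2) ^ j with he
      have he0 : 0 < e := by positivity
      have he1 : e ≤ 1 := pow_le_one₀ (by norm_num) (by norm_num)
      have he2 : (1/4 : ℝ) ^ j = e ^ 2 := by rw [he, ← pow_mul, mul_comm, pow_mul]; norm_num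
      have hR' : 2 * (e * ρ) < R := by nlinarith
      have k1 := hmid (e * ρ) (by positivity) hR' (h x) (h y)
        (by rw [(hh x hx).1]; gcongr) (by rw [(hh y hy).1]; gcongr)
      have k2 := (hh x hx).2 y hy
      rw [he2] at k2
      rw [pow_succ ((1 : ℝ) / 4) j, pow_succ ((1 : ℝ) / 2) j, he2, Function.comp, Function.comp, ← he]
      nlinarith

lemma exists_packing (hA : IsAlexandrov X κ) {n : ℕ} (hn : dimH (univ : Set X) = n)
    {θ : ℝ} (hθ : 0 < θ) : ∃ R₀ > 0, ∃ N : ℕ, ∀ (p : X) (r : ℝ), 0 < r → r < R₀ →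
      ∀ {s : Finset X}, (∀ x ∈ s, dist x p ≤ r) →
        (∀ x ∈ s, ∀ y ∈ s, x ≠ y → θ * r ≤ dist x y) → s.card ≤ N := by
  obtain ⟨C, R, hK⟩ := exists_KC κ
  have hR := hK.1
  have hC := hK.2.1
  set η : ℕ → ℝ := fun k => (1 / 32) ^ (n + 1 - k) * (1 / (16 * (n + 1))) with hη
  have hn0 : (0 : ℝ) ≤ n := Nat.cast_nonneg n
  have hηpos : ∀ k, 0 < η k := fun k => by positivity
  have hηsucc : ∀ k ≤ n, η k = η (k + 1) / 32 := fun k hk => by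
    simp only [hη]
    rw [show n + 1 - k = (n + 1 - (k + 1)) + 1 by omega, pow_succ]
    ring
  have hη0 : ∀ k, η 0 ≤ η k := fun k => by
    simp only [hη]
    gcongr ?_ * _
    exact pow_le_pow_of_le_one (by norm_num) (by norm_num) (by omega)
  have hη1 : ∀ k, η k ≤ 1 := fun k => by
    simp only [hη]
    have h1 : ((1 : ℝ) / 32) ^ (n + 1 - k) ≤ 1 := pow_le_one₀ (by norm_num) (by norm_num)
    have h2 : 1 / (16 * ((n : ℝ) + 1)) ≤ 1 := by rw [div_le_one (by positivity)]; linarith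
    exact mul_le_one₀ h1 (by positivity) h2
  choose Nk hNk using fun k => exists_card_le k (θ := θ * η 0 / 16)
    (by have := hηpos 0; positivity)
  refine ⟨min (R / 4) (θ ^ 2 * 3 / 4 / (640 * C + 1)), by positivity, ∑ k ∈ Finset.range (n + 1), Nk k,
    fun p r hr hrR s hs1 hs2 => ?_⟩
  have hrR1 : r < R / 4 := lt_of_lt_of_le hrR (min_le_left _ _)
  have hrR2 : 640 * C * r ≤ θ ^ 2 * 3 / 4 := by
    have := lt_of_lt_of_le hrR (min_le_right _ _)
    rw [lt_div_iff₀ (by positivity)] at this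
    nlinarith
  obtain ⟨k, -, hkn, ⟨z, hz, hzs⟩, hno⟩ := exists_max_strained (κ := κ) (n := n) (η := η)
    (S := ball p r) (fun z _ hz => absurd (hz.le_dim hA hn (hηpos _)
      (by simp only [hη]; rw [Nat.sub_self, pow_zero, one_mul, one_div_mul_cancel (by positivity)]))
      (by omega)) (Nat.zero_le n) (mem_ball_self hr) isStrainedPt_zero
  obtain ⟨a, b, hab⟩ := hzs
  obtain ⟨r1, C1, hS⟩ := exists_sdata hK (hηpos k) (hη1 k) hab
  have hC1 := hS.hC
  have hr1 := hS.hr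
  have hpz : 0 < r - dist z p := by have := mem_ball.1 hz; linarith
  have hηk := hηpos (k + 1)
  set r2 := min r1 (min (r - dist z p) (η (k + 1) ^ 2 / (80 * C1 + 1))) with hr2
  have hr2pos : 0 < r2 := by positivity
  have hr2b : 80 * C1 * r2 ≤ η (k + 1) ^ 2 := by
    have : r2 ≤ η (k + 1) ^ 2 / (80 * C1 + 1) := (min_le_right _ _).trans (min_le_right _ _)
    rw [le_div_iff₀ (by positivity)] at this
    nlinarith
  have hsub : ball z r2 ⊆ ball p r :=
    ball_subset_ball' (by
      have : r2 ≤ r - dist z p := (min_le_right _ _).trans (min_le_left _ _)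
      linarith)
  have hS2 := hS.mono hr2pos (min_le_left _ _) (ball_subset_ball (min_le_left _ _))
  have hsep := hS2.separate hA hηk (by rw [hηsucc k hkn]; linarith)
    (fun z hz => hno z (hsub hz)) hr2b
  obtain ⟨j, hj⟩ := exists_pow_lt_of_lt_one (x := r2 / 2 / (2 * r)) (by positivity)
    (show (1 / 2 : ℝ) < 1 by norm_num)
  rw [lt_div_iff₀ (by positivity)] at hj
  obtain ⟨h, hh⟩ := exists_contraction hA hK (z := z) (ρ := 2 * r) (by linarith) (by linarith) j
  have hzx : ∀ x ∈ s, dist z x ≤ 2 * r := fun x hx => by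
    have := dist_triangle_right z x p
    have := hs1 x hx
    have := mem_ball.1 hz
    linarith
  set e : ℝ := (1 / 2) ^ j with he
  have he0 : 0 < e := by positivity
  have he1 : e ≤ 1 := pow_le_one₀ (by norm_num) (by norm_num)
  have he2 : (1/4 : ℝ) ^ j = e ^ 2 := by rw [he, ← pow_mul, mul_comm, pow_mul]; norm_num
  have hhx : ∀ x ∈ s, dist z (h x) ≤ e * (2 * r) := fun x hx => by
    rw [(hh x (hzx x hx)).1]; exact mul_le_mul_of_nonneg_left (hzx x hx) he0.le
  have hcard := hNk k s (fun x i => dist (a i) (h x)) (fun i => dist (a i) z) (e * (2 * r))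
    (by positivity) (fun x hx => by
      refine ((lipschitz_distMap a).dist_le_mul (h x) z).trans ?_
      rw [NNReal.coe_one, one_mul, dist_comm]
      exact hhx x hx) (fun x hx y hy hxy => by
      have h1 := hsep (h x) (by rw [mem_ball']; exact (hhx x hx).trans_lt hj)
        (h y) (by rw [mem_ball']; exact (hhx y hy).trans_lt hj)
      have h2 := (hh x (hzx x hx)).2 y (hzx y hy)
      rw [he2] at h2
      have h3 := hs2 x hx y hy hxy
      have h4 : (θ * r) ^ 2 ≤ dist x y ^ 2 := by gcongr
      have h5 : 80 * C * (2 * r) ^ 3 * (1 - e) ≤ (θ * r) ^ 2 * (3 / 4) := by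
        have : 80 * C * (2 * r) ^ 3 * (1 - e) ≤ 80 * C * (2 * r) ^ 3 * 1 := by
          gcongr; linarith
        nlinarith [mul_le_mul_of_nonneg_right hrR2 (sq_nonneg r)]
      have h6 : (e * (θ * r / 2)) ^ 2 ≤ dist (h x) (h y) ^ 2 := by
        refine le_trans ?_ h2
        rw [mul_pow]
        gcongr
        nlinarith
      have h7 := abs_le_of_sq_le_sq' h6 dist_nonneg
      have h8 := h7.2.trans h1
      have h9 := hη0 (k + 1)
      rw [div_mul_eq_mul_div, le_div_iff₀ hηk] at h8
      have h10 : e * (θ * r / 2) * η 0 ≤ e * (θ * r / 2) * η (k + 1) := by gcongr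
      linarith)
  exact hcard.trans (Finset.single_le_sum (f := Nk) (fun _ _ => Nat.zero_le _)
    (Finset.mem_range.2 (by omega)))

/-- Finite-dimensional Alexandrov spaces are locally compact, uniformly in the point. -/
lemma exists_isCompact_closedBall (hA : IsAlexandrov X κ) {n : ℕ}
    (hn : dimH (univ : Set X) = n) : ∃ R₀ > 0, ∀ (p : X) (r : ℝ), r < R₀ →
      IsCompact (closedBall p r) := by
  obtain ⟨R₀, hR₀, N, hN⟩ := exists_packing hA hn (θ := 1 / 2) (by norm_num)
  have := hA.1
  have hcov : ∀ (p : X) (r : ℝ), 0 < r → r < R₀ → ∃ t : Set X, t.Finite ∧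
      closedBall p r ⊆ ⋃ x ∈ t, closedBall x (r / 2) := by
    intro p r hr hrR
    obtain ⟨s, ⟨hs1, hs2⟩, hmax⟩ : ∃ s : Finset X, ((∀ x ∈ s, dist x p ≤ r) ∧
        (∀ x ∈ s, ∀ y ∈ s, x ≠ y → 1 / 2 * r ≤ dist x y)) ∧ ∀ s' : Finset X,
        ((∀ x ∈ s', dist x p ≤ r) ∧ (∀ x ∈ s', ∀ y ∈ s', x ≠ y → 1 / 2 * r ≤ dist x y)) →
        s'.card ≤ s.card := by
      let P : Set ℕ := {k | ∃ s : Finset X, ((∀ x ∈ s, dist x p ≤ r) ∧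
        (∀ x ∈ s, ∀ y ∈ s, x ≠ y → 1 / 2 * r ≤ dist x y)) ∧ s.card = k}
      have hPb : BddAbove P := ⟨N, by rintro _ ⟨s, ⟨h1, h2⟩, rfl⟩; exact hN p r hr hrR h1 h2⟩
      have hPn : P.Nonempty := ⟨0, ∅, by simp⟩
      obtain ⟨s, hs, hsc⟩ := Nat.sSup_mem hPn hPb
      exact ⟨s, hs, fun s' hs' => hsc ▸ le_csSup hPb ⟨s', hs', rfl⟩⟩
    classical
    refine ⟨s, s.finite_toSet, fun x hx => ?_⟩
    by_contra hcon
    simp only [mem_iUnion, not_exists, mem_closedBall, not_le] at hcon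
    have hxs : x ∉ s := fun hxs => by
      have := hcon x hxs
      rw [dist_self] at this
      linarith
    have := hmax (insert x s) ⟨fun y hy => ?_, fun y hy y' hy' hne => ?_⟩
    · rw [Finset.card_insert_of_notMem hxs] at this
      omega
    · rcases Finset.mem_insert.1 hy with rfl | hy
      · exact hx
      · exact hs1 y hy
    · rcases Finset.mem_insert.1 hy with rfl | hy1 <;>
        rcases Finset.mem_insert.1 hy' with rfl | hy2
      · exact absurd rfl hne
      · have := hcon y' hy2; linarith
      · have := hcon y hy1; rw [dist_comm] at this; linarith
      · exact hs2 y hy1 y' hy2 hne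
  have hcovj : ∀ (j : ℕ) (p : X) (r : ℝ), 0 < r → r < R₀ → ∃ t : Set X, t.Finite ∧
      closedBall p r ⊆ ⋃ x ∈ t, closedBall x (r * (1 / 2) ^ j) := by
    intro j
    induction j with
    | zero => exact fun p r _ _ => ⟨{p}, finite_singleton p, by simp⟩
    | succ j ih =>
      intro p r hr hrR
      obtain ⟨t, ht, htc⟩ := hcov p r hr hrR
      choose T hT hTc using fun x => ih x (r / 2) (by linarith) (by linarith)
      refine ⟨⋃ x ∈ t, T x, ht.biUnion fun x _ => hT x, fun y hy => ?_⟩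
      obtain ⟨x, hx, hyx⟩ := mem_iUnion₂.1 (htc hy)
      obtain ⟨z, hz, hyz⟩ := mem_iUnion₂.1 (hTc x hyx)
      refine mem_iUnion₂.2 ⟨z, mem_biUnion hx hz, ?_⟩
      rwa [pow_succ, show r * ((1 / 2) ^ j * (1 / 2)) = r / 2 * (1 / 2) ^ j by ring]
  refine ⟨R₀, hR₀, fun p r hr => ?_⟩
  rcases le_or_gt r 0 with hr0 | hr0
  · exact (subsingleton_closedBall p hr0).isCompact
  · refine TotallyBounded.isCompact_of_isClosed (Metric.totallyBounded_iff.2 fun ε hε => ?_)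
      isClosed_closedBall
    obtain ⟨j, hj⟩ := exists_pow_lt_of_lt_one (x := ε / r) (by positivity)
      (show (1 / 2 : ℝ) < 1 by norm_num)
    obtain ⟨t, ht, htc⟩ := hcovj j p r hr0 hr
    refine ⟨t, ht, htc.trans (iUnion₂_mono fun x _ => closedBall_subset_ball ?_)⟩
    rw [lt_div_iff₀ hr0] at hj
    linarith
end

section
variable {X : Type*} [MetricSpace X] {κ : ℝ}

lemma KC.mono {C R R' : ℝ} (h : KC κ C R) (hR' : 0 < R') (hRR : R' ≤ R) : KC κ C R' := by
  exact ⟨hR', h.2.1, fun t ht ht' => h.2.2.1 t ht (ht'.trans_le hRR),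
    fun s t d hs ht hs' ht' => h.2.2.2 s t d hs ht (hs'.trans_le hRR) (ht'.trans_le hRR)⟩

/-! ### Projection to an extremal subset -/

lemma IsExtremal.exists_proj {E : Set X} (hE : IsExtremal κ E) {R : ℝ}
    (hcpt : ∀ (p : X) (r : ℝ), r < R → IsCompact (closedBall p r)) {q e : X} (he : e ∈ E)
    (hqe : dist q e < R) :
    ∃ y ∈ E, (∀ e ∈ E, dist q y ≤ dist q e) ∧ ∀ c p r C, Far κ c p r C → q ∈ ball p r →
      y ∈ ball p r → dist c q - C * dist q y ^ 2 ≤ dist c y := by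
  obtain ⟨y, ⟨hyE, hyq⟩, hmin⟩ := ((hcpt q _ hqe).inter_left hE.1).exists_isMinOn
    ⟨e, he, by rw [mem_closedBall, dist_comm]⟩ (f := fun x => dist q x)
    (continuous_const.dist continuous_id).continuousOn
  have hmin' : ∀ e' ∈ E, dist q y ≤ dist q e' := fun e' he' => by
    rcases le_or_gt (dist q e') (dist q e) with h | h
    · exact hmin ⟨he', by rwa [mem_closedBall, dist_comm]⟩
    · exact le_trans (by rwa [mem_closedBall, dist_comm] at hyq) h.le
  refine ⟨y, hyE, hmin', fun c p r C hc hq hy => ?_⟩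
  by_cases hqE : q ∈ E
  · have := hmin' q hqE
    rw [dist_self] at this
    have : q = y := dist_le_zero.1 this
    subst this
    simp
  · refine hc.crit hq hy (hE.2 q hqE y hyE ?_)
    filter_upwards [self_mem_nhdsWithin] with x hx using hmin' x hx

section
variable {C₀ R : ℝ} {m : ℕ} {a b : Fin m → X} {p : X} {r C δ : ℝ}

lemma SData.exists_near (hA : IsAlexandrov X κ) {E : Set X} (hE : IsExtremal κ E)
    (h : SData κ C₀ R a b p r C δ)
    (hcpt : ∀ (p : X) (r : ℝ), r < R → IsCompact (closedBall p r)) {x q : X} (hx : x ∈ E)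
    (hq : q ∈ ball p r) {s : ℝ} (hs : 0 < s) (hxq : dist x q ≤ s) (hsr : dist x p + 2 * s < r) :
    ∃ y ∈ E, y ∈ ball p r ∧ dist x y ≤ 2 * s ∧ dist q y ≤ s ∧
      (∀ c p r C, Far κ c p r C → q ∈ ball p r →
        y ∈ ball p r → dist c q - C * dist q y ^ 2 ≤ dist c y) ∧
      (∀ j, |dist (a j) y - dist (a j) q| ≤ 3 * δ * s) ∧
      ∀ j, |dist (b j) y - dist (b j) q| ≤ 3 * δ * s := by
  have hrR := h.hrR
  have hr := h.hr
  obtain ⟨y, hyE, hmin, hcr⟩ := hE.exists_proj hcpt hx (q := q) (by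
    rw [dist_comm]
    have := dist_nonneg (x := x) (y := p)
    linarith)
  have hqy : dist q y ≤ s := (hmin x hx).trans (by rwa [dist_comm])
  have hxy : dist x y ≤ 2 * s := by linarith [dist_triangle x q y]
  have hy : y ∈ ball p r := by
    rw [mem_ball]; linarith [dist_triangle_left y p x]
  have hC := h.hC
  have hδ := h.hδ
  have hsm := h.hsm
  have hCs : C * dist q y ^ 2 ≤ δ * s := by
    have h1 : C * dist q y ^ 2 ≤ C * s ^ 2 := by gcongr
    have h2 : s ≤ r := by linarith [dist_nonneg (x := x) (y := p)]
    have h3 : C * s ≤ δ := by nlinarith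
    nlinarith
  have hdq : δ * dist q y ≤ δ * s := by gcongr
  refine ⟨y, hyE, hy, hxy, hqy, hcr, fun j => ?_, fun j => ?_⟩
  all_goals
    have e1 := hcr _ _ _ _ (h.far_a j) hq hy
    have e2 := hcr _ _ _ _ (h.far_b j) hq hy
    have e3 := abs_le.1 (h.sum_le hA j hq hy)
    rw [abs_le]
    constructor <;> linarith

lemma SData.hasMoves (hA : IsAlexandrov X κ) {E : Set X} (hE : IsExtremal κ E)
    (h : SData κ C₀ R a b p r C δ)
    (hcpt : ∀ (p : X) (r : ℝ), r < R → IsCompact (closedBall p r)) :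
    HasMoves (fun x : X => fun i => dist (a i) x) E p (r / 3) (7 * δ) := by
  intro x hx i σ hσ s hs hsr
  have : dist x p < r / 3 := hx.2
  obtain ⟨q, h1, h2, h3⟩ := h.move hA i hs (by linarith) σ hσ
  obtain ⟨y, hyE, -, hxy, -, -, hy, -⟩ := h.exists_near hA hE hcpt hx.1 h2 hs h1.le (by linarith)
  refine ⟨y, hyE, hxy, fun j => ?_⟩
  have e1 := abs_le.1 (h3 j).1
  have e2 := abs_le.1 (hy j)
  dsimp only
  rw [abs_le]
  constructor <;> linarith

/-! ### Isolatedness of fibres -/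

lemma ec_mono {C R : ℝ} (hA : IsAlexandrov X κ) (hK : KC κ C R) {p x y u : X} {θ : ℝ} (hθ : 0 < θ)
    (hθ1 : θ ≤ 1) (h1 : dist p y = θ * dist p x) (h2 : dist y x = (1 - θ) * dist p x)
    (hpx : 0 < dist p x) (hpu : 0 < dist p u) (hR : dist p x + dist p u < R) :
    ec y p u - C * dist y u * (2 * dist y u + dist p x) / dist p u ≤ ec x p u := by
  have hC := hK.2.1
  have hyu : dist y u ≤ dist p x + dist p u := by
    have := dist_triangle_left y u p
    nlinarith
  have s := stewart hA hK (w := p) (v := x) (M := y) (u := u) (θ := θ)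
    (by rw [dist_comm, h1]; nlinarith) (by rw [h2]; nlinarith) (by linarith) hθ.le hθ1 h1 h2
  rw [dist_comm u p, dist_comm u x] at s
  unfold ec
  rw [h1, sub_le_iff_le_add, div_le_iff₀ (by positivity)]
  have e : ((dist p x ^ 2 + dist p u ^ 2 - dist x u ^ 2) / (2 * dist p x * dist p u) +
      C * dist y u * (2 * dist y u + dist p x) / dist p u) * (2 * (θ * dist p x) * dist p u) =
      θ * (dist p x ^ 2 + dist p u ^ 2 - dist x u ^ 2) +
        2 * C * dist y u * (θ * dist p x) * (2 * dist y u + dist p x) := by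
    field_simp
  rw [e]
  have : 2 * C * dist y u * (θ * (1 - θ) * dist p x) * (2 * dist y u + dist p x) ≤
      2 * C * dist y u * (θ * dist p x) * (2 * dist y u + dist p x) := by
    gcongr
    nlinarith
  nlinarith

set_option maxHeartbeats 800000 in
lemma SData.isolated (hA : IsAlexandrov X κ) {n : ℕ} (hn : dimH (univ : Set X) = n)
    (h : SData κ C₀ R a b p r C δ) {E : Set X} {η : ℝ} (hη : 0 < η) (hη1 : η ≤ 1)
    (hδη : 6 * δ ≤ η) (hno : ∀ z ∈ E ∩ ball p r, ¬ IsStrainedPt κ (m + 1) η z) :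
    ∃ r' > 0, ∀ x ∈ E ∩ ball p r', (∀ i, dist (a i) x = dist (a i) p) → x = p := by
  by_contra hcon
  push Not at hcon
  have hr := h.hr
  have hC := h.hC
  have hC₀ := h.hC₀
  have hrR := h.hrR
  have hC0 := h.kc.2.1
  obtain ⟨R₁, hR₁, N, hN⟩ := exists_packing hA hn (θ := η / 10) (by positivity)
  set ρ := min r (min (R₁ / 2) (η ^ 2 / (2300 * C + 1))) with hρ
  have hρ0 : 0 < ρ := by positivity
  have hρr : ρ ≤ r := min_le_left _ _
  have hρR : ρ ≤ R₁ / 2 := (min_le_right _ _).trans (min_le_left _ _)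
  have hρC : 2300 * C * ρ ≤ η ^ 2 := by
    have : ρ ≤ η ^ 2 / (2300 * C + 1) := (min_le_right _ _).trans (min_le_right _ _)
    rw [le_div_iff₀ (by positivity)] at this
    nlinarith
  set ν := η ^ 2 / 200 with hν
  have hν0 : 0 < ν := by positivity
  have hν1 : ν ≤ 1 := by rw [hν]; nlinarith
  obtain ⟨x₀, hx₀, hx₀f, hx₀p⟩ := hcon ρ hρ0
  obtain ⟨x, hx0, hxP, hxR⟩ := exists_seq_step
    (P := fun _ x => x ∈ E ∩ ball p ρ ∧ (∀ i, dist (a i) x = dist (a i) p) ∧ x ≠ p)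
    (R := fun _ x y => dist p y ≤ ν * dist p x) (x₀ := x₀) ⟨hx₀, hx₀f, hx₀p⟩ (by
      rintro - x ⟨hx, hxf, hxp⟩
      have hpos : 0 < dist p x := dist_pos.2 hxp.symm
      obtain ⟨y, hy, hyf, hyp⟩ := hcon (min ρ (ν * dist p x)) (by positivity)
      exact ⟨y, ⟨⟨hy.1, ball_subset_ball (min_le_left _ _) hy.2⟩, hyf, hyp⟩,
        (mem_ball'.1 (ball_subset_ball (min_le_right _ _) hy.2)).le⟩)
  have hpos : ∀ k, 0 < dist p (x k) := fun k => dist_pos.2 (hxP k).2.2.symm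
  have hltρ : ∀ k, dist p (x k) < ρ := fun k => mem_ball'.1 (hxP k).1.2
  have hanti : Antitone fun k => dist p (x k) := antitone_nat_of_succ_le fun k =>
    (hxR k).trans (mul_le_of_le_one_left (hpos k).le hν1)
  set ρ' := dist p (x N) with hρ'
  have hle : ∀ k ≤ N, ρ' ≤ dist p (x k) := fun k hk => hanti hk
  have : Nonempty X := ⟨p⟩
  choose! y hy1 hy2 using fun k (hk : k ≤ N) => exists_pt_between hA p (x k)
    (t := ρ' / dist p (x k)) (by have := hpos k; have := hpos N; positivity)
    ((div_le_one (hpos k)).2 (hle k hk))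
  have hy3 : ∀ k ≤ N, dist p (y k) = ρ' := fun k hk => by
    rw [hy1 k hk, div_mul_cancel₀ _ (hpos k).ne']
  obtain ⟨j, k, hjk, hkN, hd⟩ : ∃ j k, j < k ∧ k ≤ N ∧ dist (y j) (y k) < η / 10 * ρ' := by
    by_contra hc
    push Not at hc
    have hd : ∀ j ≤ N, ∀ k ≤ N, j ≠ k → η / 10 * ρ' ≤ dist (y j) (y k) := by
      intro j hj k hk hne
      rcases lt_or_gt_of_ne hne with h | h
      · exact hc j k h hk
      · rw [dist_comm]; exact hc k j h hj
    have hρ'0 : 0 < η / 10 * ρ' := by have := hpos N; positivity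
    classical
    have hinj : Set.InjOn y (Finset.range (N + 1)) := by
      intro j hj k hk hjk
      by_contra hne
      have := hd j (by simpa [Nat.lt_succ_iff] using hj) k (by simpa [Nat.lt_succ_iff] using hk) hne
      rw [hjk, dist_self] at this
      linarith
    have hcard := hN p ρ' (hpos N) (by linarith [hltρ N])
      (s := (Finset.range (N + 1)).image y) (fun z hz => by
        obtain ⟨k, hk, rfl⟩ := Finset.mem_image.1 hz
        rw [dist_comm, hy3 k (by simpa [Nat.lt_succ_iff] using hk)]) (fun z hz w hw hzw => by
        obtain ⟨k, hk, rfl⟩ := Finset.mem_image.1 hz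
        obtain ⟨j, hj, rfl⟩ := Finset.mem_image.1 hw
        exact hd k (by simpa [Nat.lt_succ_iff] using hk) j (by simpa [Nat.lt_succ_iff] using hj)
          (fun h => hzw (h ▸ rfl)))
    rw [Finset.card_image_of_injOn hinj, Finset.card_range] at hcard
    omega
  have hjN : j ≤ N := by omega
  have hA0 := hpos j
  have hB0 := hpos k
  have hρ'0 := hpos N
  have hBA : dist p (x k) ≤ ν * dist p (x j) := (hanti (Nat.succ_le_of_lt hjk)).trans (hxR j)
  have hAρ := hltρ j
  have hBρ := hltρ k
  have hR2 : 2 * ρ < R := by linarith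
  have hd2 : dist (y j) (y k) ≤ 2 * ρ' := by nlinarith
  -- lower bounds for the Euclidean angle at `p`
  have c1 : 1 - η ^ 2 / 200 ≤ ec (y j) p (y k) := by
    unfold ec
    rw [hy3 j hjN, hy3 k hkN, le_div_iff₀ (by positivity)]
    have : dist (y j) (y k) ^ 2 ≤ (η / 10 * ρ') ^ 2 := by gcongr
    nlinarith
  have c2 : ec (y j) p (y k) - 10 * C₀ * ρ ≤ ec (x j) p (y k) := by
    have := ec_mono hA h.kc (p := p) (x := x j) (y := y j) (u := y k)
      (θ := ρ' / dist p (x j)) (by positivity) ((div_le_one hA0).2 (hle j hjN)) (hy1 j hjN)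
      (hy2 j hjN) hA0 (by rw [hy3 k hkN]; exact hρ'0)
      (by rw [hy3 k hkN]; linarith [hltρ N])
    refine le_trans ?_ this
    rw [hy3 k hkN]
    gcongr
    rw [div_le_iff₀ hρ'0]
    calc C₀ * dist (y j) (y k) * (2 * dist (y j) (y k) + dist p (x j))
        ≤ C₀ * (2 * ρ') * (2 * (2 * ρ) + ρ) := by
          gcongr
          exact hd2.trans (by linarith [hltρ N])
      _ = 10 * C₀ * ρ * ρ' := by ring
  have c3 : ec (y k) p (x j) - 10 * C₀ * ρ ≤ ec (x k) p (x j) := by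
    have := ec_mono hA h.kc (p := p) (x := x k) (y := y k) (u := x j)
      (θ := ρ' / dist p (x k)) (by positivity) ((div_le_one hB0).2 (hle k hkN)) (hy1 k hkN)
      (hy2 k hkN) hB0 hA0 (by linarith)
    refine le_trans ?_ this
    have hd3 : dist (y k) (x j) ≤ 2 * dist p (x j) := by
      have := dist_triangle_left (y k) (x j) p
      rw [hy3 k hkN] at this
      linarith [hle j hjN]
    gcongr
    rw [div_le_iff₀ hA0]
    calc C₀ * dist (y k) (x j) * (2 * dist (y k) (x j) + dist p (x k))
        ≤ C₀ * (2 * dist p (x j)) * (2 * (2 * ρ) + ρ) := by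
          gcongr
          exact hd3.trans (by linarith)
      _ = 10 * C₀ * ρ * dist p (x j) := by ring
  rw [ec_comm (y k)] at c3
  have hCρ : C₀ * ρ ≤ C * ρ := by gcongr
  have c4 : 1 - η ^ 2 / 200 - 20 * C * ρ ≤ ec (x k) p (x j) := by linarith
  have hzk : 0 < dist (x k) (x j) := by
    have := dist_triangle p (x k) (x j)
    have : ν ≤ 1 / 2 := by rw [hν]; nlinarith
    nlinarith
  have hxr : ∀ k, x k ∈ ball p r := fun k => ball_subset_ball hρr (hxP k).1.2
  refine hno (x k) ⟨(hxP k).1.1, hxr k⟩ (h.add_strainer hA (hxr k) (hxr j) (mem_ball_self hr)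
    (u := x j) (w := p) (dist_pos.1 (by rwa [dist_comm])) (hxP k).2.2.symm hη le_rfl (by linarith)
    ?_ (fun i => by simp [(hxP j).2.1 i, (hxP k).2.1 i]) (fun i => by simp [(hxP k).2.1 i]))
  have c5 : ec (x j) (x k) p ≤ -1 + (η ^ 2 / 200 + 20 * C * ρ) + 2 * ν := by
    unfold ec at c4 ⊢
    rw [le_div_iff₀ (by positivity)] at c4
    rw [dist_comm (x k) p, dist_comm (x j) p, div_le_iff₀ (by positivity)]
    have ht : dist (x k) (x j) ≤ dist p (x k) + dist p (x j) := dist_triangle_left _ _ _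
    set c := 1 - η ^ 2 / 200 - 20 * C * ρ with hc
    have e1 : dist (x k) (x j) ^ 2 + dist p (x k) ^ 2 - dist p (x j) ^ 2 ≤
        2 * dist p (x k) ^ 2 - 2 * c * (dist p (x k) * dist p (x j)) := by linarith
    have hc0 : ν ≤ c := by rw [hc, hν]; nlinarith
    have hc1 : c ≤ 1 := by rw [hc]; nlinarith [mul_nonneg hC hρ0.le]
    have hg : -1 + (η ^ 2 / 200 + 20 * C * ρ) + 2 * ν = -c + 2 * ν := by rw [hc]; ring
    rw [hg]
    have e2 : dist p (x k) - c * dist p (x j) ≤ (-c + 2 * ν) * dist (x k) (x j) := by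
      rcases le_or_gt (-c + 2 * ν) 0 with hneg | hneg
      · have : (-c + 2 * ν) * (dist p (x k) + dist p (x j)) ≤
            (-c + 2 * ν) * dist (x k) (x j) := mul_le_mul_of_nonpos_left ht hneg
        have h1 : c * dist p (x k) ≤ 1 * dist p (x k) := by gcongr
        nlinarith
      · have : 0 ≤ (-c + 2 * ν) * dist (x k) (x j) := by positivity
        nlinarith
    have e3 := mul_le_mul_of_nonneg_left e2 hB0.le
    linarith
  have c6 : C * (dist (x k) (x j) + dist (x k) p) ≤ 3 * C * ρ := by
    have ht : dist (x k) (x j) ≤ dist p (x k) + dist p (x j) := dist_triangle_left _ _ _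
    rw [dist_comm (x k) p]
    calc C * (dist (x k) (x j) + dist p (x k)) ≤ C * (3 * ρ) := by gcongr; linarith
      _ = _ := by ring
  linarith
end
end

section
variable {X : Type*} [MetricSpace X] {κ : ℝ}

/-! ### Gradient steps -/

lemma mem_ball_of_between {p x y M : X} {r : ℝ} (hx : x ∈ ball p (r / 2)) (hy : y ∈ ball p (r / 2))
    (h : dist x M + dist M y = dist x y) : M ∈ ball p r := by
  rw [mem_ball] at *
  have t1 := dist_triangle_left M p x
  have t2 := dist_triangle M y p
  have t3 := dist_triangle_right x y p
  linarith

set_option maxHeartbeats 800000 in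
lemma gradient_step (hA : IsAlexandrov X κ) {C₀ R : ℝ} (hK : KC κ C₀ R) {c p : X} {r C : ℝ}
    (hc : Far κ c p r C) (hC₀ : C₀ ≤ C) (hrR : 6 * r ≤ R) {z w w' v : X} (hz : z ∈ ball p (r / 2))
    (hw : w ∈ ball p (r / 2)) (hw' : w' ∈ ball p (r / 2)) (hv : v ∈ ball p (r / 2)) {s σ σ' : ℝ}
    (hs : 0 < s) (hσ : 0 < σ) (hσσ' : σ ≤ σ') (hzw : dist z w = s) (hww' : dist w w' = σ')
    (hzw' : dist z w' = s + σ') (hσv : σ ≤ dist w v) {ρ l ε e : ℝ} (hρ : 1 / 2 ≤ ρ) (hl : 0 ≤ l)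
    (he0 : 0 ≤ e)
    (hup : ∀ M ∈ ball p r, dist c M - dist c z ≤ ρ * dist z M + l * dist z M ^ 2)
    (hlow : dist c z + s * (ρ - ε) ≤ dist c w) (he : s * ε + l * (s + σ) ^ 2 ≤ e * σ) :
    dist w' v ^ 2 ≤ dist w v ^ 2 - 2 * σ' / ρ * (dist c v - dist c w) +
      σ' * (8 * C * dist w v ^ 2 +
        dist w v * (4 * e + σ / s + 2 * C * (s + 2 * σ + σ') + 16 * C * σ') + σ') := by
  have hC := hc.2.1
  have hC0 := hK.2.1
  have hL : 0 < dist w v := hσ.trans_le hσv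
  set L := dist w v with hLdef
  set θ := σ / L with hθ
  have hθ0 : 0 < θ := by positivity
  have hθ1 : θ ≤ 1 := (div_le_one hL).2 hσv
  have hθL : θ * L = σ := div_mul_cancel₀ _ hL.ne'
  obtain ⟨M, hM1, hM2⟩ := exists_pt_between hA w v hθ0.le hθ1
  have hM : M ∈ ball p r := mem_ball_of_between hw hv (by rw [hM1, hM2]; ring)
  have hrr : ball p (r / 2) ⊆ ball p r := ball_subset_ball (by linarith [hc.1])
  have hr := hc.1
  have hz' := mem_ball.1 hz
  have hw1 := mem_ball.1 hw
  have hw'1 := mem_ball.1 hw'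
  have hv1 := mem_ball.1 hv
  have hsr : s < r := by rw [← hzw]; linarith [dist_triangle_right z w p]
  have hσ'r : σ' < r := by rw [← hww']; linarith [dist_triangle_right w w' p]
  have hLr : L < r := by linarith [dist_triangle_right w v p]
  rw [← hLdef] at hM1 hM2
  have hwM : dist w M = σ := by rw [hM1, hθL]
  have cM := hc.concave hA hK (by linarith) (hrr hw) (hrr hv) hM hθ0.le hθ1
    (by rw [← hLdef]; exact hM1) (by rw [← hLdef]; exact hM2)
  rw [← hLdef] at cM
  set G := dist c v - dist c w with hG
  set t := dist z M with ht
  have hts : t ≤ s + σ := by rw [ht, ← hzw, ← hwM]; exact dist_triangle _ _ _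
  have hMup := hup M hM
  rw [← ht] at hMup
  set b := (G / L - C * L - e) / ρ with hb
  have hρ0 : 0 < ρ := by linarith
  have hbρ : ρ * b = G / L - C * L - e := by rw [hb]; field_simp
  have ht0 : 0 ≤ t := dist_nonneg
  have htb : s + σ * b ≤ t := by
    have e1 : θ * (1 - θ) * L ^ 2 = σ * L * (1 - θ) := by rw [← hθL]; ring
    have e2 : C * (θ * (1 - θ)) * L ^ 2 ≤ C * (σ * L) := by
      have : σ * L * (1 - θ) ≤ σ * L * 1 := by gcongr; linarith
      calc C * (θ * (1 - θ)) * L ^ 2 = C * (θ * (1 - θ) * L ^ 2) := by ring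
        _ ≤ _ := by rw [e1]; exact mul_le_mul_of_nonneg_left (by linarith) hC
    have e3 : θ * G = σ * (G / L) := by rw [hθ]; ring
    have e4 : l * t ^ 2 ≤ l * (s + σ) ^ 2 := by gcongr
    have e5 : σ * (ρ * b) = σ * (G / L) - C * (σ * L) - e * σ := by rw [hbρ]; ring
    have e6 : (1 - θ) * dist c w + θ * dist c v = dist c w + θ * G := by rw [hG]; ring
    have e7 : ρ * (s + σ * b) ≤ ρ * t := by
      have : ρ * (s + σ * b) = ρ * s + σ * (ρ * b) := by ring
      rw [this, e5]
      linarith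
    exact le_of_mul_le_mul_left e7 hρ0
  have ht2 : s ^ 2 + 2 * s * (σ * b) ≤ t ^ 2 := by
    rcases le_or_gt 0 (s + σ * b) with hp | hn
    · have e1 : (s + σ * b) ^ 2 ≤ t ^ 2 := by gcongr
      linarith [sq_nonneg (σ * b)]
    · have e1 := mul_neg_of_pos_of_neg hs hn
      linarith [sq_nonneg s, sq_nonneg t]
  have hσ'0 : 0 < σ' := by linarith
  have hMw : M ≠ w := dist_pos.1 (by rwa [dist_comm, hwM])
  have hzw0 : z ≠ w := dist_pos.1 (by rwa [hzw])
  have hw'w : w' ≠ w := dist_pos.1 (by rwa [dist_comm, hww'])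
  have hq := quad_cos hA hzw0 hw'w hMw le_rfl (by
    rw [cangle_collinear (by rw [hzw, hww', hzw'])
      (hK.2.2.1 _ (by rw [dist_comm, hzw]; exact hs) (by rw [dist_comm, hzw]; linarith))
      (hK.2.2.1 _ (by rw [hww']; exact hσ'0) (by rw [hww']; linarith))]
    linarith)
  have a1 := abs_le.1 (hK.ca_approx hzw0 hMw (by rw [dist_comm, hzw]; linarith)
    (by rw [hwM]; linarith))
  have a2 := abs_le.1 (hK.ca_approx hw'w hMw (by rw [hww']; linarith) (by rw [hwM]; linarith))
  rw [dist_comm w z, hzw, hwM] at a1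
  rw [hww', hwM] at a2
  have b1 : ec z w M ≤ σ / (2 * s) - b := by
    unfold ec
    rw [dist_comm w z, hzw, hwM, ← ht, div_le_iff₀ (by positivity)]
    have : (σ / (2 * s) - b) * (2 * s * σ) = σ ^ 2 - 2 * s * (σ * b) := by field_simp
    rw [this]; linarith
  set q := b - σ / (2 * s) - C * (s + 2 * σ + σ') with hqdef
  have b2 : q ≤ ec w' w M := by
    have : C₀ * (s + 2 * σ + σ') ≤ C * (s + 2 * σ + σ') := by gcongr
    rw [hqdef]
    linarith
  have b3 : dist M w' ^ 2 ≤ σ ^ 2 + σ' ^ 2 - 2 * σ * σ' * q := by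
    unfold ec at b2
    rw [hww', hwM, le_div_iff₀ (by positivity), dist_comm w' M] at b2
    linarith
  have hMw' : dist M w' ≤ 2 * σ' := by
    have := dist_triangle_left M w' w
    rw [hwM, hww'] at this
    linarith
  have st := stewart hA hK (w := w) (v := v) (M := M) (u := w') (θ := θ)
    (by rw [dist_comm, hwM]; linarith)
    (by rw [hM2]; nlinarith) (by linarith) hθ0.le hθ1 hM1 hM2
  rw [dist_comm w' w, hww', ← hLdef] at st
  have b4 : 2 * C₀ * dist M w' * (θ * (1 - θ) * L) * (2 * dist M w' + L) ≤
      θ * (σ' * (4 * C * L * (4 * σ' + L))) := by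
    calc 2 * C₀ * dist M w' * (θ * (1 - θ) * L) * (2 * dist M w' + L)
        ≤ 2 * C * (2 * σ') * (θ * 1 * L) * (2 * (2 * σ') + L) := by
          have h0 : 0 ≤ 1 - θ := by linarith
          have h1 : 1 - θ ≤ 1 := by linarith
          generalize 1 - θ = ζ at h0 h1
          gcongr
      _ = _ := by ring
  have b5 : σ ^ 2 - 2 * σ * σ' * q = θ * (L * σ - 2 * L * σ' * q) := by rw [← hθL]; ring
  have b6 : θ * dist w' v ^ 2 ≤ θ * (L ^ 2 - 2 * L * σ' * q + σ' ^ 2 +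
      σ' * (4 * C * L * (4 * σ' + L))) := by
    have e1 : θ * (1 - θ) * L ^ 2 = θ * (L ^ 2 - L * σ) := by rw [← hθL]; ring
    linarith
  have b7 := le_of_mul_le_mul_left b6 hθ0
  refine b7.trans ?_
  have b8 : 2 * L * σ' * b = 2 * σ' / ρ * G - σ' * ((2 / ρ) * (C * L ^ 2 + L * e)) := by
    rw [hb]; field_simp; ring
  have b9 : (2 / ρ) * (C * L ^ 2 + L * e) ≤ 4 * (C * L ^ 2 + L * e) := by
    gcongr
    rw [div_le_iff₀ hρ0]; linarith
  have b10 : σ' * ((2 / ρ) * (C * L ^ 2 + L * e)) ≤ σ' * (4 * (C * L ^ 2 + L * e)) := by gcongr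
  have b11 : 2 * L * σ' * q = 2 * L * σ' * b - σ' * (L * (σ / s)) -
      σ' * (L * (2 * C * (s + 2 * σ + σ'))) := by
    rw [hqdef]; field_simp
  rw [b11, b8]
  linarith
/-- Points on a geodesic from `z` inherit an increment estimate from its endpoint. -/
lemma increment_between (hA : IsAlexandrov X κ) {C₀ R : ℝ} (hK : KC κ C₀ R) {c p : X} {r C : ℝ}
    (hc : Far κ c p r C) (hrR : 2 * r ≤ R) {z u : X} (hz : z ∈ ball p (r / 2))
    (hu : u ∈ ball p (r / 2)) {A θ : ℝ} (hθ : 0 ≤ θ) (hθ1 : θ ≤ 1)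
    (h : dist c z + dist z u * A + C * dist z u ^ 2 ≤ dist c u) :
    ∃ u', dist z u' = θ * dist z u ∧ dist u' u = (1 - θ) * dist z u ∧
      dist c z + dist z u' * A + C * dist z u' ^ 2 ≤ dist c u' := by
  obtain ⟨M, hM1, hM2⟩ := exists_pt_between hA z u hθ hθ1
  have hM : M ∈ ball p r := mem_ball_of_between hz hu (by rw [hM1, hM2]; ring)
  have hrr : ball p (r / 2) ⊆ ball p r := ball_subset_ball (by linarith [hc.1])
  have cM := hc.concave hA hK hrR (hrr hz) (hrr hu) hM hθ hθ1 hM1 hM2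
  refine ⟨M, hM1, hM2, ?_⟩
  rw [hM1]
  have := mul_le_mul_of_nonneg_left h hθ
  linarith

set_option maxHeartbeats 800000 in
lemma exists_gradient (hA : IsAlexandrov X κ) {C₀ R : ℝ} (hK : KC κ C₀ R) {c p : X} {r C : ℝ}
    (hc : Far κ c p r C) (hC₀ : C₀ ≤ C) (hrR : 6 * r ≤ R)
    {z : X} (hz : z ∈ ball p (r / 2)) (hopp : ∀ s₀ > 0, ∃ M, 0 < dist z M ∧
      dist z M < s₀ ∧ dist c z + 3 / 4 * dist z M ≤ dist c M) {η : ℝ} (hη : 0 < η) :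
    ∃ ρ, 1 / 2 ≤ ρ ∧ ρ ≤ 1 ∧ ∃ K : ℕ, 0 < K ∧ 8 ≤ η * K ∧ ∃ S₀ > 0, ∀ S, 0 < S → S ≤ S₀ → ∃ w : ℕ → X,
      (∀ j ≤ K, dist z (w j) = j * (S / K)) ∧ (∀ j < K, dist (w j) (w (j + 1)) = S / K) ∧
      ∀ j, 1 ≤ j → j < K → ∀ v ∈ ball p (r / 2),
        dist (w (j + 1)) v ^ 2 ≤ dist (w j) v ^ 2 -
          2 * (S / K) / ρ * (dist c v - dist c (w j)) +
          S / K * (8 * C * dist (w j) v ^ 2 + η * (dist (w j) v + S)) := by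
  have hC := hc.2.1
  have hr := hc.1
  set Q : Set ℝ := (fun M => (dist c M - dist c z) / dist z M - C * dist z M) ''
    {M | M ∈ ball p r ∧ M ≠ z} with hQ
  have hQ1 : ∀ q ∈ Q, q ≤ 1 := by
    rintro _ ⟨M, ⟨hM, hMz⟩, rfl⟩
    have h1 : (dist c M - dist c z) / dist z M ≤ 1 := by
      refine div_le_one_of_le₀ ?_ dist_nonneg
      linarith [dist_triangle c z M]
    have h2 : 0 ≤ C * dist z M := by positivity
    dsimp only
    linarith
  have hQb : BddAbove Q := ⟨1, hQ1⟩
  set ρ := sSup Q with hρdef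
  have hrz : 0 < r / 2 - dist z p := by have := mem_ball.1 hz; linarith
  have hρ : 1 / 2 ≤ ρ := by
    obtain ⟨M, h1, h2, h3⟩ := hopp (min (r / 2) (1 / (4 * (C + 1)))) (by positivity)
    have h4 : C * dist z M ≤ 1 / 4 := by
      have : dist z M ≤ 1 / (4 * (C + 1)) := (h2.trans_le (min_le_right _ _)).le
      rw [le_div_iff₀ (by positivity)] at this
      linarith
    have hM : M ∈ ball p r := by
      have h5 := h2.trans_le (min_le_left _ _)
      rw [mem_ball]
      linarith [dist_triangle_left M p z]
    have h6 : 3 / 4 ≤ (dist c M - dist c z) / dist z M := by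
      rw [le_div_iff₀ h1]; linarith
    have := le_csSup hQb (mem_image_of_mem _ (show M ∈ {M | M ∈ ball p r ∧ M ≠ z} from
      ⟨hM, (dist_pos.1 h1).symm⟩))
    rw [← hρdef] at this
    linarith
  have hQn : Q.Nonempty := by
    by_contra hh
    rw [not_nonempty_iff_eq_empty] at hh
    rw [hρdef, hh, Real.sSup_empty] at hρ
    linarith
  have hup : ∀ M ∈ ball p r, dist c M - dist c z ≤ ρ * dist z M + C * dist z M ^ 2 := by
    intro M hM
    rcases eq_or_ne M z with rfl | hMz
    · simp
    have := le_csSup hQb (mem_image_of_mem _ (show M ∈ {M | M ∈ ball p r ∧ M ≠ z} from ⟨hM, hMz⟩))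
    rw [← hρdef] at this
    have hp : 0 < dist z M := dist_pos.2 hMz.symm
    have h2 : (dist c M - dist c z) / dist z M ≤ ρ + C * dist z M := by linarith
    rw [div_le_iff₀ hp] at h2
    linarith
  obtain ⟨K, hKη⟩ := exists_nat_ge (8 / η)
  rw [div_le_iff₀ hη] at hKη
  have hK0 : 0 < K := by
    rcases Nat.eq_zero_or_pos K with rfl | h
    · rw [Nat.cast_zero] at hKη; linarith
    · exact h
  have hKr : (1 : ℝ) ≤ K := by exact_mod_cast hK0
  set e := η / 16 with he
  set ε := e / (2 * K ^ 2) with hε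
  have he0 : 0 < e := by positivity
  have hε0 : 0 < ε := by positivity
  obtain ⟨_, ⟨M₁, ⟨hM₁, hM₁z⟩, rfl⟩, hM₁ρ⟩ := exists_lt_of_lt_csSup hQn (sub_lt_self ρ hε0)
  have hzM₁ : 0 < dist z M₁ := dist_pos.2 hM₁z.symm
  refine ⟨ρ, hρ, csSup_le hQn hQ1, K, hK0, by linarith, min ((r / 2 - dist z p) / 2) (min (dist z M₁)
    (min ε (η / 4) / (24 * C + 1))), by positivity, fun S hS hSle => ?_⟩
  have hS1 : S ≤ (r / 2 - dist z p) / 2 := hSle.trans (min_le_left _ _)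
  have hS2 : S ≤ dist z M₁ := (hSle.trans (min_le_right _ _)).trans (min_le_left _ _)
  have hS3 : S ≤ min ε (η / 4) / (24 * C + 1) :=
    (hSle.trans (min_le_right _ _)).trans (min_le_right _ _)
  rw [le_div_iff₀ (by positivity)] at hS3
  have hS4 := hS3.trans (min_le_left _ _)
  have hS5 := hS3.trans (min_le_right _ _)
  -- the endpoint of the curve, on the geodesic from `z` to `M₁`
  have hrr : ball p (r / 2) ⊆ ball p r := ball_subset_ball (by linarith [hc.1])
  obtain ⟨u₀, hu₀, hu₀'⟩ : ∃ u₀, dist z u₀ = S ∧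
      dist c z + dist z u₀ * (ρ - ε) + C * dist z u₀ ^ 2 ≤ dist c u₀ := by
    obtain ⟨M, h1, h2⟩ := exists_pt_between hA z M₁ (t := S / dist z M₁) (by positivity)
      ((div_le_one hzM₁).2 hS2)
    have h3 : dist z M = S := by rw [h1, div_mul_cancel₀ _ hzM₁.ne']
    have hM : M ∈ ball p r := by
      rw [mem_ball]
      linarith [dist_triangle_left M p z]
    have cM := hc.concave hA hK (by linarith) (hrr hz) hM₁ hM (by positivity)
      ((div_le_one hzM₁).2 hS2) h1 h2
    refine ⟨M, h3, ?_⟩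
    rw [h3]
    dsimp only at hM₁ρ
    have h4 : (ρ - ε + C * dist z M₁) * dist z M₁ ≤ dist c M₁ - dist c z := by
      rw [← le_div_iff₀ hzM₁]; linarith
    set θ := S / dist z M₁ with hθ
    have h5 : θ * dist z M₁ = S := div_mul_cancel₀ _ hzM₁.ne'
    have h6 := mul_le_mul_of_nonneg_left h4 (show 0 ≤ θ by positivity)
    have h7 : θ * ((ρ - ε + C * dist z M₁) * dist z M₁) = S * (ρ - ε) + C * S * dist z M₁ := by
      rw [← h5]; ring
    have h8 : C * (θ * (1 - θ)) * dist z M₁ ^ 2 = C * S * dist z M₁ - C * S ^ 2 := by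
      rw [← h5]; ring
    rw [h7] at h6
    rw [h8] at cM
    linarith
  have hnear : ∀ x, dist z x ≤ S → x ∈ ball p (r / 2) := fun x hx => by
    rw [mem_ball]
    linarith [dist_triangle_left x p z]
  obtain ⟨u, -, huP, huR⟩ := exists_seq_step
    (P := fun i u => dist z u = ((K - i : ℕ) : ℝ) * (S / K) ∧
      dist c z + dist z u * (ρ - ε) + C * dist z u ^ 2 ≤ dist c u)
    (R := fun i x y => i < K → dist x y = S / K) (x₀ := u₀)
    ⟨by rw [Nat.sub_zero, hu₀]; field_simp, hu₀'⟩ (by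
      rintro i x ⟨hx1, hx2⟩
      rcases Nat.lt_or_ge i K with hi | hi
      · obtain ⟨j, hj⟩ : ∃ j, K - i = j + 1 := ⟨K - i - 1, by omega⟩
        have hxS : dist z x ≤ S := by
          rw [hx1, ← mul_div_assoc, div_le_iff₀ (by positivity), mul_comm]
          gcongr
          exact Nat.sub_le _ _
        have hj0 : (0 : ℝ) < j + 1 := by positivity
        obtain ⟨y, hy1, hy2, hy3⟩ := increment_between hA hK hc (by linarith) hz (hnear x hxS)
          (θ := j / (j + 1)) (by positivity) (by rw [div_le_one hj0]; linarith) hx2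
        rw [hx1, hj] at hy1 hy2
        refine ⟨y, ⟨?_, hy3⟩, fun _ => ?_⟩
        · rw [hy1, show K - (i + 1) = j by omega]
          push_cast
          field_simp
        · rw [dist_comm, hy2]
          push_cast
          field_simp
          ring
      · refine ⟨x, ⟨?_, hx2⟩, fun h => absurd h (by omega)⟩
        rw [hx1, show K - i = 0 by omega, show K - (i + 1) = 0 by omega])
  have hw1 : ∀ j ≤ K, dist z (u (K - j)) = j * (S / K) := fun j hj => by
    rw [(huP (K - j)).1, show K - (K - j) = j by omega]
  have hw2 : ∀ j < K, dist (u (K - j)) (u (K - (j + 1))) = S / K := fun j hj => by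
    rw [dist_comm, show K - j = K - (j + 1) + 1 by omega]
    exact huR _ (by omega)
  have hwS : ∀ j ≤ K, dist z (u (K - j)) ≤ S := fun j hj => by
    rw [hw1 j hj, ← mul_div_assoc, div_le_iff₀ (by positivity), mul_comm]
    gcongr
  refine ⟨fun j => u (K - j), hw1, hw2, fun j hj1 hjK v hv => ?_⟩
  have hjr : (1 : ℝ) ≤ j := by exact_mod_cast hj1
  set w := u (K - j) with hw
  set w' := u (K - (j + 1)) with hw'
  set s := j * (S / K) with hs
  set σ' := S / K with hσ'
  have hσ'0 : 0 < σ' := by positivity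
  have hs0 : σ' ≤ s := by rw [hs]; exact le_mul_of_one_le_left hσ'0.le hjr
  have hsS : s ≤ S := by have := hwS j hjK.le; rwa [hw1 j hjK.le] at this
  have hσ'η : 8 * σ' ≤ η * S := by
    rw [hσ', ← mul_div_assoc, div_le_iff₀ (by positivity)]
    have := mul_le_mul_of_nonneg_right hKη hS.le
    linarith
  set σ := σ' / K with hσ
  have hσ0 : 0 < σ := by positivity
  have hσσ' : σ ≤ σ' := div_le_self hσ'0.le hKr
  have hG : |dist c v - dist c w| ≤ dist w v := by
    have := abs_dist_sub_le v w c
    rwa [dist_comm v c, dist_comm w c, dist_comm v w] at this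
  have hρ0 : 0 < ρ := by linarith
  rcases le_or_gt σ (dist w v) with hLσ | hLσ
  · have step := gradient_step hA hK hc hC₀ hrR (z := z) (w := w) (w' := w') (v := v) (s := s)
      (σ := σ) (σ' := σ') hz (hnear _ (hwS j hjK.le)) (hnear _ (hwS (j + 1) hjK)) hv
      (by linarith) hσ0 hσσ' (hw1 j hjK.le) (hw2 j hjK)
      (by rw [hw1 (j + 1) hjK]; push_cast; ring) hLσ hρ hC he0.le hup (ε := ε) (by
        have := (huP (K - j)).2
        rw [hw1 j hjK.le] at this
        have h0 : 0 ≤ C * s ^ 2 := by positivity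
        linarith) (by
        have h1 : (s + σ) ^ 2 ≤ (2 * S) ^ 2 := by
          gcongr
          linarith
        have h2 : C * (s + σ) ^ 2 ≤ C * (2 * S) ^ 2 := by gcongr
        have h3 : C * (2 * S) ^ 2 ≤ ε * S := by
          have : C * 4 * S ≤ ε := by nlinarith
          have := mul_le_mul_of_nonneg_right this hS.le
          linarith
        have h4 : s * ε ≤ S * ε := by gcongr
        have h5 : e * σ = 2 * ε * S := by
          rw [hε, hσ, hσ']; field_simp
        linarith)
    refine step.trans ?_
    have h1 : σ / s ≤ η / 8 := by
      rw [div_le_iff₀ (by linarith), hσ, div_le_iff₀ (by positivity)]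
      have : σ' * 8 ≤ s * (η * K) := mul_le_mul hs0 (by linarith) (by norm_num) (by linarith)
      linarith
    have h2 : 4 * e + σ / s + 2 * C * (s + 2 * σ + σ') + 16 * C * σ' ≤ η := by
      have : C * (s + 2 * σ + σ') ≤ C * (4 * S) := by gcongr; linarith
      have : C * σ' ≤ C * S := by gcongr; linarith
      linarith
    have h3 := mul_le_mul_of_nonneg_left h2 (dist_nonneg (x := w) (y := v))
    have h4 : 8 * C * dist w v ^ 2 +
        dist w v * (4 * e + σ / s + 2 * C * (s + 2 * σ + σ') + 16 * C * σ') + σ' ≤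
        8 * C * dist w v ^ 2 + η * (dist w v + S) := by linarith
    have h5 := mul_le_mul_of_nonneg_left h4 hσ'0.le
    linarith
  · have h1 : dist w' v ≤ dist w v + σ' := by
      have h := dist_triangle_left w' v w
      have h' := hw2 j hjK
      linarith
    have h2 : dist w' v ^ 2 ≤ (dist w v + σ') ^ 2 := by gcongr
    have h3 : 2 * σ' / ρ * (dist c v - dist c w) ≤ σ' * (4 * dist w v) := by
      calc 2 * σ' / ρ * (dist c v - dist c w) ≤ 2 * σ' / ρ * dist w v := by
            gcongr; exact (le_abs_self _).trans hG
        _ ≤ 4 * σ' * dist w v := by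
            gcongr; rw [div_le_iff₀ hρ0]; linarith [mul_le_mul_of_nonneg_left hρ hσ'0.le]
        _ = _ := by ring
    have h4 : σ' * (4 * dist w v + 2 * dist w v + σ') ≤
        σ' * (8 * C * dist w v ^ 2 + η * (dist w v + S)) := by
      refine mul_le_mul_of_nonneg_left ?_ hσ'0.le
      have : 0 ≤ C * dist w v ^ 2 := by positivity
      have : 0 ≤ η * dist w v := by positivity
      linarith
    linarith
end

section
variable {X : Type*} [MetricSpace X] {κ : ℝ}

/-! ### The Lieberman inequality -/

set_option maxHeartbeats 800000 in
/-- A gradient step inside an extremal subset. -/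
lemma IsExtremal.exists_gradient_step (hA : IsAlexandrov X κ) {E : Set X} (hE : IsExtremal κ E)
    {C₀ R : ℝ} (hK : KC κ C₀ R) (hcpt : ∀ (p : X) (r : ℝ), r < R → IsCompact (closedBall p r))
    {c p : X} {r C : ℝ} (hc : Far κ c p r C) (hC₀ : C₀ ≤ C) (hrR : 6 * r ≤ R)
    {z : X} (hzE : z ∈ E) (hz : z ∈ ball p (r / 2)) (hopp : ∀ s₀ > 0, ∃ M, 0 < dist z M ∧
      dist z M < s₀ ∧ dist c z + 3 / 4 * dist z M ≤ dist c M) {ε s₀ : ℝ} (hε : 0 < ε)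
    (hs₀ : 0 < s₀) :
    ∃ ρ, 1 / 2 ≤ ρ ∧ ρ ≤ 1 ∧ ∃ S > 0, ∃ z' ∈ E, dist z z' < s₀ ∧ ∀ v ∈ ball p (r / 2),
      dist z' v ^ 2 ≤ dist z v ^ 2 - 2 * S / ρ * (dist c v - dist c z) +
        S * (8 * C * dist z v ^ 2 + ε) := by
  have hC := hc.2.1
  have hr := hc.1
  have hrz : 0 < r / 2 - dist z p := by have := mem_ball.1 hz; linarith
  set τ := min 1 (ε / (16 * (r + 1))) with hτ
  have hτ0 : 0 < τ := by positivity
  have hτ1 : τ ≤ 1 := min_le_left _ _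
  have hτε : τ * (16 * (r + 1)) ≤ ε := by
    have : τ ≤ ε / (16 * (r + 1)) := min_le_right _ _
    rwa [le_div_iff₀ (by positivity)] at this
  set η := τ ^ 2 with hη
  have hη0 : 0 < η := by positivity
  have hητ : η ≤ τ := by rw [hη, sq]; exact mul_le_of_le_one_left hτ0.le hτ1
  obtain ⟨ρ, hρ, hρ1, K, hK0, hKη, S₀, hS₀, hw⟩ := exists_gradient hA hK hc hC₀ hrR hz hopp hη0
  have hρ0 : 0 < ρ := by linarith
  set S := min S₀ (min 1 (min (s₀ / 4) (min ((r / 2 - dist z p) / 4)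
    (min (ε / 8 / (4 + 8 * C * (2 * r + 1))) (η / (12 * C + 1)))))) with hS
  have hS0 : 0 < S := by positivity
  have hS1 : S ≤ 1 := (min_le_right _ _).trans (min_le_left _ _)
  have hS2 : S ≤ min (s₀ / 4) (min ((r / 2 - dist z p) / 4)
    (min (ε / 8 / (4 + 8 * C * (2 * r + 1))) (η / (12 * C + 1)))) :=
    (min_le_right _ _).trans (min_le_right _ _)
  have hS3 : S ≤ s₀ / 4 := hS2.trans (min_le_left _ _)
  have hS4 : S ≤ (r / 2 - dist z p) / 4 := (hS2.trans (min_le_right _ _)).trans (min_le_left _ _)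
  have hS5 : S * (4 + 8 * C * (2 * r + 1)) ≤ ε / 8 := by
    rw [← le_div_iff₀ (by positivity)]
    exact ((hS2.trans (min_le_right _ _)).trans (min_le_right _ _)).trans (min_le_left _ _)
  have hS6 : S * (12 * C + 1) ≤ η := by
    rw [← le_div_iff₀ (by positivity)]
    exact ((hS2.trans (min_le_right _ _)).trans (min_le_right _ _)).trans (min_le_right _ _)
  obtain ⟨w, hw1, hw2, hw3⟩ := hw S hS0 (min_le_left _ _)
  clear_value S η τ
  have hKr : (1 : ℝ) ≤ K := by exact_mod_cast hK0
  set σ := S / K with hσ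
  have hσ0 : 0 < σ := by positivity
  have hKσ : K * σ = S := by rw [hσ]; field_simp
  have hσS : 8 * σ ≤ η * S := by
    rw [hσ, ← mul_div_assoc, div_le_iff₀ (by positivity)]
    have := mul_le_mul_of_nonneg_right hKη hS0.le
    linarith
  have hσS' : σ ≤ S := div_le_self hS0.le hKr
  clear_value σ
  have hwS : ∀ j ≤ K, dist z (w j) ≤ S := fun j hj => by
    rw [hw1 j hj, ← hKσ]
    gcongr
  have hw11 : dist z (w 1) = σ := by rw [hw1 1 hK0]; simp
  -- nearest points on `E`
  have hnear : ∀ j ≤ K, ∃ y ∈ E, (∀ e ∈ E, dist (w j) y ≤ dist (w j) e) ∧ y ∈ ball p (r / 2) ∧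
      dist c (w j) - C * dist (w j) y ^ 2 ≤ dist c y := fun j hj => by
    obtain ⟨y, hy1, hy2, hy3⟩ := hE.exists_proj hcpt hzE (q := w j) (by
      rw [dist_comm]
      have := hwS j hj
      linarith [dist_nonneg (x := z) (y := p)])
    have h1 := hy2 z hzE
    rw [dist_comm _ z] at h1
    have h2 := hwS j hj
    have h3 : y ∈ ball p (r / 2) := by
      rw [mem_ball]
      linarith [dist_triangle_left y p (w j), dist_triangle_left (w j) p z]
    refine ⟨y, hy1, hy2, h3, hy3 _ _ _ _ hc ?_ (ball_subset_ball (by linarith) h3)⟩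
    rw [mem_ball]
    linarith [dist_triangle_left (w j) p z]
  have : Nonempty X := ⟨p⟩
  choose! y hyE hy1 hy2 hy3 using hnear
  have he : ∀ j, 1 ≤ j → j ≤ K → dist (w j) (y j) ^ 2 ≤ j * (σ * (3 * η * S)) := by
    intro j hj1
    induction j, hj1 using Nat.le_induction with
    | base =>
      intro h1
      have h2 : dist (w 1) (y 1) ≤ σ := by
        rw [← hw11, dist_comm z]; exact hy1 1 h1 z hzE
      have h3 : dist (w 1) (y 1) ^ 2 ≤ σ ^ 2 := by gcongr
      have h4 := mul_le_mul_of_nonneg_left hσS hσ0.le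
      have h5 : 0 ≤ σ * (η * S) := by positivity
      rw [Nat.cast_one]
      linarith
    | succ j hj ih =>
      intro hjK
      have ih := ih (by omega)
      have h1 := hw3 j hj (by omega) (y j) (hy2 j (by omega))
      have h2 := hy1 (j + 1) hjK (y j) (hyE j (by omega))
      have h3 := hy3 j (by omega)
      have h4 : dist (w j) (y j) ≤ S := by
        have := hy1 j (by omega) z hzE
        rw [dist_comm _ z] at this
        exact this.trans (hwS j (by omega))
      have h5 : dist (w (j + 1)) (y (j + 1)) ^ 2 ≤ dist (w (j + 1)) (y j) ^ 2 := by gcongr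
      have h6 : -(4 * σ * (C * dist (w j) (y j) ^ 2)) ≤
          2 * σ / ρ * (dist c (y j) - dist c (w j)) := by
        have h7 : 2 * σ / ρ ≤ 4 * σ := by rw [div_le_iff₀ hρ0]; linarith [mul_le_mul_of_nonneg_left hρ hσ0.le]
        have h8 : 0 ≤ C * dist (w j) (y j) ^ 2 := by positivity
        have h9 : 2 * σ / ρ * -(C * dist (w j) (y j) ^ 2) ≤
          2 * σ / ρ * (dist c (y j) - dist c (w j)) := by gcongr; linarith
        have h10 := mul_le_mul_of_nonneg_right h7 h8
        linarith
      have h11 : 12 * C * dist (w j) (y j) ^ 2 + η * (dist (w j) (y j) + S) ≤ 3 * η * S := by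
        have : 12 * C * dist (w j) (y j) ^ 2 ≤ 12 * C * S ^ 2 := by gcongr
        have : 12 * C * S ^ 2 ≤ η * S := by nlinarith
        have : η * dist (w j) (y j) ≤ η * S := by gcongr
        linarith
      have h12 := mul_le_mul_of_nonneg_left h11 hσ0.le
      push_cast
      linarith
  have heK : dist (w K) (y K) ≤ 2 * τ * S := by
    have h1 := he K hK0 le_rfl
    have h2 : (K : ℝ) * (σ * (3 * η * S)) = 3 * τ ^ 2 * S ^ 2 := by
      rw [← mul_assoc, hKσ, hη]; ring
    have h3 : dist (w K) (y K) ^ 2 ≤ (2 * τ * S) ^ 2 := by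
      have : 0 ≤ τ ^ 2 * S ^ 2 := by positivity
      nlinarith
    exact (abs_le_of_sq_le_sq' h3 (by positivity)).2
  refine ⟨ρ, hρ, hρ1, S, hS0, y K, hyE K le_rfl, ?_, fun v hv => ?_⟩
  · have h1 := hwS K le_rfl
    have h2 := hy1 K le_rfl z hzE
    rw [dist_comm _ z] at h2
    linarith [dist_triangle z (w K) (y K)]
  have hzv : dist z v < r := by
    have := mem_ball.1 hz
    have := mem_ball.1 hv
    linarith [dist_triangle_right z v p]
  have hG : |dist c v - dist c z| ≤ dist z v := by
    have := abs_dist_sub_le v z c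
    rwa [dist_comm v c, dist_comm z c, dist_comm v z] at this
  have h2ρ : 2 * σ / ρ ≤ 4 * σ := by rw [div_le_iff₀ hρ0]; linarith [mul_le_mul_of_nonneg_left hρ hσ0.le]
  have hsum : ∀ j, 1 ≤ j → j ≤ K → dist (w j) v ^ 2 ≤ dist z v ^ 2 +
      j * (σ * (8 * C * dist z v ^ 2 + ε / 4) - 2 * σ / ρ * (dist c v - dist c z)) +
      σ * (6 * r + S) := by
    intro j hj1
    induction j, hj1 using Nat.le_induction with
    | base =>
      intro _
      have h1 : dist (w 1) v ≤ σ + dist z v := by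
        rw [← hw11]; exact dist_triangle_left _ _ _
      have h2 : dist (w 1) v ^ 2 ≤ (σ + dist z v) ^ 2 := by gcongr
      have h3 : 2 * σ / ρ * (dist c v - dist c z) ≤ 4 * σ * r := by
        have h4 : 2 * σ / ρ * (dist c v - dist c z) ≤ 2 * σ / ρ * r := by
          gcongr
          exact (le_abs_self _).trans (hG.trans hzv.le)
        exact h4.trans (mul_le_mul_of_nonneg_right h2ρ hr.le)
      have h5 : 0 ≤ σ * (8 * C * dist z v ^ 2 + ε / 4) := by positivity
      have h6 : σ * dist z v ≤ σ * r := by gcongr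
      have h7 : σ * σ ≤ σ * S := by gcongr
      rw [Nat.cast_one]
      linarith
    | succ j hj ih =>
      intro hjK
      have ih := ih (by omega)
      have h1 := hw3 j hj (by omega) v hv
      have h2 := hwS j (by omega)
      have h3 : dist c (w j) ≤ dist c z + S := by linarith [dist_triangle c z (w j)]
      have h4 : dist (w j) v ≤ dist z v + S := by linarith [dist_triangle_left (w j) v z]
      have h5 : 2 * σ / ρ * (dist c v - dist c z) - 4 * σ * S ≤
          2 * σ / ρ * (dist c v - dist c (w j)) := by
        have h6 : 2 * σ / ρ * (dist c v - dist c z - S) ≤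
          2 * σ / ρ * (dist c v - dist c (w j)) :=
          mul_le_mul_of_nonneg_left (by linarith) (by positivity)
        have h7 := mul_le_mul_of_nonneg_right h2ρ hS0.le
        linarith
      have h8 : 4 * S + 8 * C * dist (w j) v ^ 2 + η * (dist (w j) v + S) ≤
          8 * C * dist z v ^ 2 + ε / 4 := by
        have h9 : 8 * C * dist (w j) v ^ 2 ≤ 8 * C * (dist z v + S) ^ 2 := by gcongr
        have h10 : 8 * C * (2 * dist z v * S + S ^ 2) ≤ 8 * C * (2 * r * S + 1 * S) := by
          rw [sq]; gcongr
        have h11 : η * (dist (w j) v + S) ≤ τ * (r + 2) := 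
          mul_le_mul hητ (by linarith) (by positivity) hτ0.le
        have h12 : 0 ≤ τ * r := by positivity
        linarith
      have h13 := mul_le_mul_of_nonneg_left h8 hσ0.le
      push_cast
      linarith
  have h1 := hsum K hK0 le_rfl
  have h2 : dist (y K) v ≤ 2 * τ * S + dist (w K) v := by
    linarith [dist_triangle_left (y K) v (w K)]
  have h3 : dist (y K) v ^ 2 ≤ (2 * τ * S + dist (w K) v) ^ 2 := by gcongr
  have h4 : dist (w K) v ≤ r + 1 := by linarith [dist_triangle_left (w K) v z, hwS K le_rfl]
  have h5 : τ * S * dist (w K) v ≤ τ * S * (r + 1) := by gcongr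
  have h6 : (2 * τ * S) ^ 2 ≤ 4 * (τ * S) := by
    have e1 : τ * S ≤ 1 := mul_le_one₀ hτ1 hS0.le hS1
    have e2 : τ * S * (τ * S) ≤ τ * S * 1 := by gcongr
    linarith
  have h7 : σ * (6 * r + S) ≤ τ * S * (r + 1) := by
    have e1 : 8 * σ ≤ τ * S := hσS.trans (by gcongr)
    have e2 : 8 * σ * (6 * r + S) ≤ τ * S * (6 * r + 1) := by gcongr
    have e3 : 0 ≤ τ * S * r := by positivity
    have e4 : 0 ≤ τ * S := by positivity
    linarith
  have h8 : (K : ℝ) * (σ * (8 * C * dist z v ^ 2 + ε / 4) -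
      2 * σ / ρ * (dist c v - dist c z)) =
      S * (8 * C * dist z v ^ 2 + ε / 4) - 2 * S / ρ * (dist c v - dist c z) := by
    rw [← hKσ]; ring
  rw [h8] at h1
  have h9 : τ * S * (r + 1) ≤ S * (ε / 16) := by
    have := mul_le_mul_of_nonneg_left hτε hS0.le
    linarith
  have h10 : τ * S ≤ τ * S * (r + 1) := by
    have : 0 ≤ τ * S * r := by positivity
    linarith
  linarith [mul_pos hS0 hε]

/-- The Lieberman inequality for a critical midpoint. -/
lemma IsExtremal.lieberman (hA : IsAlexandrov X κ) {E : Set X} (hE : IsExtremal κ E)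
    {C₀ R : ℝ} (hK : KC κ C₀ R) (hcpt : ∀ (p : X) (r : ℝ), r < R → IsCompact (closedBall p r))
    {c p : X} {r C : ℝ} (hc : Far κ c p r C) (hC₀ : C₀ ≤ C) (hrR : 6 * r ≤ R)
    {z : X} (hzE : z ∈ E) (hz : z ∈ ball p (r / 2)) (hopp : ∀ s₀ > 0, ∃ M, 0 < dist z M ∧
      dist z M < s₀ ∧ dist c z + 3 / 4 * dist z M ≤ dist c M) {v₁ v₂ : X}
    (hv₁ : v₁ ∈ ball p (r / 2)) (hv₂ : v₂ ∈ ball p (r / 2)) {s₀ : ℝ} (hs₀ : 0 < s₀)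
    (hmin : ∀ z' ∈ E, dist z z' < s₀ →
      dist z v₁ ^ 2 + dist z v₂ ^ 2 ≤ dist z' v₁ ^ 2 + dist z' v₂ ^ 2) :
    dist c v₁ + dist c v₂ - 2 * dist c z ≤ 4 * C * (dist z v₁ ^ 2 + dist z v₂ ^ 2) := by
  refine le_of_forall_pos_le_add fun ε hε => ?_
  obtain ⟨ρ, hρ, hρ1, S, hS, z', hz', hzz', h⟩ :=
    hE.exists_gradient_step hA hK hcpt hc hC₀ hrR hzE hz hopp hε hs₀
  have h1 := h v₁ hv₁
  have h2 := h v₂ hv₂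
  have h3 := hmin z' hz' hzz'
  have hρ0 : 0 < ρ := by linarith
  set A := dist c v₁ + dist c v₂ - 2 * dist c z with hA
  set B := 4 * C * (dist z v₁ ^ 2 + dist z v₂ ^ 2) + ε with hB
  have hB0 : 0 ≤ B := by have := hc.2.1; positivity
  have h4 : 2 * S / ρ * A ≤ S * (2 * B) := by
    rw [hA, hB]; linarith
  have h5 : 2 * S * A ≤ 2 * S * (ρ * B) := by
    have e1 := mul_le_mul_of_nonneg_left h4 hρ0.le
    have e2 : ρ * (2 * S / ρ * A) = 2 * S * A := by field_simp
    linarith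
  have h6 := le_of_mul_le_mul_left h5 (by positivity)
  exact h6.trans (mul_le_of_le_one_left hB0 hρ1)
end

section
variable {X : Type*} [MetricSpace X] {κ : ℝ}

/-! ### Chains of minimal energy -/

/-- The energy of the first `N` steps of a chain. -/
def energy (c : ℕ → X) (N : ℕ) : ℝ := ∑ j ∈ Finset.range N, dist (c j) (c (j + 1)) ^ 2

/-- `c` is a chain in `K` which reaches `y` from `x` in `N` steps. -/
def IsPath (K : Set X) (x y : X) (N : ℕ) (c : ℕ → X) : Prop :=
  c 0 = x ∧ c N = y ∧ ∀ j, c j ∈ K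

lemma energy_nonneg (c : ℕ → X) (N : ℕ) : 0 ≤ energy c N :=
  Finset.sum_nonneg fun _ _ => sq_nonneg _

lemma dist_sq_le_energy (c : ℕ → X) {N i : ℕ} (hi : i ≤ N) :
    dist (c 0) (c i) ^ 2 ≤ N * energy c N := by
  have h1 : dist (c 0) (c i) ≤ ∑ j ∈ Finset.range N, dist (c j) (c (j + 1)) :=
    (dist_le_range_sum_dist c i).trans (Finset.sum_le_sum_of_subset_of_nonneg
      (Finset.range_mono hi) fun _ _ _ => dist_nonneg)
  have h2 := sq_sum_le_card_mul_sum_sq (s := Finset.range N) (f := fun j => dist (c j) (c (j + 1)))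
  rw [Finset.card_range] at h2
  exact (by gcongr : dist (c 0) (c i) ^ 2 ≤ _).trans h2

lemma step_sq_le_energy (c : ℕ → X) {N j : ℕ} (hj : j < N) :
    dist (c j) (c (j + 1)) ^ 2 ≤ energy c N :=
  Finset.single_le_sum (f := fun j => dist (c j) (c (j + 1)) ^ 2) (fun _ _ => sq_nonneg _)
    (Finset.mem_range.2 hj)

lemma sum_range_two_mul (f : ℕ → ℝ) (N : ℕ) :
    ∑ j ∈ Finset.range (2 * N), f j = ∑ k ∈ Finset.range N, (f (2 * k) + f (2 * k + 1)) := by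
  induction N with
  | zero => simp
  | succ N ih =>
    rw [show 2 * (N + 1) = 2 * N + 1 + 1 by ring, Finset.sum_range_succ, Finset.sum_range_succ, ih,
      Finset.sum_range_succ]
    ring

lemma energy_two_mul (c : ℕ → X) (N : ℕ) : energy c (2 * N) = ∑ k ∈ Finset.range N,
    (dist (c (2 * k)) (c (2 * k + 1)) ^ 2 + dist (c (2 * k + 1)) (c (2 * k + 2)) ^ 2) :=
  sum_range_two_mul _ _

lemma energy_even_le (c : ℕ → X) (N : ℕ) :
    energy (fun k => c (2 * k)) N ≤ 2 * energy c (2 * N) := by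
  rw [energy_two_mul, Finset.mul_sum]
  refine Finset.sum_le_sum fun k _ => ?_
  dsimp only
  rw [show 2 * (k + 1) = 2 * k + 2 by ring]
  have h1 := dist_triangle (c (2 * k)) (c (2 * k + 1)) (c (2 * k + 2))
  have h2 : dist (c (2 * k)) (c (2 * k + 2)) ^ 2 ≤ (dist (c (2 * k)) (c (2 * k + 1)) +
    dist (c (2 * k + 1)) (c (2 * k + 2))) ^ 2 := by gcongr
  linarith [sq_nonneg (dist (c (2 * k)) (c (2 * k + 1)) - dist (c (2 * k + 1)) (c (2 * k + 2)))]

lemma exists_minimal_path {K : Set X} (hK : IsCompact K) {x y : X} {N : ℕ}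
    (h : ∃ c, IsPath K x y N c) :
    ∃ c, IsPath K x y N c ∧ ∀ c', IsPath K x y N c' → energy c N ≤ energy c' N := by
  have h1 : IsCompact (univ.pi fun _ : ℕ => K) := isCompact_univ_pi fun _ => hK
  have h2 : IsClosed {c : ℕ → X | c 0 = x ∧ c N = y} :=
    (isClosed_eq (continuous_apply 0) continuous_const).inter
      (isClosed_eq (continuous_apply N) continuous_const)
  have h3 : Continuous fun c : ℕ → X => energy c N := by
    unfold energy
    fun_prop
  obtain ⟨c₀, hc₀⟩ := h
  obtain ⟨c, ⟨⟨hc1, hc2⟩, hc3⟩, hmin⟩ := (h1.inter_left h2).exists_isMinOn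
    ⟨c₀, ⟨hc₀.1, hc₀.2.1⟩, fun j _ => hc₀.2.2 j⟩ h3.continuousOn
  exact ⟨c, ⟨hc1, hc2, fun j => hc3 j trivial⟩, fun c' hc' =>
    hmin ⟨⟨hc'.1, hc'.2.1⟩, fun j _ => hc'.2.2 j⟩⟩

/-- Interior points of a path of minimal energy are midpoints in the sense of squared distances. -/
lemma IsPath.local_min {K : Set X} {x y : X} {N : ℕ} {c : ℕ → X} (hc : IsPath K x y N c)
    (hmin : ∀ c', IsPath K x y N c' → energy c N ≤ energy c' N) {j : ℕ} (hj : j + 2 ≤ N) {z : X}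
    (hz : z ∈ K) :
    dist (c (j + 1)) (c j) ^ 2 + dist (c (j + 1)) (c (j + 2)) ^ 2 ≤
      dist z (c j) ^ 2 + dist z (c (j + 2)) ^ 2 := by
  have h1 := hmin (Function.update c (j + 1) z) ⟨by
    rw [Function.update_of_ne (by omega)]; exact hc.1, by
    rw [Function.update_of_ne (by omega)]; exact hc.2.1, fun i => by
    rcases eq_or_ne i (j + 1) with rfl | h
    · rwa [Function.update_self]
    · rw [Function.update_of_ne h]; exact hc.2.2 i⟩
  unfold energy at h1
  have hs : ({j, j + 1} : Finset ℕ) ⊆ Finset.range N := by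
    intro i hi
    simp only [Finset.mem_insert, Finset.mem_singleton] at hi
    rw [Finset.mem_range]
    omega
  rw [← Finset.sum_sdiff hs, ← Finset.sum_sdiff hs, Finset.sum_pair (by omega),
    Finset.sum_pair (by omega)] at h1
  have h2 : ∑ i ∈ Finset.range N \ {j, j + 1}, dist (Function.update c (j + 1) z i)
      (Function.update c (j + 1) z (i + 1)) ^ 2 =
      ∑ i ∈ Finset.range N \ {j, j + 1}, dist (c i) (c (i + 1)) ^ 2 := by
    refine Finset.sum_congr rfl fun i hi => ?_
    simp only [Finset.mem_sdiff, Finset.mem_insert, Finset.mem_singleton, not_or] at hi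
    rw [Function.update_of_ne (by omega), Function.update_of_ne (by omega)]
  rw [h2, Function.update_self, Function.update_of_ne (by omega),
    Function.update_of_ne (by omega)] at h1
  rw [dist_comm (c (j + 1)) (c j), dist_comm z (c j)]
  linarith

/-- A path of minimal energy whose coarsening is nearly minimal as well. -/
lemma exists_tight_path {K : Set X} (hK : IsCompact K) {x y : X} (hxy : x ≠ y) {B : ℝ}
    (h : ∀ j : ℕ, ∃ c, IsPath K x y (2 ^ (j + 1)) c ∧
      (2 ^ (j + 1) : ℕ) * energy c (2 ^ (j + 1)) ≤ B) {θ : ℝ} (hθ : 0 < θ) (N₀ : ℕ) :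
    ∃ N ≥ N₀, 0 < N ∧ ∃ c, IsPath K x y (2 * N) c ∧
      (∀ c', IsPath K x y (2 * N) c' → energy c (2 * N) ≤ energy c' (2 * N)) ∧
      (2 * N : ℕ) * energy c (2 * N) ≤ B ∧
      2 * (1 - θ) * energy c (2 * N) ≤ energy (fun k => c (2 * k)) N := by
  choose c hc hcmin using fun j => exists_minimal_path hK ⟨_, (h j).choose_spec.1⟩
  set L : ℕ → ℝ := fun j => (2 ^ (j + 1) : ℕ) * energy (c j) (2 ^ (j + 1)) with hL
  have hLB : ∀ j, L j ≤ B := fun j => by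
    refine le_trans ?_ (h j).choose_spec.2
    rw [hL]
    exact mul_le_mul_of_nonneg_left (hcmin j _ (h j).choose_spec.1) (by positivity)
  have hpow : ∀ j : ℕ, 2 ^ (j + 1 + 1) = 2 * 2 ^ (j + 1) := fun j => by ring
  have hev : ∀ j, IsPath K x y (2 ^ (j + 1)) fun k => c (j + 1) (2 * k) := fun j =>
    ⟨(hc (j + 1)).1, by
      have := (hc (j + 1)).2.1
      rwa [hpow] at this, fun k => (hc (j + 1)).2.2 _⟩
  have hmono : Monotone L := monotone_nat_of_le_succ fun j => by
    have h1 := (hcmin j _ (hev j)).trans (energy_even_le _ _)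
    rw [hL]
    dsimp only
    rw [hpow, Nat.cast_mul]
    have := mul_le_mul_of_nonneg_left h1 (Nat.cast_nonneg (α := ℝ) (2 ^ (j + 1)))
    push_cast at this ⊢
    linarith
  have hbdd : BddAbove (range L) := ⟨B, by rintro _ ⟨j, rfl⟩; exact hLB j⟩
  have hd : 0 < dist x y := dist_pos.2 hxy
  obtain ⟨j₁, hj₁⟩ := exists_lt_of_lt_ciSup (sub_lt_self (⨆ j, L j)
    (show 0 < θ * dist x y ^ 2 by positivity))
  set j := max j₁ N₀ with hj
  have h1 : L j₁ ≤ L j := hmono (le_max_left _ _)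
  have h2 : L (j + 1) ≤ ⨆ j, L j := le_ciSup hbdd _
  have h3 : dist x y ^ 2 ≤ L (j + 1) := by
    have := dist_sq_le_energy (c (j + 1)) (le_refl (2 ^ (j + 1 + 1)))
    rwa [(hc (j + 1)).1, (hc (j + 1)).2.1] at this
  have h4 : (1 - θ) * L (j + 1) ≤ L j := by nlinarith
  refine ⟨2 ^ (j + 1), ?_, by positivity, c (j + 1), ?_⟩
  · have : j + 1 < 2 ^ (j + 1) := Nat.lt_two_pow_self
    have := le_max_right j₁ N₀
    omega
  have h5 := hcmin j _ (hev j)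
  have h6 : L j = ((2 ^ (j + 1) : ℕ) : ℝ) * energy (c j) (2 ^ (j + 1)) := rfl
  have h7 : L (j + 1) = ((2 ^ (j + 1 + 1) : ℕ) : ℝ) * energy (c (j + 1)) (2 ^ (j + 1 + 1)) := rfl
  have h8 := hLB (j + 1)
  have h9 := hc (j + 1)
  have h10 := hcmin (j + 1)
  rw [hpow] at h7 h9 h10
  refine ⟨h9, h10, by rwa [h7] at h8, ?_⟩
  rw [h6, h7, Nat.cast_mul] at h4
  refine le_trans ?_ h5
  have hp : (0 : ℝ) < ((2 ^ (j + 1) : ℕ) : ℝ) := by positivity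
  refine le_of_mul_le_mul_left (le_trans (le_of_eq ?_) h4) hp
  push_cast
  ring

/-- Increments of two functions that are almost concave along a path and almost opposite to each
other are almost constant. -/
lemma abs_increment_sub_le {F G τ : ℕ → ℝ} {n : ℕ} {Λ δ : ℝ} (hΛ : 0 ≤ Λ)
    (hF : ∀ j, j + 2 ≤ n → F j + F (j + 2) - 2 * F (j + 1) ≤ Λ * (τ j ^ 2 + τ (j + 1) ^ 2))
    (hG : ∀ j, j + 2 ≤ n → G j + G (j + 2) - 2 * G (j + 1) ≤ Λ * (τ j ^ 2 + τ (j + 1) ^ 2))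
    (hFG : ∀ j < n, |(F j + G j) - (F (j + 1) + G (j + 1))| ≤ 2 * δ * τ j) {j : ℕ} (hj : j < n) :
    |n * (F (j + 1) - F j) - (F n - F 0)| ≤
      n * (2 * Λ * ∑ i ∈ Finset.range n, τ i ^ 2 + 2 * δ * τ j) +
        2 * δ * ∑ i ∈ Finset.range n, τ i := by
  set e := ∑ i ∈ Finset.range n, τ i ^ 2 with he
  have mono : ∀ H : ℕ → ℝ, (∀ j, j + 2 ≤ n →
      H j + H (j + 2) - 2 * H (j + 1) ≤ Λ * (τ j ^ 2 + τ (j + 1) ^ 2)) → ∀ i k, i ≤ k → k < n →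
      H (k + 1) - H k - (H (i + 1) - H i) ≤ 2 * Λ * e := by
    intro H hH i k hik
    have main : k < n → H (k + 1) - H k - (H (i + 1) - H i) ≤
        Λ * ∑ l ∈ Finset.Ico i k, (τ l ^ 2 + τ (l + 1) ^ 2) := by
      induction k, hik using Nat.le_induction with
      | base => intro _; simp
      | succ k hk ih =>
        intro hkn
        have h1 := ih (by omega)
        have h2 := hH k (by omega)
        rw [Finset.sum_Ico_succ_top hk, mul_add]
        rw [show k + 1 + 1 = k + 2 by ring]
        linarith
    intro hkn
    refine (main hkn).trans ?_
    rw [Finset.sum_add_distrib, mul_comm 2 Λ, mul_assoc]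
    refine mul_le_mul_of_nonneg_left ?_ hΛ
    have h1 : ∑ l ∈ Finset.Ico i k, τ l ^ 2 ≤ e := by
      refine Finset.sum_le_sum_of_subset_of_nonneg (fun l hl => ?_) fun _ _ _ => sq_nonneg _
      rw [Finset.mem_Ico] at hl
      rw [Finset.mem_range]; omega
    have h2 : ∑ l ∈ Finset.Ico i k, τ (l + 1) ^ 2 ≤ e := by
      rw [Finset.sum_Ico_add' (fun l => τ l ^ 2)]
      refine Finset.sum_le_sum_of_subset_of_nonneg (fun l hl => ?_) fun _ _ _ => sq_nonneg _
      rw [Finset.mem_Ico] at hl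
      rw [Finset.mem_range]; omega
    linarith
  have he0 : 0 ≤ e := Finset.sum_nonneg fun _ _ => sq_nonneg _
  have hδτ : ∀ i < n, 0 ≤ 2 * δ * τ i := fun i hi => (abs_nonneg _).trans (hFG i hi)
  have pair : ∀ i < n, |(F (j + 1) - F j) - (F (i + 1) - F i)| ≤
      2 * Λ * e + 2 * δ * τ j + 2 * δ * τ i := by
    intro i hi
    have hi1 := abs_le.1 (hFG i hi)
    have hj1 := abs_le.1 (hFG j hj)
    have hi0 := hδτ i hi
    have hj0 := hδτ j hj
    rw [abs_le]
    rcases le_total i j with hij | hij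
    · have h1 := mono F hF i j hij hj
      have h2 := mono G hG i j hij hj
      constructor <;> linarith
    · have h1 := mono F hF j i hij hi
      have h2 := mono G hG j i hij hi
      constructor <;> linarith
  have hsum : n * (F (j + 1) - F j) - (F n - F 0) =
      ∑ i ∈ Finset.range n, ((F (j + 1) - F j) - (F (i + 1) - F i)) := by
    rw [Finset.sum_sub_distrib, Finset.sum_range_sub, Finset.sum_const, Finset.card_range,
      nsmul_eq_mul]
  rw [hsum]
  refine (Finset.abs_sum_le_sum_abs _ _).trans ((Finset.sum_le_sum fun i hi =>
    pair i (Finset.mem_range.1 hi)).trans (le_of_eq ?_))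
  rw [Finset.sum_add_distrib, Finset.sum_const, Finset.card_range, nsmul_eq_mul, ← Finset.mul_sum]

/-- In a tight path some pair of consecutive steps is nearly straight and not too short. -/
lemma exists_straight_step {c : ℕ → X} {N : ℕ} (hN : 0 < N) {θ : ℝ} (hθ : 0 < θ) (hθ1 : θ ≤ 1)
    (h : 2 * (1 - θ ^ 2 / 2) * energy c (2 * N) ≤ energy (fun k => c (2 * k)) N) :
    ∃ k < N, 2 * (dist (c (2 * k)) (c (2 * k + 1)) ^ 2 + dist (c (2 * k + 1)) (c (2 * k + 2)) ^ 2) -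
        dist (c (2 * k)) (c (2 * k + 2)) ^ 2 ≤
        θ * (dist (c (2 * k)) (c (2 * k + 1)) ^ 2 + dist (c (2 * k + 1)) (c (2 * k + 2)) ^ 2) ∧
      (1 - θ) * (energy c (2 * N) / N) ≤
        dist (c (2 * k)) (c (2 * k + 1)) ^ 2 + dist (c (2 * k + 1)) (c (2 * k + 2)) ^ 2 := by
  set t : ℕ → ℝ := fun k =>
    dist (c (2 * k)) (c (2 * k + 1)) ^ 2 + dist (c (2 * k + 1)) (c (2 * k + 2)) ^ 2 with ht
  set D : ℕ → ℝ := fun k => 2 * t k - dist (c (2 * k)) (c (2 * k + 2)) ^ 2 with hD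
  set e := energy c (2 * N) with he
  have het : ∑ k ∈ Finset.range N, t k = e := (energy_two_mul c N).symm
  have hD0 : ∀ k, 0 ≤ D k := fun k => by
    have h1 := dist_triangle (c (2 * k)) (c (2 * k + 1)) (c (2 * k + 2))
    have h2 : dist (c (2 * k)) (c (2 * k + 2)) ^ 2 ≤ (dist (c (2 * k)) (c (2 * k + 1)) +
      dist (c (2 * k + 1)) (c (2 * k + 2))) ^ 2 := by gcongr
    simp only [hD, ht]
    linarith [sq_nonneg (dist (c (2 * k)) (c (2 * k + 1)) - dist (c (2 * k + 1)) (c (2 * k + 2)))]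
  have hDs : ∑ k ∈ Finset.range N, D k ≤ θ ^ 2 * e := by
    rw [Finset.sum_sub_distrib, ← Finset.mul_sum, het]
    have : energy (fun k => c (2 * k)) N =
      ∑ k ∈ Finset.range N, dist (c (2 * k)) (c (2 * k + 2)) ^ 2 := rfl
    rw [← this]
    linarith
  have hNr : (0 : ℝ) < N := by exact_mod_cast hN
  obtain ⟨k, hk, hle⟩ := Finset.exists_le_of_sum_le (s := Finset.range N)
    (f := fun k => D k / θ + (1 - θ) * (e / N)) (g := t) ⟨0, Finset.mem_range.2 hN⟩ (by
      rw [het, Finset.sum_add_distrib, ← Finset.sum_div, Finset.sum_const, Finset.card_range,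
        nsmul_eq_mul]
      have h1 : (∑ k ∈ Finset.range N, D k) / θ ≤ θ * e := by
        rw [div_le_iff₀ hθ]; linarith
      have h2 : (N : ℝ) * ((1 - θ) * (e / N)) = (1 - θ) * e := by field_simp
      linarith)
  have h1 : 0 ≤ D k / θ := div_nonneg (hD0 k) hθ.le
  have h2 : 0 ≤ (1 - θ) * (e / N) :=
    mul_nonneg (by linarith) (div_nonneg (energy_nonneg _ _) hNr.le)
  refine ⟨k, Finset.mem_range.1 hk, ?_, by linarith⟩
  have h3 : D k / θ ≤ t k := by linarith
  rw [div_le_iff₀ hθ] at h3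
  linarith
end

section
variable {X : Type*} [MetricSpace X] {κ : ℝ} {C₀ R : ℝ} {m : ℕ} {a b : Fin m → X} {p : X}
  {r C δ : ℝ}

/-- Segments in the coordinate space lift to paths in an extremal subset. -/
lemma SData.exists_lift_path (hA : IsAlexandrov X κ) {E : Set X} (hE : IsExtremal κ E)
    (h : SData κ C₀ R a b p r C δ) (hcpt : ∀ (p : X) (r : ℝ), r < R → IsCompact (closedBall p r))
    (hδm : 28 * δ * m ≤ 1) {x : X} (hx : x ∈ E) {T : Fin m → ℝ} {S : ℝ}
    (hTS : 4 * ∑ j, |T j - dist (a j) x| ≤ S) (hS : dist x p + 2 * S < r / 3) {N : ℕ}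
    (hN : 0 < N) :
    ∃ c : ℕ → X, c 0 = x ∧ (∀ j, c j ∈ E ∧ dist x (c j) ≤ S) ∧ (∀ i, dist (a i) (c N) = T i) ∧
      ∀ j, dist (c j) (c (j + 1)) ≤ S / N := by
  have := hA.1
  have hNr : (0 : ℝ) < N := by exact_mod_cast hN
  have hmv := h.hasMoves hA hE hcpt
  have hS0 : 0 ≤ S := le_trans (by positivity) hTS
  obtain ⟨c, hc0, hcP, hcR⟩ := exists_seq_step
    (P := fun j y => y ∈ E ∧ dist x y ≤ ((min j N : ℕ) : ℝ) / N * S ∧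
      ∀ i, dist (a i) y = dist (a i) x + ((min j N : ℕ) : ℝ) / N * (T i - dist (a i) x))
    (R := fun _ y y' => dist y y' ≤ S / N) (x₀ := x) ⟨hx, by simp, by simp⟩ (by
      rintro j y ⟨hyE, hxy, hy⟩
      rcases Nat.lt_or_ge j N with hj | hj
      · rw [min_eq_left hj.le] at hxy hy
        have hjN : (j : ℝ) / N ≤ 1 := (div_le_one hNr).2 (by exact_mod_cast hj.le)
        have hdiff : ∀ i, dist (a i) x + ((j + 1 : ℕ) : ℝ) / N * (T i - dist (a i) x) -
            dist (a i) y = (1 / N) * (T i - dist (a i) x) := fun i => by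
          rw [hy i]; push_cast; field_simp; ring
        have hsum : 4 * ∑ i, |dist (a i) x + ((j + 1 : ℕ) : ℝ) / N * (T i - dist (a i) x) -
            dist (a i) y| ≤ S / N := by
          simp only [hdiff, abs_mul, ← Finset.mul_sum]
          rw [abs_of_pos (by positivity)]
          calc 4 * (1 / (N : ℝ) * ∑ i, |T i - dist (a i) x|)
              = (4 * ∑ i, |T i - dist (a i) x|) / N := by ring
            _ ≤ _ := by gcongr
        have hxyS : dist x y ≤ S := hxy.trans (mul_le_of_le_one_left hS0 hjN)
        have hSN : S / N ≤ S := div_le_self hS0 (by exact_mod_cast hN)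
        obtain ⟨y', h1, h2, h3⟩ := hmv.exists_eq (by exact continuous_distMap a) hE.1 (by
            rw [Fintype.card_fin]; linarith) hyE
          (T := fun i => dist (a i) x + ((j + 1 : ℕ) : ℝ) / N * (T i - dist (a i) x)) (by linarith [dist_triangle_left y p x])
        refine ⟨y', ⟨h1, ?_, fun i => ?_⟩, h3.trans hsum⟩
        · rw [min_eq_left (show j + 1 ≤ N by omega)]
          have := dist_triangle x y y'
          have h4 : ((j + 1 : ℕ) : ℝ) / N * S = j / N * S + S / N := by push_cast; ring
          rw [h4]
          linarith
        · rw [min_eq_left (show j + 1 ≤ N by omega)]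
          exact congrFun h2 i
      · refine ⟨y, ⟨hyE, ?_, ?_⟩, by rw [dist_self]; positivity⟩
        · rwa [min_eq_right (by omega)] at hxy ⊢
        · rwa [min_eq_right (by omega)] at hy ⊢)
  refine ⟨c, hc0, fun j => ⟨(hcP j).1, (hcP j).2.1.trans (mul_le_of_le_one_left hS0 ?_)⟩,
    fun i => ?_, hcR⟩
  · rw [div_le_one hNr]
    exact_mod_cast min_le_right _ _
  · rw [(hcP N).2.2 i, min_self]
    field_simp
    ring

/-- Two points of `E` near `p` are joined by short paths through `p`. -/
lemma SData.exists_path (hA : IsAlexandrov X κ) {E : Set X} (hE : IsExtremal κ E)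
    (h : SData κ C₀ R a b p r C δ) (hcpt : ∀ (p : X) (r : ℝ), r < R → IsCompact (closedBall p r))
    (hδm : 28 * δ * m ≤ 1) {r' : ℝ}
    (hiso : ∀ x ∈ E ∩ ball p r', (∀ i, dist (a i) x = dist (a i) p) → x = p) {d S : ℝ}
    (hS : S = 4 * m * d) (hdS : d + 2 * S < r / 3) (hdr : d + S < r') {x y : X}
    (hx : x ∈ E ∩ ball p d) (hy : y ∈ E ∩ ball p d) {N : ℕ} (hN : 0 < N) :
    ∃ c, IsPath (E ∩ closedBall p (d + S)) x y (2 * N) c ∧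
      (2 * N : ℕ) * energy c (2 * N) ≤ 4 * S ^ 2 := by
  have hNr : (0 : ℝ) < N := by exact_mod_cast hN
  have key : ∀ x ∈ E ∩ ball p d, ∃ c : ℕ → X, c 0 = x ∧ (∀ j, c j ∈ E ∩ closedBall p (d + S)) ∧
      c N = p ∧ ∀ j, dist (c j) (c (j + 1)) ≤ S / N := by
    intro x hx
    have hxd := mem_ball.1 hx.2
    have hTS : 4 * ∑ j, |dist (a j) p - dist (a j) x| ≤ S := by
      have h1 : ∑ j, |dist (a j) p - dist (a j) x| ≤ ∑ _j : Fin m, d := by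
        refine Finset.sum_le_sum fun j _ => ?_
        have := abs_dist_sub_le p x (a j)
        rw [dist_comm p, dist_comm x, dist_comm p] at this
        linarith
      rw [Finset.sum_const, Finset.card_univ, Fintype.card_fin, nsmul_eq_mul] at h1
      linarith
    obtain ⟨c, h1, h2, h3, h4⟩ := h.exists_lift_path hA hE hcpt hδm hx.1 hTS (by linarith) hN
    have h5 : ∀ j, dist (c j) p < d + S := fun j => by
      linarith [dist_triangle_left (c j) p x, (h2 j).2]
    exact ⟨c, h1, fun j => ⟨(h2 j).1, (h5 j).le⟩,
      hiso _ ⟨(h2 N).1, (h5 N).trans hdr⟩ h3, h4⟩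
  obtain ⟨cx, hx0, hxK, hxN, hxs⟩ := key x hx
  obtain ⟨cy, hy0, hyK, hyN, hys⟩ := key y hy
  have hd0 : 0 < d := dist_nonneg.trans_lt hx.2
  have hS0 : 0 ≤ S := by rw [hS]; positivity
  set c : ℕ → X := fun k => if k ≤ N then cx k else cy (2 * N - k) with hc
  have hstep : ∀ k, dist (c k) (c (k + 1)) ≤ S / N := by
    intro k
    simp only [hc]
    rcases lt_trichotomy k N with hk | rfl | hk
    · rw [if_pos hk.le, if_pos (by omega)]
      exact hxs k
    · rw [if_pos le_rfl, if_neg (by omega), hxN, ← hyN, dist_comm]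
      have := hys (2 * k - (k + 1))
      rwa [show 2 * k - (k + 1) + 1 = k by omega] at this
    · rw [if_neg (by omega), if_neg (by omega), dist_comm]
      rcases Nat.lt_or_ge k (2 * N) with hk2 | hk2
      · have := hys (2 * N - (k + 1))
        rwa [show 2 * N - (k + 1) + 1 = 2 * N - k by omega] at this
      · rw [show 2 * N - (k + 1) = 2 * N - k by omega, dist_self]
        positivity
  refine ⟨c, ⟨?_, ?_, fun k => ?_⟩, ?_⟩
  · simp only [hc]
    rw [if_pos (Nat.zero_le _), hx0]
  · simp only [hc]
    rw [if_neg (by omega), Nat.sub_self, hy0]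
  · simp only [hc]
    split_ifs
    · exact hxK k
    · exact hyK _
  · have h1 : energy c (2 * N) ≤ ∑ _j ∈ Finset.range (2 * N), (S / N) ^ 2 :=
      Finset.sum_le_sum fun j _ => by gcongr; exact hstep j
    rw [Finset.sum_const, Finset.card_range, nsmul_eq_mul] at h1
    have h2 := mul_le_mul_of_nonneg_left h1 (Nat.cast_nonneg (α := ℝ) (2 * N))
    refine h2.trans (le_of_eq ?_)
    push_cast
    field_simp
    ring

lemma steps_comparable {τ τ' μ φ : ℝ} (hτ : 0 ≤ τ) (hτ' : 0 ≤ τ') (hμ : 0 < μ) (hφ : 0 < φ)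
    (hφ1 : φ ≤ 1 / 16) (h1 : (1 - φ ^ 2) * (2 * μ ^ 2) ≤ τ ^ 2 + τ' ^ 2)
    (h2 : (τ - τ') ^ 2 ≤ φ ^ 2 * (τ ^ 2 + τ' ^ 2)) :
    0 < τ ∧ |τ - τ'| ≤ 3 * φ * τ ∧ μ ≤ (1 + 8 * φ) * τ := by
  have h3 : |τ - τ'| ≤ φ * (τ + τ') := by
    refine abs_le_of_sq_le_sq (h2.trans ?_) (by positivity)
    have : 0 ≤ φ ^ 2 * (τ * τ') := by positivity
    linarith
  have h4 := abs_le.1 h3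
  have h5 : (1 - φ) * τ' ≤ (1 + φ) * τ := by linarith
  have h6 : τ' ≤ (1 + 3 * φ) * τ := by
    have e1 : (1 + φ) * τ ≤ (1 - φ) * ((1 + 3 * φ) * τ) := by
      have : 0 ≤ φ * (1 - 3 * φ) * τ := by
        have : 0 ≤ 1 - 3 * φ := by linarith
        positivity
      linarith
    exact le_of_mul_le_mul_left (h5.trans e1) (by linarith)
  have h7 : |τ - τ'| ≤ 3 * φ * τ := by
    rw [abs_le]
    constructor
    · linarith
    · have e1 : (1 - φ) * (τ - τ') ≤ (1 - φ) * (3 * φ * τ) := by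
        have e2 : 0 ≤ φ * (1 - 3 * φ) * τ := by
          have : 0 ≤ 1 - 3 * φ := by linarith
          positivity
        have e3 : φ * (τ + τ') ≤ φ * ((2 + 3 * φ) * τ) := by
          gcongr; linarith
        rcases le_total τ' τ with hle | hle
        · have e4 : φ * (τ + τ') ≤ φ * (2 * τ) := by gcongr; linarith
          have e5 : (1 - φ) * (τ - τ') ≤ 1 * (τ - τ') :=
            mul_le_mul_of_nonneg_right (by linarith) (by linarith)
          linarith
        · have e4 : (1 - φ) * (τ - τ') ≤ 0 :=
            mul_nonpos_of_nonneg_of_nonpos (by linarith) (by linarith)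
          have e5 : 0 ≤ (1 - φ) * (3 * φ * τ) := by
            have : 0 ≤ 1 - φ := by linarith
            positivity
          linarith
      exact le_of_mul_le_mul_left e1 (by linarith)
  have hτ0 : 0 < τ := by
    rcases hτ.eq_or_lt with h0 | h0
    · rw [← h0] at h6 h1
      have : τ' = 0 := le_antisymm (by linarith) hτ'
      rw [this] at h1
      have : 0 < (1 - φ ^ 2) * (2 * μ ^ 2) := by
        have : 0 < 1 - φ ^ 2 := by nlinarith
        positivity
      norm_num at h1
      linarith
    · exact h0
  refine ⟨hτ0, h7, ?_⟩
  have h8 : τ' ^ 2 ≤ ((1 + 3 * φ) * τ) ^ 2 := by gcongr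
  have h9 : τ ^ 2 ≤ ((1 + 3 * φ) * τ) ^ 2 := by
    gcongr
    exact le_mul_of_one_le_left hτ (by linarith)
  have h10 : (1 - φ ^ 2) * μ ^ 2 ≤ (1 - φ ^ 2) * ((1 + 8 * φ) * τ) ^ 2 := by
    have e1 : (1 + 3 * φ) ^ 2 ≤ (1 - φ ^ 2) * (1 + 8 * φ) ^ 2 := by
      nlinarith [mul_pos hφ hφ, mul_pos (mul_pos hφ hφ) hφ]
    have e2 := mul_le_mul_of_nonneg_right e1 (sq_nonneg τ)
    rw [mul_pow] at h8 h9
    rw [mul_pow]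
    linarith
  have h11 : μ ^ 2 ≤ ((1 + 8 * φ) * τ) ^ 2 := le_of_mul_le_mul_left h10 (by nlinarith)
  exact (abs_le_of_sq_le_sq' h11 (by positivity)).2

/-- Distance functions of strainer points satisfy the Lieberman inequality. -/
lemma SData.lieberman (hA : IsAlexandrov X κ) {E : Set X} (hE : IsExtremal κ E)
    (h : SData κ C₀ R a b p r C δ) (hcpt : ∀ (p : X) (r : ℝ), r < R → IsCompact (closedBall p r))
    (hδ : 16 * δ ≤ 1) {z : X} (hzE : z ∈ E) (hz : z ∈ ball p (r / 2)) {v₁ v₂ : X}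
    (hv₁ : v₁ ∈ ball p (r / 2)) (hv₂ : v₂ ∈ ball p (r / 2)) {s₀ : ℝ} (hs₀ : 0 < s₀)
    (hmin : ∀ z' ∈ E, dist z z' < s₀ →
      dist z v₁ ^ 2 + dist z v₂ ^ 2 ≤ dist z' v₁ ^ 2 + dist z' v₂ ^ 2) (i : Fin m) :
    dist (a i) v₁ + dist (a i) v₂ - 2 * dist (a i) z ≤ 4 * C * (dist z v₁ ^ 2 + dist z v₂ ^ 2) ∧
    dist (b i) v₁ + dist (b i) v₂ - 2 * dist (b i) z ≤
      4 * C * (dist z v₁ ^ 2 + dist z v₂ ^ 2) := by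
  have hr := h.hr
  have hzr := mem_ball.1 hz
  have hopp : ∀ σ : ℝ, (σ = 1 ∨ σ = -1) → ∀ s₀ > 0, ∃ M, 0 < dist z M ∧ dist z M < s₀ ∧
      |dist (a i) M - dist (a i) z - σ * dist z M| ≤ 1 / 4 * dist z M ∧
      |dist (b i) M - dist (b i) z + σ * dist z M| ≤ 1 / 4 * dist z M := by
    intro σ hσ s₀ hs₀
    have hs : 0 < min (s₀ / 2) (r / 4) := by positivity
    obtain ⟨M, h1, -, h2⟩ := h.move hA i (x := z) hs
      (by linarith [min_le_right (s₀ / 2) (r / 4)]) σ hσ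
    have h3 := h2 i
    rw [if_pos rfl, ← h1] at h3
    have h4 : 4 * δ * dist z M ≤ 1 / 4 * dist z M := by gcongr; linarith
    refine ⟨M, by rwa [h1], ?_, h3.1.trans h4, h3.2.trans h4⟩
    rw [h1]
    linarith [min_le_left (s₀ / 2) (r / 4)]
  constructor
  · refine hE.lieberman hA h.kc hcpt (h.far_a i) h.hC₀ (by linarith [h.hrR]) hzE hz ?_ hv₁ hv₂ hs₀
      hmin
    intro s hs
    obtain ⟨M, h1, h2, h3, -⟩ := hopp 1 (Or.inl rfl) s hs
    exact ⟨M, h1, h2, by linarith [(abs_le.1 h3).1]⟩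
  · refine hE.lieberman hA h.kc hcpt (h.far_b i) h.hC₀ (by linarith [h.hrR]) hzE hz ?_ hv₁ hv₂ hs₀
      hmin
    intro s hs
    obtain ⟨M, h1, h2, -, h3⟩ := hopp (-1) (Or.inr rfl) s hs
    exact ⟨M, h1, h2, by linarith [(abs_le.1 h3).1]⟩

set_option maxHeartbeats 1000000 in
/-- Nearly straight triples of points of `E` along which the coordinates change at almost the
same rate as between two given points. -/
lemma SData.exists_triple (hA : IsAlexandrov X κ) {E : Set X} (hE : IsExtremal κ E)
    (h : SData κ C₀ R a b p r C δ) (hcpt : ∀ (p : X) (r : ℝ), r < R → IsCompact (closedBall p r))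
    (hδ : 16 * δ ≤ 1) (hδm : 28 * δ * m ≤ 1) {r' : ℝ} (hr' : 0 < r')
    (hiso : ∀ x ∈ E ∩ ball p r', (∀ i, dist (a i) x = dist (a i) p) → x = p) {ε r₂ : ℝ}
    (hε : 0 < ε) (hε1 : ε ≤ 1 / 2) (hr₂ : 0 < r₂) :
    ∃ r₁ > 0, ∀ x ∈ E ∩ ball p r₁, ∀ y ∈ E ∩ ball p r₁, x ≠ y → ∀ s₀ > 0,
      ∃ z ∈ E ∩ ball p r₂, ∃ u w, u ∈ ball p r₂ ∧ w ∈ ball p r₂ ∧ u ≠ z ∧ w ≠ z ∧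
        dist z u < s₀ ∧ dist z w < s₀ ∧ ec u z w ≤ -1 + ε ∧ ∃ t, 0 ≤ t ∧ t * dist x y ≤ 1 + ε ∧
        ∀ i, |dist (a i) w - dist (a i) z - dist z w * (t * (dist (a i) y - dist (a i) x))| ≤
            (5 * δ + ε) * dist z w ∧
          |dist (a i) u - dist (a i) z + dist z u * (t * (dist (a i) y - dist (a i) x))| ≤
            (5 * δ + ε) * dist z u := by
  have hr := h.hr
  have hC := h.hC
  have hδ0 := h.hδ
  set ρ := min (r₂ / 2) (r / 4) with hρ
  have hρ0 : 0 < ρ := by positivity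
  set β := min ρ (min (r / 3) (min r' (ε / (64 * (C + 1))))) with hβ
  have hβ0 : 0 < β := by positivity
  set d := β / (2 * (16 * m + 1)) with hd
  have hd0 : 0 < d := by positivity
  set S := 4 * m * d with hS
  have hS0 : 0 ≤ S := by positivity
  have hdS : d + 4 * S < β := by
    have : d * (2 * (16 * m + 1)) = β := by rw [hd]; field_simp
    rw [hS]; linarith
  have hβρ : β ≤ ρ := min_le_left _ _
  have hβ2 : β ≤ min (r / 3) (min r' (ε / (64 * (C + 1)))) := min_le_right _ _
  have hβr : β ≤ r / 3 := hβ2.trans (min_le_left _ _)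
  have hβr' : β ≤ r' := (hβ2.trans (min_le_right _ _)).trans (min_le_left _ _)
  have hβε : β * (64 * (C + 1)) ≤ ε := by
    rw [← le_div_iff₀ (by positivity)]
    exact (hβ2.trans (min_le_right _ _)).trans (min_le_right _ _)
  have hρr : ρ ≤ r / 4 := min_le_right _ _
  have hρr₂ : ρ ≤ r₂ / 2 := min_le_left _ _
  clear_value β ρ d
  refine ⟨d, hd0, fun x hx y hy hxy s₀ hs₀ => ?_⟩
  set φ := ε / 8 with hφ
  have hφ0 : 0 < φ := by positivity
  have hφ1 : φ ≤ 1 / 16 := by linarith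
  have hφ2 : φ ^ 2 ≤ 1 := pow_le_one₀ hφ0.le (by linarith)
  have hK : IsCompact (E ∩ closedBall p ρ) :=
    (hcpt p ρ (by linarith [h.hrR])).inter_left hE.1
  obtain ⟨N₀, hN₀⟩ := exists_nat_gt (2 * S ^ 2 / s₀ ^ 2)
  rw [div_lt_iff₀ (by positivity)] at hN₀
  obtain ⟨N, hNN₀, hN, c, hc, hcmin, hcB, hct⟩ := exists_tight_path hK hxy (B := 4 * S ^ 2)
    (fun j => by
      obtain ⟨c, h1, h2⟩ := h.exists_path hA hE hcpt hδm hiso hS (by linarith) (by linarith)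
        hx hy (N := 2 ^ j) (by positivity)
      rw [show 2 * 2 ^ j = 2 ^ (j + 1) by ring] at h1 h2
      exact ⟨c, ⟨h1.1, h1.2.1, fun i => ⟨(h1.2.2 i).1,
        closedBall_subset_closedBall (by linarith) (h1.2.2 i).2⟩⟩, h2⟩)
    (θ := (φ ^ 2) ^ 2 / 2) (by positivity) N₀
  obtain ⟨k, hk, hk1, hk2⟩ := exists_straight_step hN (θ := φ ^ 2) (by positivity) hφ2 hct
  set e := energy c (2 * N) with he
  have he0 : 0 ≤ e := energy_nonneg _ _
  have hNr : (0 : ℝ) < (2 * N : ℕ) := by exact_mod_cast (by omega : 0 < 2 * N)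
  set n : ℝ := ((2 * N : ℕ) : ℝ) with hn
  set ℓ := √(n * e) with hℓ
  have hℓ2 : ℓ ^ 2 = n * e := Real.sq_sqrt (by positivity)
  have hℓ0 : 0 ≤ ℓ := Real.sqrt_nonneg _
  have hdist : ∀ j ≤ 2 * N, dist x (c j) ≤ ℓ := fun j hj => by
    have := dist_sq_le_energy c hj
    rw [hc.1] at this
    exact Real.le_sqrt_of_sq_le this
  have hxyℓ : dist x y ≤ ℓ := by
    have := hdist _ le_rfl
    rwa [hc.2.1] at this
  have hℓp : 0 < ℓ := (dist_pos.2 hxy).trans_le hxyℓ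
  have hℓS : ℓ ≤ 2 * S := by
    rw [hℓ]
    exact Real.sqrt_le_iff.2 ⟨by positivity, by linarith⟩
  have hcp : ∀ j ≤ 2 * N, dist (c j) p < ρ := fun j hj => by
    linarith [hdist j hj, dist_triangle_left (c j) p x, mem_ball.1 hx.2]
  have hcr : ∀ j ≤ 2 * N, c j ∈ ball p (r / 2) := fun j hj => by
    rw [mem_ball]; linarith [hcp j hj]
  have hcr₂ : ∀ j ≤ 2 * N, c j ∈ ball p r₂ := fun j hj => by
    rw [mem_ball]; linarith [hcp j hj]
  have hcE : ∀ j, c j ∈ E := fun j => (hc.2.2 j).1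
  set μ := ℓ / n with hμ
  have hμ0 : 0 < μ := by positivity
  have hnμ : n * μ = ℓ := by rw [hμ]; field_simp
  have heμ : e = ℓ * μ := by rw [hμ]; field_simp; linarith
  have hinc : ∀ j < 2 * N, ∀ i, |dist (a i) (c (j + 1)) - dist (a i) (c j) -
      μ * ((dist (a i) y - dist (a i) x) / ℓ)| ≤
      8 * C * ℓ * μ + 2 * δ * dist (c j) (c (j + 1)) + 2 * δ * μ := by
    intro j hj i
    have lieb : ∀ j, j + 2 ≤ 2 * N → _ := fun j hj =>
      h.lieberman hA hE hcpt hδ (hcE (j + 1)) (hcr _ (by omega)) (hcr j (by omega))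
        (hcr (j + 2) (by omega)) (s₀ := ρ - dist (c (j + 1)) p)
        (by linarith [hcp (j + 1) (by omega)]) (fun z' hz' hzz' =>
          hc.local_min hcmin (by omega) ⟨hz', by
            rw [mem_closedBall]
            linarith [dist_triangle_left z' p (c (j + 1))]⟩) i
    have := abs_increment_sub_le (F := fun j => dist (a i) (c j)) (G := fun j => dist (b i) (c j))
      (τ := fun j => dist (c j) (c (j + 1))) (n := 2 * N) (Λ := 4 * C) (δ := δ) (by positivity)
      (fun j hj => by
        have := (lieb j hj).1
        rwa [dist_comm (c (j + 1)) (c j)] at this)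
      (fun j hj => by
        have := (lieb j hj).2
        rwa [dist_comm (c (j + 1)) (c j)] at this)
      (fun j hj => h.sum_le hA i (ball_subset_ball (by linarith) (hcr j (by omega)))
        (ball_subset_ball (by linarith) (hcr (j + 1) (by omega)))) hj
    rw [hc.1, hc.2.1, ← hn] at this
    have hsum : ∑ i ∈ Finset.range (2 * N), dist (c i) (c (i + 1)) ≤ ℓ := by
      have h2 := sq_sum_le_card_mul_sum_sq (s := Finset.range (2 * N))
        (f := fun j => dist (c j) (c (j + 1)))
      rw [Finset.card_range] at h2
      exact Real.le_sqrt_of_sq_le h2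
    have hee : ∑ i ∈ Finset.range (2 * N), dist (c i) (c (i + 1)) ^ 2 = e := rfl
    rw [hee] at this
    have h3 : 2 * δ * ∑ i ∈ Finset.range (2 * N), dist (c i) (c (i + 1)) ≤ 2 * δ * ℓ := by gcongr
    refine le_of_mul_le_mul_left ?_ hNr
    rw [← abs_of_pos hNr, ← abs_mul, abs_of_pos hNr]
    have h4 : n * (dist (a i) (c (j + 1)) - dist (a i) (c j) -
        μ * ((dist (a i) y - dist (a i) x) / ℓ)) =
        n * (dist (a i) (c (j + 1)) - dist (a i) (c j)) - (dist (a i) y - dist (a i) x) := by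
      rw [hμ]; field_simp
    rw [h4]
    refine this.trans ?_
    have h5 : n * (8 * C * ℓ * μ + 2 * δ * dist (c j) (c (j + 1)) + 2 * δ * μ) =
        n * (2 * (4 * C) * e + 2 * δ * dist (c j) (c (j + 1))) + 2 * δ * ℓ := by
      rw [heμ, ← hnμ]; ring
    rw [h5]
    linarith
  set z := c (2 * k + 1) with hz
  set u := c (2 * k) with hu
  set w := c (2 * k + 2) with hw
  have hi1 := hinc (2 * k) (by omega)
  have hi2 := hinc (2 * k + 1) (by omega)
  rw [← hz, ← hu, dist_comm u z] at hi1
  rw [show 2 * k + 1 + 1 = 2 * k + 2 by ring, ← hz, ← hw] at hi2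
  rw [dist_comm u z] at hk1 hk2
  set τ := dist z u with hτ
  set τ' := dist z w with hτ'
  have huw : |τ - τ'| ≤ dist u w ∧ dist u w ≤ τ + τ' := by
    refine ⟨?_, ?_⟩
    · have := abs_dist_sub_le u w z
      rwa [dist_comm u z, dist_comm w z] at this
    · exact dist_triangle_left _ _ _
  have hA1 : (τ - τ') ^ 2 ≤ φ ^ 2 * (τ ^ 2 + τ' ^ 2) := by
    have : dist u w ^ 2 ≤ (τ + τ') ^ 2 := by gcongr; exact huw.2
    linarith
  have hB1 : (1 - φ ^ 2) * (2 * μ ^ 2) ≤ τ ^ 2 + τ' ^ 2 := by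
    have : e / N = 2 * μ ^ 2 := by
      have h1 : (N : ℝ) = n / 2 := by rw [hn]; push_cast; ring
      rw [h1, heμ, hμ]; field_simp
    rwa [this] at hk2
  obtain ⟨hτ0, hττ, hμτ⟩ := steps_comparable dist_nonneg dist_nonneg hμ0 hφ0 hφ1 hB1 hA1
  obtain ⟨hτ'0, hττ', hμτ'⟩ := steps_comparable (τ := τ') (τ' := τ) dist_nonneg dist_nonneg hμ0
    hφ0 hφ1 (by linarith) (by linarith)
  have h8φ : 8 * φ = ε := by rw [hφ]; ring
  rw [h8φ] at hμτ hμτ'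
  have hsmall : ∀ j < 2 * N, dist (c j) (c (j + 1)) < s₀ := fun j hj => by
    have h1 := step_sq_le_energy c hj
    have h2 : (N₀ : ℝ) ≤ N := by exact_mod_cast hNN₀
    have h3 : (N₀ : ℝ) * s₀ ^ 2 ≤ N * s₀ ^ 2 := by gcongr
    have hNp : (0 : ℝ) < N := by exact_mod_cast hN
    have h4 : n = 2 * N := by rw [hn]; push_cast; ring
    have h5 : e < s₀ ^ 2 := by
      have : (N : ℝ) * e < N * s₀ ^ 2 := by rw [h4] at hcB; linarith
      exact lt_of_mul_lt_mul_left this hNp.le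
    exact lt_of_pow_lt_pow_left₀ 2 hs₀.le (h1.trans_lt h5)
  have hCℓ : 8 * C * ℓ ≤ ε / 4 := by
    have h1 : C * ℓ ≤ C * (2 * S) := by gcongr
    have h2 : 4 * S ≤ β := by linarith
    have h3 : C * (4 * S) ≤ C * β := by gcongr
    linarith
  have herr : ∀ s, 0 < s → μ ≤ (1 + ε) * s →
      8 * C * ℓ * μ + 2 * δ * s + 2 * δ * μ ≤ (5 * δ + 3 / 8 * ε) * s := by
    intro s hs hμs
    have h1 : μ ≤ 3 / 2 * s := hμs.trans (by gcongr; linarith)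
    have h2 : 8 * C * ℓ * μ ≤ ε / 4 * (3 / 2 * s) := by gcongr
    have h3 : 2 * δ * μ ≤ 2 * δ * (3 / 2 * s) := by gcongr
    linarith
  have hVi : ∀ i, |(dist (a i) y - dist (a i) x) / ℓ| ≤ 1 := fun i => by
    rw [abs_div, abs_of_pos hℓp, div_le_one hℓp]
    have := abs_dist_sub_le y x (a i)
    rw [dist_comm y, dist_comm x, dist_comm y] at this
    exact this.trans hxyℓ
  refine ⟨z, ⟨hcE _, hcr₂ _ (by omega)⟩, u, w, hcr₂ _ (by omega), hcr₂ _ (by omega),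
    (dist_pos.1 hτ0).symm, (dist_pos.1 hτ'0).symm, ?_, ?_, ?_, μ / (ℓ * τ'), by positivity, ?_,
    fun i => ⟨?_, ?_⟩⟩
  · rw [dist_comm]; exact hsmall _ (by omega)
  · exact hsmall (2 * k + 1) (by omega)
  · unfold ec
    rw [← hτ, ← hτ', div_le_iff₀ (by positivity)]
    have h1 : 2 * τ * τ' ≤ τ ^ 2 + τ' ^ 2 := by linarith [sq_nonneg (τ - τ')]
    have h2 : (1 - φ ^ 2) * (2 * τ * τ') ≤ (1 - φ ^ 2) * (τ ^ 2 + τ' ^ 2) :=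
      mul_le_mul_of_nonneg_left h1 (by linarith)
    have h3 : φ ^ 2 ≤ ε := (pow_le_of_le_one hφ0.le (by linarith) two_ne_zero).trans (by linarith)
    have h4 : φ ^ 2 * (2 * τ * τ') ≤ ε * (2 * τ * τ') := by gcongr
    linarith
  · have : μ / (ℓ * τ') * dist x y ≤ μ / (ℓ * τ') * ℓ := by gcongr
    refine this.trans ?_
    have : μ / (ℓ * τ') * ℓ = μ / τ' := by field_simp
    rw [this, div_le_iff₀ hτ'0]
    exact hμτ'
  · have : τ' * (μ / (ℓ * τ') * (dist (a i) y - dist (a i) x)) =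
        μ * ((dist (a i) y - dist (a i) x) / ℓ) := by field_simp
    rw [this]
    refine (hi2 i).trans ((herr _ hτ'0 hμτ').trans ?_)
    gcongr; linarith
  · set V := (dist (a i) y - dist (a i) x) / ℓ with hV
    have h1 : dist (a i) u - dist (a i) z + τ * (μ / (ℓ * τ') * (dist (a i) y - dist (a i) x)) =
        -(dist (a i) z - dist (a i) u - μ * V) + (τ - τ') * (μ / τ' * V) := by
      rw [hV]; field_simp; ring
    rw [h1]
    refine (abs_add_le _ _).trans ?_
    rw [abs_neg, abs_mul]
    have h2 := (hi1 i).trans (herr _ hτ0 hμτ)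
    have h3 : |μ / τ' * V| ≤ 3 / 2 := by
      rw [abs_mul, abs_of_pos (by positivity)]
      have : μ / τ' ≤ 3 / 2 := by
        rw [div_le_iff₀ hτ'0]
        exact hμτ'.trans (by gcongr; linarith)
      calc μ / τ' * |V| ≤ 3 / 2 * 1 := by
            gcongr
            exact hVi i
        _ = _ := by norm_num
    have h4 : |τ - τ'| * |μ / τ' * V| ≤ 3 * φ * τ * (3 / 2) := by gcongr
    have h5 : 3 * φ * τ * (3 / 2) = 9 / 16 * ε * τ := by rw [hφ]; ring
    have h6 : 0 < ε * τ := by positivity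
    linarith
end

section
variable {X : Type*} [MetricSpace X] {κ : ℝ} {C₀ R : ℝ} {m : ℕ} {a b : Fin m → X} {p : X}
  {r C δ : ℝ}

/-- If no point of an extremal subset near `p` carries a longer strainer, the strainer map is
injective on the extremal subset near `p`. -/
lemma SData.exists_injOn (hA : IsAlexandrov X κ) {n : ℕ} (hn : dimH (univ : Set X) = n)
    {E : Set X} (hE : IsExtremal κ E)
    (h : SData κ C₀ R a b p r C δ) (hcpt : ∀ (p : X) (r : ℝ), r < R → IsCompact (closedBall p r))
    (hδm : 28 * δ * m ≤ 1) {η : ℝ} (hη : 0 < η) (hη1 : η ≤ 1) (hδη : 32 * δ ≤ η)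
    (hno : ∀ z ∈ E ∩ ball p r, ¬ IsStrainedPt κ (m + 1) η z) :
    ∃ r₁ > 0, ∀ x ∈ E ∩ ball p r₁, ∀ y ∈ E ∩ ball p r₁,
      (∀ i, dist (a i) x = dist (a i) y) → x = y := by
  have hδ0 := h.hδ
  have hC := h.hC
  obtain ⟨r', hr', hiso⟩ := h.isolated hA hn hη hη1 (by linarith) hno
  have hη2 : η ^ 2 ≤ η := by nlinarith
  obtain ⟨r₁, hr₁, H⟩ := h.exists_triple hA hE hcpt (by linarith) hδm hr' hiso
    (ε := η ^ 2 / 40) (by positivity) (by linarith) h.hr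
  refine ⟨r₁, hr₁, fun x hx y hy hxy => ?_⟩
  by_contra hne
  obtain ⟨z, hz, u, w, hu, hw, huz, hwz, hzu, hzw, hang, t, -, -, ht⟩ :=
    H x hx y hy hne (η ^ 2 / (80 * (C + 1))) (by positivity)
  refine hno z hz (h.add_strainer hA hz.2 hu hw huz hwz hη (c := 5 * δ + η ^ 2 / 40)
    (by positivity) (by linarith) ?_ (fun i => ?_) fun i => ?_)
  · have h1 : C * (dist z u + dist z w) ≤ C * (2 * (η ^ 2 / (80 * (C + 1)))) :=
      mul_le_mul_of_nonneg_left (by linarith) hC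
    have h2 : C * (2 * (η ^ 2 / (80 * (C + 1)))) ≤ η ^ 2 / 40 := by
      rw [show C * (2 * (η ^ 2 / (80 * (C + 1)))) = (C / (C + 1)) * (η ^ 2 / 40) by
        field_simp; ring]
      have : C / (C + 1) ≤ 1 := by rw [div_le_one (by positivity)]; linarith
      exact mul_le_of_le_one_left (by positivity) this
    linarith
  · have := (ht i).2
    rwa [hxy i, sub_self, mul_zero, mul_zero, add_zero] at this
  · have := (ht i).1
    rwa [hxy i, sub_self, mul_zero, mul_zero, sub_zero] at this

/-- Under the hypotheses of `SData.exists_injOn`, the inverse of the strainer map is Lipschitz. -/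
lemma SData.exists_dist_le (hA : IsAlexandrov X κ) {n : ℕ} (hn : dimH (univ : Set X) = n)
    {E : Set X} (hE : IsExtremal κ E)
    (h : SData κ C₀ R a b p r C δ) (hcpt : ∀ (p : X) (r : ℝ), r < R → IsCompact (closedBall p r))
    (hδm : 28 * δ * m ≤ 1) {η : ℝ} (hη : 0 < η) (hη1 : η ≤ 1) (hδη : 32 * δ ≤ η)
    (hno : ∀ z ∈ E ∩ ball p r, ¬ IsStrainedPt κ (m + 1) η z) :
    ∃ r₁ > 0, ∀ x ∈ E ∩ ball p r₁, ∀ y ∈ E ∩ ball p r₁,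
      dist x y ≤ 4 * ∑ j, |dist (a j) y - dist (a j) x| := by
  have := hA.1
  obtain ⟨r₁, hr₁, H⟩ := h.exists_injOn hA hn hE hcpt hδm hη hη1 hδη hno
  have hr := h.hr
  set ρ := min r₁ (r / 3) with hρ
  have hρ0 : 0 < ρ := by positivity
  set d := ρ / (16 * m + 2) with hd
  have hd0 : 0 < d := by positivity
  have hdρ : d * (16 * m + 2) = ρ := by rw [hd]; field_simp
  refine ⟨d, hd0, fun x hx y hy => ?_⟩
  have hxp : dist x p < d := hx.2
  have hyp : dist y p < d := hy.2
  have hxy : dist x y < 2 * d := dist_lt_of_mem_ball hx.2 hy.2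
  have hdm : 0 ≤ d * m := by positivity
  have hle : ∑ j, |dist (a j) y - dist (a j) x| ≤ m * dist x y := by
    calc ∑ j, |dist (a j) y - dist (a j) x| ≤ ∑ _j : Fin m, dist x y :=
          Finset.sum_le_sum fun j _ => by
            have := abs_dist_sub_le y x (a j)
            rwa [dist_comm y, dist_comm x, dist_comm y x] at this
      _ = m * dist x y := by simp
  have hmd : (m : ℝ) * dist x y ≤ m * (2 * d) := mul_le_mul_of_nonneg_left hxy.le (by positivity)
  have hd1 : d < ρ := by linarith
  obtain ⟨y', hy'E, hy', hdist⟩ := (h.hasMoves hA hE hcpt).exists_eq (x := x)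
    (by fun_prop) hE.1 (by rw [Fintype.card_fin]; linarith) hx.1
    (T := fun j => dist (a j) y) (by
      have := min_le_right r₁ (r / 3)
      linarith)
  have := H y' ⟨hy'E, by
    rw [mem_ball]
    have := dist_triangle y' x p
    rw [dist_comm y' x] at this
    have := min_le_left r₁ (r / 3)
    linarith⟩ y ⟨hy.1, by
      rw [mem_ball]
      have := min_le_left r₁ (r / 3)
      linarith⟩ (congrFun hy')
  rwa [this] at hdist

/-- Under the hypotheses of `SData.exists_injOn`, the dimension of the extremal subset near `p` is
at most the length of the strainer. -/
lemma SData.exists_dimH_le (hA : IsAlexandrov X κ) {n : ℕ} (hn : dimH (univ : Set X) = n)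
    {E : Set X} (hE : IsExtremal κ E)
    (h : SData κ C₀ R a b p r C δ) (hcpt : ∀ (p : X) (r : ℝ), r < R → IsCompact (closedBall p r))
    (hδm : 28 * δ * m ≤ 1) {η : ℝ} (hη : 0 < η) (hη1 : η ≤ 1) (hδη : 32 * δ ≤ η)
    (hno : ∀ z ∈ E ∩ ball p r, ¬ IsStrainedPt κ (m + 1) η z) :
    ∃ r₁ > 0, dimH (E ∩ ball p r₁) ≤ m := by
  obtain ⟨r₁, hr₁, H⟩ := h.exists_dist_le hA hn hE hcpt hδm hη hη1 hδη hno
  refine ⟨r₁, hr₁, ?_⟩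
  have := dimH_le_card_of_antilipschitz (G := fun x i => dist (a i) x) (K := 4 * m)
    (S := E ∩ ball p r₁) fun x hx y hy => (H x hx y hy).trans ?_
  · rwa [Fintype.card_fin] at this
  · have : ∑ j, |dist (a j) y - dist (a j) x| ≤
        ∑ _j : Fin m, dist (fun i => dist (a i) x) fun i => dist (a i) y :=
      Finset.sum_le_sum fun j _ => by
        have := dist_le_pi_dist (fun i => dist (a i) x) (fun i => dist (a i) y) j
        rwa [Real.dist_eq, abs_sub_comm] at this
    simp only [Finset.sum_const, Finset.card_univ, Fintype.card_fin, nsmul_eq_mul] at this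
    push_cast
    linarith

/-- A longer strainer with a fixed quality cannot exist in an extremal subset if longer strainers
of better quality do not exist. -/
lemma not_isStrainedPt_of_forall (hA : IsAlexandrov X κ) {n : ℕ} (hn : dimH (univ : Set X) = n)
    {E : Set X} (hE : IsExtremal κ E) (hK : KC κ C₀ R)
    (hcpt : ∀ (p : X) (r : ℝ), r < R → IsCompact (closedBall p r)) {U : Set X} (hU : IsOpen U)
    {k : ℕ} {δ η : ℝ} (hδ : 0 < δ) (hδ1 : δ ≤ 1) (hδk : 28 * δ * k ≤ 1)
    (hη : 0 < η) (hη1 : η ≤ 1) (hηk : 28 * η * (k + 1) ≤ 1)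
    (hno : ∀ z ∈ E ∩ U, ¬ IsStrainedPt κ (k + 1) δ z) :
    ∀ z ∈ E ∩ U, ¬ IsStrainedPt κ (k + 1) η z := by
  have := hA.1
  rintro z ⟨hzE, hzU⟩ ⟨a, b, hab⟩
  obtain ⟨r, C, hS⟩ := exists_sdata hK hη hη1 hab
  have hr := hS.hr
  have hmv := hS.hasMoves hA hE hcpt
  set ζ : ℕ → ℝ := fun j => (1 / 32) ^ (k + 1 - j) * δ with hζ
  have hζpos : ∀ j, 0 < ζ j := fun j => by positivity
  have hζle : ∀ j, ζ j ≤ δ := fun j =>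
    mul_le_of_le_one_left hδ.le (pow_le_one₀ (by norm_num) (by norm_num))
  have hζs : ∀ j ≤ k, 32 * ζ j = ζ (j + 1) := fun j hj => by
    simp only [hζ]
    rw [show k + 1 - j = (k + 1 - (j + 1)) + 1 by omega, pow_succ]
    ring
  obtain ⟨ρ, hρ, hρU⟩ := Metric.isOpen_iff.1 hU z hzU
  set O := ball z (min ρ (r / 3)) with hO
  have hOU : O ⊆ U := (ball_subset_ball (min_le_left _ _)).trans hρU
  obtain ⟨j, -, hjk, ⟨z', hz', a', b', hab'⟩, hno'⟩ := exists_max_strained (κ := κ) (n := k) (η := ζ)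
    (S := E ∩ O) (fun x hx => by
      have : ζ (k + 1) = δ := by simp [hζ]
      rw [this]
      exact hno x ⟨hx.1, hOU hx.2⟩) (Nat.zero_le k)
    ⟨hzE, mem_ball_self (by positivity)⟩ isStrainedPt_zero
  obtain ⟨r', C', hS'⟩ := exists_sdata hK (hζpos j) ((hζle j).trans hδ1) hab'
  obtain ⟨ρ', hρ', hρO⟩ := Metric.isOpen_iff.1 (isOpen_ball : IsOpen O) z' hz'.2
  have hr' := hS'.hr
  have hS'' := hS'.mono (p' := z') (r' := min r' ρ') (by positivity) (min_le_left _ _)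
    (ball_subset_ball (min_le_left _ _))
  have hζj : 28 * ζ j * j ≤ 1 := by
    have h1 : (j : ℝ) ≤ k := by exact_mod_cast hjk
    have h2 : ζ j * j ≤ δ * k := mul_le_mul (hζle j) h1 (by positivity) hδ.le
    linarith
  obtain ⟨r₁, hr₁, hdim⟩ := hS''.exists_dimH_le hA hn hE hcpt hζj (hζpos (j + 1))
    ((hζle _).trans hδ1) (hζs j hjk).le fun x hx =>
      hno' x ⟨hx.1, hρO (ball_subset_ball (min_le_right _ _) hx.2)⟩
  have hnhds := hmv.image_mem_nhds (continuous_distMap a) hE.1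
    (by rw [Fintype.card_fin]; push_cast; linarith)
    (x := z') (ball_subset_ball (min_le_right _ _) hz'.2) hz'.1 hr₁
  have hcard := card_le_dimH_of_image_mem_nhds (K := 1)
    (LipschitzWith.lipschitzOnWith (lipschitz_distMap a)) hnhds
  rw [Fintype.card_fin] at hcard
  have := hcard.trans hdim
  have : k + 1 ≤ j := by exact_mod_cast this
  omega

end

section
variable {X : Type*} [MetricSpace X] {κ : ℝ} {C₀ R : ℝ} {m : ℕ} {a b : Fin m → X} {p : X}
  {r C δ : ℝ}

/-! ### The lower distance estimate -/

/-- Two far points in almost opposite directions: the sum of the distances is almost constant. -/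
lemma Far.sum_le (hA : IsAlexandrov X κ) {c c' : X} (hc : Far κ c p r C) (hc' : Far κ c' p r C)
    (hδ : 0 < δ) (hsm : 100 * C * r ≤ δ) (hopp : ∀ x ∈ ball p r, ca κ c x c' ≤ -1 + δ ^ 2 / 5)
    {x y : X} (hx : x ∈ ball p r) (hy : y ∈ ball p r) :
    |(dist c x + dist c' x) - (dist c y + dist c' y)| ≤ 2 * δ * dist x y := by
  have main : ∀ x ∈ ball p r, ∀ y ∈ ball p r,
      (dist c y + dist c' y) - (dist c x + dist c' x) ≤ 2 * δ * dist x y := by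
    intro x hx y hy
    rcases eq_or_ne y x with rfl | hyx
    · simp
    have hd := dist_pos.2 hyx.symm
    have q := quad_cos' hA (hc.ne hx) (hc'.ne hx) hyx hδ.le (hopp x hx)
    have a1 := (abs_le.1 (hc.2.2.2 x hx y hy hyx)).2
    have a2 := (abs_le.1 (hc'.2.2.2 x hx y hy hyx)).2
    have hs : 2 * C * dist x y ≤ δ := by
      have h1 := dist_lt_of_mem_ball hx hy
      have h2 := hc.2.1
      have h3 : C * dist x y ≤ C * (2 * r) := mul_le_mul_of_nonneg_left h1.le h2
      have h4 : 0 ≤ C * r := mul_nonneg h2 hc.1.le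
      linarith
    have : -(2 * δ) ≤ ((dist c x - dist c y) + (dist c' x - dist c' y)) / dist x y := by
      rw [add_div]; linarith
    rw [le_div_iff₀ hd] at this
    linarith
  rw [abs_le]
  have h1 := main x hx y hy
  have h2 := main y hy x hx
  rw [dist_comm y x] at h2
  constructor <;> linarith

/-- Moving inside an extremal subset towards a far point, with control of all pairs of almost
opposite far points. -/
lemma SData.exists_move_toward (hA : IsAlexandrov X κ) {E : Set X} (hE : IsExtremal κ E)
    (h : SData κ C₀ R a b p r C δ) (hcpt : ∀ (p : X) (r : ℝ), r < R → IsCompact (closedBall p r))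
    {c : X} (hc : Far κ c p r C) {x : X} (hx : x ∈ E) {s : ℝ} (hs : 0 < s)
    (hsr : dist x p + 2 * s < r) :
    ∃ y ∈ E, dist x y ≤ 2 * s ∧ ∀ c₁ c₂ α e, Far κ c₁ p r C → Far κ c₂ p r C →
      (∀ x ∈ ball p r, ∀ y ∈ ball p r,
        |(dist c₁ x + dist c₂ x) - (dist c₁ y + dist c₂ y)| ≤ 2 * δ * dist x y) → 0 ≤ e →
      (c₁ = c ∧ α = 1 ∨ c₂ = c ∧ α = -1 ∨
        ∀ q ∈ ball p r, ca κ c₁ q c ≤ α + e ∧ ca κ c₂ q c ≤ -α + e) →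
      |dist c₁ y - dist c₁ x + α * s| ≤ (e + 6 * δ) * s := by
  have hr := h.hr
  have hrR : r ≤ R := by have := h.hrR; linarith
  have hxb : x ∈ ball p r := by rw [mem_ball]; linarith
  obtain ⟨q, hxq, hq, hcq, hmv⟩ := hc.move hA h.kc hrR hs (by linarith)
  obtain ⟨y, hyE, hy, hxy, hqy, hfar, -, -⟩ := h.exists_near hA hE hcpt hx hq hs hxq.le hsr
  have hds : 0 < δ * s := mul_pos h.hδ hs
  have hC := h.hC
  have hsr' : s ≤ r := by have := dist_nonneg (x := x) (y := p); linarith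
  have hCs : C * s ≤ δ := by
    have h1 : C * s ≤ C * r := mul_le_mul_of_nonneg_left hsr' hC
    have h2 := h.hsm
    have h3 : 0 ≤ C * r := mul_nonneg hC hr.le
    linarith
  have hC2 : C * s ^ 2 ≤ δ * s := by
    have : C * s * s ≤ δ * s := mul_le_mul_of_nonneg_right hCs hs.le
    linarith [show C * s ^ 2 = C * s * s by ring]
  have hq2 : C * dist q y ^ 2 ≤ δ * s := by
    have : dist q y ^ 2 ≤ s ^ 2 := pow_le_pow_left₀ dist_nonneg hqy 2
    have := mul_le_mul_of_nonneg_left this hC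
    linarith
  refine ⟨y, hyE, hxy, fun c₁ c₂ α e h1 h2 hopp he halt => ?_⟩
  have n1 := hfar c₁ p r C h1 hq hy
  have n2 := hfar c₂ p r C h2 hq hy
  have oq := abs_le.1 (hopp x hxb q hq)
  have oy := abs_le.1 (hopp q hq y hy)
  rw [hxq] at oq
  have hy1 : 2 * δ * dist q y ≤ 2 * δ * s :=
    mul_le_mul_of_nonneg_left hqy (by have := h.hδ; positivity)
  have hes : 0 ≤ e * s := by positivity
  rw [abs_le]
  rcases halt with ⟨rfl, rfl⟩ | ⟨rfl, rfl⟩ | hang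
  · constructor <;> linarith
  · constructor <;> linarith
  · have m1 := hmv c₁ C h1
    have m2 := hmv c₂ C h2
    have k1 := mul_le_mul_of_nonneg_right (hang q hq).1 hs.le
    have k2 := mul_le_mul_of_nonneg_right (hang q hq).2 hs.le
    constructor <;> linarith

/-- The linear change of coordinates straightening the differentials of the coordinate moves. -/
noncomputable def straighten (V : Fin m → ℝ) (A : Fin m → ℝ) (B : ℝ) : Option (Fin m) → ℝ
  | none => -(B + ∑ j, V j * A j) / (1 - ∑ j, V j ^ 2)
  | some i => -(B + ∑ j, V j * A j) / (1 - ∑ j, V j ^ 2) * V i - A i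

lemma straighten_sub (V A A' : Fin m → ℝ) (B B' : ℝ) (o : Option (Fin m)) :
    straighten V A B o - straighten V A' B' o = straighten V (fun j => A j - A' j) (B - B') o := by
  have : ∑ j, V j * (A j - A' j) = ∑ j, V j * A j - ∑ j, V j * A' j := by
    rw [← Finset.sum_sub_distrib]; exact Finset.sum_congr rfl fun j _ => by ring
  cases o <;> simp only [straighten, this] <;> ring

lemma abs_straighten_le {V A : Fin m → ℝ} {B d : ℝ} (hV : ∑ j, V j ^ 2 < 1)
    (hA : ∀ j, |A j| ≤ d) (hB : |B| ≤ d) (o : Option (Fin m)) :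
    |straighten V A B o| ≤ (m + 2) / (1 - ∑ j, V j ^ 2) * d := by
  set N := 1 - ∑ j, V j ^ 2 with hN
  have hN0 : 0 < N := by linarith
  have hN1 : N ≤ 1 := by
    have : 0 ≤ ∑ j, V j ^ 2 := Finset.sum_nonneg fun j _ => sq_nonneg _
    linarith
  have hd : 0 ≤ d := (abs_nonneg B).trans hB
  have hV1 : ∀ j, |V j| ≤ 1 := fun j => by
    have h1 : V j ^ 2 ≤ ∑ j, V j ^ 2 :=
      Finset.single_le_sum (fun j _ => sq_nonneg (V j)) (Finset.mem_univ j)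
    exact abs_le_one_iff_mul_self_le_one.2 (by nlinarith)
  have hsum : |∑ j, V j * A j| ≤ m * d := by
    calc |∑ j, V j * A j| ≤ ∑ j, |V j * A j| := Finset.abs_sum_le_sum_abs _ _
      _ ≤ ∑ _j : Fin m, d := Finset.sum_le_sum fun j _ => by
          rw [abs_mul]
          calc |V j| * |A j| ≤ 1 * d := mul_le_mul (hV1 j) (hA j) (abs_nonneg _) zero_le_one
            _ = d := one_mul d
      _ = m * d := by simp
  have hT : |-(B + ∑ j, V j * A j) / N| ≤ (m + 1) / N * d := by
    rw [abs_div, abs_neg, abs_of_pos hN0, div_mul_eq_mul_div]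
    have := abs_add_le B (∑ j, V j * A j)
    exact div_le_div_of_nonneg_right (by linarith) hN0.le
  have e1 : ((m : ℝ) + 2) / N * d = (m + 1) / N * d + d / N := by ring
  have hdN : d ≤ d / N := by rw [le_div_iff₀ hN0]; nlinarith
  cases o with
  | none =>
    change |-(B + ∑ j, V j * A j) / N| ≤ _
    linarith
  | some i =>
    change |-(B + ∑ j, V j * A j) / N * V i - A i| ≤ _
    have h1 := abs_sub (-(B + ∑ j, V j * A j) / N * V i) (A i)
    rw [abs_mul] at h1
    have h2 : |-(B + ∑ j, V j * A j) / N| * |V i| ≤ |-(B + ∑ j, V j * A j) / N| * 1 :=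
      mul_le_mul_of_nonneg_left (hV1 i) (abs_nonneg _)
    have := hA i
    linarith

/-- If a pair of almost opposite far points makes definite angles with the strainer directions,
the extremal subset has coordinate moves in one more direction. -/
lemma SData.hasMoves_straighten (hA : IsAlexandrov X κ) {E : Set X} (hE : IsExtremal κ E)
    (h : SData κ C₀ R a b p r C δ) (hcpt : ∀ (p : X) (r : ℝ), r < R → IsCompact (closedBall p r))
    {u w : X} (hu : Far κ u p r C) (hw : Far κ w p r C) {V : Fin m → ℝ} {e : ℝ} (heδ : δ ≤ e)
    (hV : ∑ j, V j ^ 2 < 1)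
    (huw : ∀ x ∈ ball p r, ca κ w x u ≤ -1 + δ ^ 2 / 5)
    (haw : ∀ x ∈ ball p r, ∀ i, ca κ (a i) x w ≤ -V i + e)
    (hbw : ∀ x ∈ ball p r, ∀ i, ca κ (b i) x w ≤ V i + e)
    (hau : ∀ x ∈ ball p r, ∀ i, ca κ (a i) x u ≤ V i + e)
    (hbu : ∀ x ∈ ball p r, ∀ i, ca κ (b i) x u ≤ -V i + e) :
    HasMoves (fun x => straighten V (fun i => dist (a i) x) (dist w x)) E p (r / 3)
      ((m + 2) / (1 - ∑ j, V j ^ 2) * (e + 6 * δ)) := by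
  have hδ := h.hδ
  have he : 0 ≤ e := hδ.le.trans heδ
  have hN0 : 0 < 1 - ∑ j, V j ^ 2 := by linarith
  have hopp : ∀ x ∈ ball p r, ∀ y ∈ ball p r,
      |(dist w x + dist u x) - (dist w y + dist u y)| ≤ 2 * δ * dist x y :=
    fun x hx y hy => hw.sum_le hA hu hδ h.hsm huw hx hy
  have hoab : ∀ i, ∀ x ∈ ball p r, ∀ y ∈ ball p r,
      |(dist (a i) x + dist (b i) x) - (dist (a i) y + dist (b i) y)| ≤ 2 * δ * dist x y :=
    fun i x hx y hy => h.sum_le hA i hx hy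
  have hcos : ∀ {c c' q : X}, π / 2 - δ < cangle κ c q c' → ca κ c q c' ≤ e := fun hh =>
    (cos_lt_of_pi_div_two_sub_lt (cangle_le_pi _ _ _) hδ.le hh).trans heδ
  -- the increments of the coordinates in terms of those of the distances
  have fin : ∀ {x y : X} {s : ℝ} (A₀ : Fin m → ℝ) (B₀ : ℝ),
      (∀ j, |dist (a j) y - dist (a j) x + A₀ j * s| ≤ (e + 6 * δ) * s) →
      |dist w y - dist w x + B₀ * s| ≤ (e + 6 * δ) * s → ∀ o : Option (Fin m),
      |straighten V (fun i => dist (a i) y) (dist w y) o -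
        straighten V (fun i => dist (a i) x) (dist w x) o -
        straighten V (fun i => -A₀ i * s) (-B₀ * s) o| ≤
      (m + 2) / (1 - ∑ j, V j ^ 2) * (e + 6 * δ) * s := by
    intro x y s A₀ B₀ h1 h2 o
    rw [straighten_sub, straighten_sub, mul_assoc]
    refine abs_straighten_le hV (fun j => ?_) ?_ o
    · rw [neg_mul, sub_neg_eq_add]; exact h1 j
    · rw [neg_mul, sub_neg_eq_add]; exact h2
  have hVV : ∀ σ s : ℝ, ∑ j, V j * (σ * V j * s) = σ * s * ∑ j, V j ^ 2 := fun σ s => by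
    rw [Finset.mul_sum]; exact Finset.sum_congr rfl fun j _ => by ring
  intro x hx o σ hσ s hs hsr
  have hxp : dist x p < r / 3 := hx.2
  have hsr' : dist x p + 2 * s < r := by linarith
  cases o with
  | none =>
    -- moves towards `w` and `u`
    have st : ∀ σ : ℝ, ∀ j, straighten V (fun i => -(-(σ * V i)) * s) (-σ * s) j =
        if j = none then σ * s else 0 := by
      intro σ j
      have e1 : -(-σ * s + ∑ j, V j * (σ * V j * s)) / (1 - ∑ j, V j ^ 2) = σ * s := by
        rw [hVV, div_eq_iff hN0.ne']; ring
      cases j with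
      | none => simp only [straighten, neg_neg, if_true, e1]
      | some i => simp only [straighten, neg_neg, e1, reduceCtorEq, if_false]; ring
    rcases hσ with rfl | rfl
    · obtain ⟨y, hyE, hxy, hy⟩ := h.exists_move_toward hA hE hcpt hw hx.1 hs hsr'
      refine ⟨y, hyE, hxy, fun j => ?_⟩
      rw [← st 1 j]
      refine fin _ _ (fun j => hy _ _ _ _ (h.far_a j) (h.far_b j) (hoab j) he
        (Or.inr (Or.inr fun q hq => ⟨by linarith [haw q hq j], by linarith [hbw q hq j]⟩)))
        (hy _ _ _ _ hw hu hopp he (Or.inl ⟨rfl, rfl⟩)) j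
    · obtain ⟨y, hyE, hxy, hy⟩ := h.exists_move_toward hA hE hcpt hu hx.1 hs hsr'
      refine ⟨y, hyE, hxy, fun j => ?_⟩
      rw [← st (-1) j]
      refine fin _ _ (fun j => hy _ _ _ _ (h.far_a j) (h.far_b j) (hoab j) he
        (Or.inr (Or.inr fun q hq => ⟨by linarith [hau q hq j], by linarith [hbu q hq j]⟩)))
        (hy _ _ _ _ hw hu hopp he (Or.inr (Or.inl ⟨rfl, rfl⟩))) j
  | some i =>
    have st : ∀ σ : ℝ, ∀ j, straighten V (fun k => -(if k = i then σ else 0) * s) (-(-(σ * V i)) * s)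
        j = if j = some i then σ * s else 0 := by
      intro σ j
      have e1 : ∑ j, V j * (-(if j = i then σ else 0) * s) = -(V i * σ * s) := by
        rw [Finset.sum_eq_single i (fun j _ hj => by simp [hj]) (by simp)]
        simp; ring
      cases j with
      | none =>
        simp only [straighten, e1, reduceCtorEq, if_false]
        ring
      | some k =>
        simp only [straighten, e1, Option.some_inj]
        split_ifs <;> ring
    have hstr : ∀ q ∈ ball p r, ∀ j, j ≠ i → ca κ (a j) q (a i) ≤ e ∧ ca κ (b j) q (a i) ≤ e ∧
        ca κ (a j) q (b i) ≤ e ∧ ca κ (b j) q (b i) ≤ e := fun q hq j hj => by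
      have h1 := (h.str q hq).2 j i hj
      have h2 := (h.str q hq).2 i j hj.symm
      exact ⟨hcos h1.1, hcos (by rw [cangle_comm]; exact h2.2.1), hcos h1.2.1, hcos h1.2.2⟩
    rcases hσ with rfl | rfl
    · obtain ⟨y, hyE, hxy, hy⟩ := h.exists_move_toward hA hE hcpt (h.far_a i) hx.1 hs hsr'
      refine ⟨y, hyE, hxy, fun j => ?_⟩
      rw [← st 1 j]
      refine fin _ _ (fun j => hy _ _ _ _ (h.far_a j) (h.far_b j) (hoab j) he ?_)
        (hy _ _ _ _ hw hu hopp he (Or.inr (Or.inr fun q hq => ?_))) j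
      · by_cases hj : j = i
        · subst hj; exact Or.inl ⟨rfl, by simp⟩
        · refine Or.inr (Or.inr fun q hq => ?_)
          simp only [hj, if_false, neg_zero, zero_add]
          exact ⟨(hstr q hq j hj).1, (hstr q hq j hj).2.1⟩
      · rw [ca_comm w, ca_comm u]
        exact ⟨by linarith [haw q hq i], by linarith [hau q hq i]⟩
    · obtain ⟨y, hyE, hxy, hy⟩ := h.exists_move_toward hA hE hcpt (h.far_b i) hx.1 hs hsr'
      refine ⟨y, hyE, hxy, fun j => ?_⟩
      rw [← st (-1) j]
      refine fin _ _ (fun j => hy _ _ _ _ (h.far_a j) (h.far_b j) (hoab j) he ?_)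
        (hy _ _ _ _ hw hu hopp he (Or.inr (Or.inr fun q hq => ?_))) j
      · by_cases hj : j = i
        · subst hj; exact Or.inr (Or.inl ⟨rfl, by simp⟩)
        · refine Or.inr (Or.inr fun q hq => ?_)
          simp only [hj, if_false, neg_zero, zero_add]
          exact ⟨(hstr q hq j hj).2.2.1, (hstr q hq j hj).2.2.2⟩
      · rw [ca_comm w, ca_comm u]
        exact ⟨by linarith [hbw q hq i], by linarith [hbu q hq i]⟩

end

section
variable {X : Type*} [MetricSpace X] {κ : ℝ} {C₀ R : ℝ} {m : ℕ} {a b : Fin m → X} {p : X}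
  {r C δ : ℝ}

lemma abs_sub_straighten_le {V : Fin m → ℝ} (hV : ∑ j, V j ^ 2 < 1) (w x y : X) :
    dist (straighten V (fun i => dist (a i) x) (dist w x))
      (straighten V (fun i => dist (a i) y) (dist w y)) ≤
      (m + 2) / (1 - ∑ j, V j ^ 2) * dist x y := by
  have hN0 : 0 < 1 - ∑ j, V j ^ 2 := by linarith
  have hd : ∀ c : X, |dist c x - dist c y| ≤ dist x y := fun c => by
    have := abs_dist_sub_le x y c
    rwa [dist_comm x c, dist_comm y c] at this
  refine (dist_pi_le_iff (by positivity)).2 fun o => ?_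
  rw [Real.dist_eq, straighten_sub]
  exact abs_straighten_le hV (fun j => hd _) (hd _) o

set_option maxHeartbeats 800000 in
/-- The lower distance estimate for the strainer map on an extremal subset. -/
lemma SData.exists_le_sum_sq (hA : IsAlexandrov X κ) {E : Set X} (hE : IsExtremal κ E)
    (h : SData κ C₀ R a b p r C δ) (hcpt : ∀ (p : X) (r : ℝ), r < R → IsCompact (closedBall p r))
    {r' : ℝ} (hr' : 0 < r')
    (hiso : ∀ x ∈ E ∩ ball p r', (∀ i, dist (a i) x = dist (a i) p) → x = p) {ρ : ℝ} (hρ : 0 < ρ)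
    (hdim : dimH (E ∩ ball p ρ) ≤ m) {ε : ℝ} (hε1 : ε ≤ 1)
    (hδε : 120 * (m + 2) * (m + 1) * δ ≤ ε) :
    ∃ r₁ > 0, ∀ x ∈ E ∩ ball p r₁, ∀ y ∈ E ∩ ball p r₁,
      (1 - ε) * dist x y ^ 2 ≤ ∑ i, (dist (a i) y - dist (a i) x) ^ 2 := by
  have := hA.1
  have hδ := h.hδ
  have hr := h.hr
  have hC := h.hC
  have hC₀ := h.hC₀
  have hrR := h.hrR
  have hKC := h.kc.2.1
  have hm0 : (0 : ℝ) ≤ m := Nat.cast_nonneg m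
  have hmδ : 0 ≤ m * δ := by positivity
  have hmδ2 : 0 ≤ m * (m * δ) := by positivity
  have hδε' : 120 * (m * (m * δ)) + 360 * (m * δ) + 240 * δ ≤ ε := by linarith
  have hε : 0 < ε := by linarith
  have hδ2 : δ ^ 2 ≤ δ := by nlinarith
  obtain ⟨r₁, hr₁, H⟩ := h.exists_triple hA hE hcpt (by linarith) (by linarith) hr' hiso
    (ε := δ ^ 2 / 20) (by positivity) (by linarith) (r₂ := min r ρ) (by positivity)
  refine ⟨r₁, hr₁, fun x hx y hy => ?_⟩
  rcases eq_or_ne x y with rfl | hne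
  · simp
  by_contra hlt
  push Not at hlt
  obtain ⟨z, ⟨hzE, hz⟩, u, w, hu, hw, huz, hwz, hzu, hzw, hang, t, ht0, ht, hfw⟩ :=
    H x hx y hy hne (δ ^ 2 / (40 * (C + 1))) (by positivity)
  have hzr : z ∈ ball p r := ball_subset_ball (min_le_left _ _) hz
  have hur : u ∈ ball p r := ball_subset_ball (min_le_left _ _) hu
  have hwr : w ∈ ball p r := ball_subset_ball (min_le_left _ _) hw
  set V : Fin m → ℝ := fun i => t * (dist (a i) y - dist (a i) x) with hVdef
  have hN : ∑ j, V j ^ 2 ≤ 1 - ε / 2 := by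
    have e1 : ∑ j, V j ^ 2 = t ^ 2 * ∑ i, (dist (a i) y - dist (a i) x) ^ 2 := by
      rw [Finset.mul_sum]; exact Finset.sum_congr rfl fun j _ => by simp only [hVdef]; ring
    have h1 : t ^ 2 * ∑ i, (dist (a i) y - dist (a i) x) ^ 2 ≤
        t ^ 2 * ((1 - ε) * dist x y ^ 2) := mul_le_mul_of_nonneg_left hlt.le (sq_nonneg t)
    have h2 : (t * dist x y) ^ 2 ≤ (1 + δ ^ 2 / 20) ^ 2 :=
      pow_le_pow_left₀ (by positivity) ht 2
    have h3 : (1 + δ ^ 2 / 20) ^ 2 ≤ 1 + δ := by nlinarith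
    have h4 : (1 - ε) * (t * dist x y) ^ 2 ≤ (1 - ε) * (1 + δ) :=
      mul_le_mul_of_nonneg_left (h2.trans h3) (by linarith)
    have h5 : 0 ≤ ε * δ := by positivity
    rw [e1]
    linarith [show t ^ 2 * ((1 - ε) * dist x y ^ 2) = (1 - ε) * (t * dist x y) ^ 2 by ring]
  have hV1 : ∑ j, V j ^ 2 < 1 := by linarith
  -- angles at `z`
  have hzu0 : 0 < dist z u := dist_pos.2 huz.symm
  have hzw0 : 0 < dist z w := dist_pos.2 hwz.symm
  have hs₀ : (C + 1) * (δ ^ 2 / (40 * (C + 1))) = δ ^ 2 / 40 := by field_simp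
  have hCu : C * dist z u ≤ δ ^ 2 / 40 := by
    have : C * dist z u ≤ C * (δ ^ 2 / (40 * (C + 1))) := mul_le_mul_of_nonneg_left hzu.le hC
    have : 0 ≤ δ ^ 2 / (40 * (C + 1)) := by positivity
    linarith
  have hCw : C * dist z w ≤ δ ^ 2 / 40 := by
    have : C * dist z w ≤ C * (δ ^ 2 / (40 * (C + 1))) := mul_le_mul_of_nonneg_left hzw.le hC
    have : 0 ≤ δ ^ 2 / (40 * (C + 1)) := by positivity
    linarith
  have hzuR : dist z u < R := by linarith [dist_lt_of_mem_ball hzr hur]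
  have hzwR : dist z w < R := by linarith [dist_lt_of_mem_ball hzr hwr]
  have hsu : sn κ (dist z u) ≠ 0 := h.kc.2.2.1 _ hzu0 hzuR
  have hsw : sn κ (dist z w) ≠ 0 := h.kc.2.2.1 _ hzw0 hzwR
  have awu : ca κ w z u < -1 + δ ^ 2 / 5 := by
    have h1 := (abs_le.1 (h.kc.ca_approx hwz huz hzwR hzuR)).2
    have h2 : C₀ * (dist z w + dist z u) ≤ C * (dist z w + dist z u) :=
      mul_le_mul_of_nonneg_right hC₀ (by positivity)
    rw [ec_comm] at hang
    nlinarith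
  have far_w : ∀ c, Far κ c p r C → ∀ α, dist c w - dist c z - dist z w * α ≥
      -((7 * δ + δ ^ 2 / 20) * dist z w) → ca κ c z w < -α + 8 * δ := by
    intro c hc α hα
    have h1 := (abs_le.1 (hc.2.2.2 z hzr w hwr hwz)).2
    have h2 : (dist c z - dist c w) / dist z w ≤ -α + (7 * δ + δ ^ 2 / 20) := by
      rw [div_le_iff₀ hzw0]; linarith
    linarith
  have far_u : ∀ c, Far κ c p r C → ∀ α, dist c u - dist c z - dist z u * α ≥
      -((7 * δ + δ ^ 2 / 20) * dist z u) → ca κ c z u < -α + 8 * δ := by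
    intro c hc α hα
    have h1 := (abs_le.1 (hc.2.2.2 z hzr u hur huz)).2
    have h2 : (dist c z - dist c u) / dist z u ≤ -α + (7 * δ + δ ^ 2 / 20) := by
      rw [div_le_iff₀ hzu0]; linarith
    linarith
  have hds : 0 < δ * dist z w := by positivity
  have hds' : 0 < δ * dist z u := by positivity
  have aaw : ∀ i, ca κ (a i) z w < -V i + 8 * δ := fun i => far_w _ (h.far_a i) _ (by
    have := abs_le.1 (hfw i).1; linarith)
  have abw : ∀ i, ca κ (b i) z w < V i + 8 * δ := fun i => by
    have := far_w _ (h.far_b i) (-V i) (by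
      have h1 := abs_le.1 (hfw i).1
      have h2 := abs_le.1 (h.sum_le hA i hzr hwr)
      linarith)
    rwa [neg_neg] at this
  have aau : ∀ i, ca κ (a i) z u < V i + 8 * δ := fun i => by
    have := far_u _ (h.far_a i) (-V i) (by
      have h1 := abs_le.1 (hfw i).2
      linarith)
    rwa [neg_neg] at this
  have abu : ∀ i, ca κ (b i) z u < -V i + 8 * δ := fun i => far_u _ (h.far_b i) _ (by
    have h1 := abs_le.1 (hfw i).2
    have h2 := abs_le.1 (h.sum_le hA i hzr hur)
    linarith)
  -- angles near `z`
  have hca : ∀ {c c' : X} {v : ℝ}, sn κ (dist z c) ≠ 0 → sn κ (dist z c') ≠ 0 → ca κ c z c' < v →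
      ∀ᶠ x in nhds z, ca κ c x c' < v := fun h1 h2 h3 =>
    (continuous_cos.continuousAt.comp (continuousAt_cangle h1 h2)).eventually (gt_mem_nhds h3)
  have hsa := fun i => (h.far_a i).2.2.1 z hzr
  have hsb := fun i => (h.far_b i).2.2.1 z hzr
  obtain ⟨r₃, hr₃, hev⟩ := Metric.eventually_nhds_iff_ball.1
    ((hca hsw hsu awu).and <| (Filter.eventually_all.2 fun i => hca (hsa i) hsw (aaw i)).and <|
      (Filter.eventually_all.2 fun i => hca (hsb i) hsw (abw i)).and <|
      (Filter.eventually_all.2 fun i => hca (hsa i) hsu (aau i)).and <|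
      (Filter.eventually_all.2 fun i => hca (hsb i) hsu (abu i)))
  obtain ⟨rw, hrw, Cw, -, hFw⟩ := exists_far hsw
  obtain ⟨ru, hru, Cu, -, hFu⟩ := exists_far hsu
  set C' := max C (max Cw Cu) with hC'
  have hC'0 : 0 ≤ C' := hC.trans (le_max_left _ _)
  have hzp : 0 < min r ρ - dist z p := by have := mem_ball.1 hz; linarith
  set r₄ := min (min r₃ (min rw ru)) (min (min r ρ - dist z p) (δ / (100 * (C' + 1)))) with hr₄
  have hr₄0 : 0 < r₄ := by positivity
  have hr₄3 : r₄ ≤ r₃ := (min_le_left _ _).trans (min_le_left _ _)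
  have hr₄w : r₄ ≤ rw := (min_le_left _ _).trans ((min_le_right _ _).trans (min_le_left _ _))
  have hr₄u : r₄ ≤ ru := (min_le_left _ _).trans ((min_le_right _ _).trans (min_le_right _ _))
  have hr₄z : r₄ ≤ min r ρ - dist z p := (min_le_right _ _).trans (min_le_left _ _)
  have hr₄C : r₄ ≤ δ / (100 * (C' + 1)) := (min_le_right _ _).trans (min_le_right _ _)
  have hsub : ball z r₄ ⊆ ball p (min r ρ) := ball_subset_ball' (by linarith)
  have hsubr : ball z r₄ ⊆ ball p r := hsub.trans (ball_subset_ball (min_le_left _ _))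
  have hS : SData κ C₀ R a b z r₄ C' δ :=
    { hr := hr₄0
      hC := hC'0
      hδ := hδ
      kc := h.kc
      hrR := by
        have := min_le_left r ρ
        have := dist_nonneg (x := z) (y := p)
        linarith
      hC₀ := hC₀.trans (le_max_left _ _)
      hsm := by
        rw [le_div_iff₀ (by positivity)] at hr₄C
        linarith
      far_a := fun i => (h.far_a i).mono hr₄0 (le_max_left _ _) hsubr
      far_b := fun i => (h.far_b i).mono hr₄0 (le_max_left _ _) hsubr
      str := fun x hx => h.str x (hsubr hx) }
  have hev' := fun x hx => hev x (ball_subset_ball hr₄3 hx)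
  have hmv := hS.hasMoves_straighten hA hE hcpt (u := u) (w := w) (V := V) (e := 8 * δ)
    (hFu.mono hr₄0 ((le_max_right _ _).trans (le_max_right _ _)) (ball_subset_ball hr₄u))
    (hFw.mono hr₄0 ((le_max_left _ _).trans (le_max_right _ _)) (ball_subset_ball hr₄w))
    (by linarith) hV1 (fun x hx => (hev' x hx).1.le) (fun x hx i => ((hev' x hx).2.1 i).le)
    (fun x hx i => ((hev' x hx).2.2.1 i).le) (fun x hx i => ((hev' x hx).2.2.2.1 i).le)
    fun x hx i => ((hev' x hx).2.2.2.2 i).le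
  have hN0 : 0 < 1 - ∑ j, V j ^ 2 := by linarith
  have hlip : LipschitzWith (Real.toNNReal ((m + 2) / (1 - ∑ j, V j ^ 2)))
      (fun x => straighten V (fun i => dist (a i) x) (dist w x)) :=
    LipschitzWith.of_dist_le_mul fun x y => by
      rw [Real.coe_toNNReal _ (by positivity)]
      exact abs_sub_straighten_le hV1 w x y
  have hnhds := hmv.image_mem_nhds hlip.continuous hE.1 (by
    rw [Fintype.card_option, Fintype.card_fin]
    push_cast
    rw [show ((m : ℝ) + 2) / (1 - ∑ j, V j ^ 2) * (8 * δ + 6 * δ) * (m + 1) =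
      14 * (m + 2) * (m + 1) * δ / (1 - ∑ j, V j ^ 2) by ring, div_le_iff₀ hN0]
    nlinarith) (mem_ball_self (by positivity)) hzE hr₄0
  have hcard := card_le_dimH_of_image_mem_nhds hlip.lipschitzOnWith hnhds
  have hle : dimH (E ∩ ball z r₄) ≤ m := (dimH_mono (inter_subset_inter_right _
    (hsub.trans (ball_subset_ball (min_le_right _ _))))).trans hdim
  rw [Fintype.card_option, Fintype.card_fin] at hcard
  have : m + 1 ≤ m := by exact_mod_cast hcard.trans hle
  omega

end

section
variable {X : Type*} [MetricSpace X] {κ : ℝ} {C₀ R : ℝ} {m : ℕ} {a b : Fin m → X} {p : X}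
  {r C δ : ℝ}

/-! ### The upper distance estimate -/

/-- Moving away from a far point by `s` decreases the squared distance to other points at the
Euclidean rate. -/
lemma SData.sq_dist_le (hA : IsAlexandrov X κ) (h : SData κ C₀ R a b p r C δ) {τ : ℝ} (hτ : 0 < τ)
    (hδτ : δ ≤ τ) (hδτ2 : δ ≤ τ ^ 2) {c : X} (hc : Far κ c p r C) {q y z : X} {s : ℝ} (hs : 0 < s)
    (hz : z ∈ ball p r) (hq : q ∈ ball p r) (hy : y ∈ ball p r) (hzq : dist z q = s)
    (hcq : s - 4 * δ * s ≤ dist c q - dist c z) {F : ℝ}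
    (hF : dist c z - dist c y ≤ -F + 2 * δ * dist z y) :
    dist q y ^ 2 ≤ dist z y ^ 2 + s ^ 2 - 2 * s * (F - 9 * τ * dist z y) := by
  have hr := h.hr
  have hC := h.hC
  have hδ := h.hδ
  have hrR := h.hrR
  have hCr : 100 * (C * r) ≤ δ := by have := h.hsm; linarith
  have hCr0 : 0 ≤ C * r := by positivity
  have hqz : q ≠ z := by rintro rfl; rw [dist_self] at hzq; linarith
  have hsr : s < 2 * r := hzq ▸ dist_lt_of_mem_ball hz hq
  have hCs : C * s ≤ C * (2 * r) := mul_le_mul_of_nonneg_left hsr.le hC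
  rcases eq_or_ne y z with rfl | hyz
  · rw [dist_self] at hF ⊢
    rw [dist_comm q y, hzq]
    have : 0 ≤ s * -F := mul_nonneg hs.le (by linarith)
    linarith
  set d := dist z y with hd
  have hd0 : 0 < d := dist_pos.2 hyz.symm
  have hdr : d < 2 * r := dist_lt_of_mem_ball hz hy
  have hCd : C * d ≤ C * (2 * r) := mul_le_mul_of_nonneg_left hdr.le hC
  have h1 : ca κ q z c ≤ -1 + (5 * τ) ^ 2 / 5 := by
    have e1 := (abs_le.1 (hc.2.2.2 z hz q hq hqz)).2
    rw [hzq] at e1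
    have e2 : (dist c z - dist c q) / s ≤ -1 + 4 * δ := by
      rw [div_le_iff₀ hs]; linarith
    rw [ca_comm]
    linarith
  have h2 := quad_cos' hA hqz (hc.ne hz) hyz (by positivity) h1
  have h3 := (abs_le.1 (hc.2.2.2 z hz y hy hyz)).2
  have h4 : (dist c z - dist c y) / d ≤ -F / d + 2 * δ := by
    rw [div_le_iff₀ hd0, add_mul, div_mul_cancel₀ _ hd0.ne']; linarith
  have h5 := (abs_le.1 (h.kc.ca_approx hqz hyz (by linarith) (by linarith))).2
  have h6 : C₀ * (dist z q + dist z y) ≤ C * (s + d) := by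
    rw [hzq, ← hd]
    exact mul_le_mul_of_nonneg_right h.hC₀ (by positivity)
  have h7 : F / d - 9 * τ ≤ ec q z y := by
    have : -F / d = -(F / d) := neg_div _ _
    linarith
  have h8 : F - 9 * τ * d ≤ ec q z y * d := by
    have := mul_le_mul_of_nonneg_right h7 hd0.le
    rwa [sub_mul, div_mul_cancel₀ _ hd0.ne'] at this
  have h9 : 2 * s * (ec q z y * d) = s ^ 2 + d ^ 2 - dist q y ^ 2 := by
    unfold ec
    rw [hzq, ← hd]
    field_simp
  have h10 := mul_le_mul_of_nonneg_left h8 (by positivity : 0 ≤ 2 * s)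
  linarith

set_option maxHeartbeats 800000 in
/-- The upper distance estimate for the strainer map. -/
lemma SData.sum_sq_le (hA : IsAlexandrov X κ) (h : SData κ C₀ R a b p r C δ) {τ : ℝ} (hτ : 0 < τ)
    (hδτ : δ ≤ τ) (hδτ2 : δ ≤ τ ^ 2) {x y : X} (hx : x ∈ ball p (r / (2 * m + 4)))
    (hy : y ∈ ball p (r / (2 * m + 4))) :
    ∑ i, (dist (a i) y - dist (a i) x) ^ 2 ≤ (1 + 26 * m * (m + 1) * τ) * dist x y ^ 2 := by
  have hr := h.hr
  have hδ := h.hδ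
  have hm0 : (0 : ℝ) ≤ m := Nat.cast_nonneg m
  set ρ := r / (2 * m + 4) with hρ
  have hρr : ρ * (2 * m + 4) = r := by rw [hρ]; field_simp
  have hρ0 : 0 < ρ := by positivity
  set L := dist x y with hL
  have hL0 : 0 ≤ L := dist_nonneg
  have hLρ : L < 2 * ρ := dist_lt_of_mem_ball hx hy
  have hρr' : ρ ≤ r := by nlinarith
  set G : Fin m → ℝ := fun i => dist (a i) y - dist (a i) x with hG
  have hGL : ∀ i, |G i| ≤ L := fun i => by
    have := abs_dist_sub_le y x (a i)
    rwa [dist_comm y, dist_comm x, dist_comm y x] at this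
  have key : ∀ S : Finset (Fin m), ∃ z, dist x z ≤ S.card * L ∧
      (∀ j, |dist (a j) z - dist (a j) x - (if j ∈ S then G j else 0)| ≤ 4 * δ * (S.card * L)) ∧
      dist z y ^ 2 ≤ L ^ 2 - ∑ i ∈ S, G i ^ 2 + S.card * (26 * (m + 1) * τ * L ^ 2) := by
    intro S
    induction S using Finset.induction_on with
    | empty => exact ⟨x, by simp, by simp, by simp [hL]⟩
    | insert i S hi ih =>
      obtain ⟨z, hxz, hzj, hzy⟩ := ih
      rw [Finset.card_insert_of_notMem hi, Finset.sum_insert hi]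
      push_cast
      have hSm : (S.card : ℝ) ≤ m := by
        have := Finset.card_le_univ S
        rw [Fintype.card_fin] at this
        exact_mod_cast this
      have hSL : S.card * L ≤ m * L := mul_le_mul_of_nonneg_right hSm hL0
      have hmL : m * L ≤ m * (2 * ρ) := mul_le_mul_of_nonneg_left hLρ.le hm0
      have hδL : 0 ≤ δ * L := by positivity
      rcases eq_or_ne (G i) 0 with hG0 | hG0
      · refine ⟨z, by linarith, fun j => ?_, ?_⟩
        · refine le_trans ?_ ((hzj j).trans (by linarith))
          by_cases hj : j = i
          · subst hj; simp [hi, hG0]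
          · simp [hj]
        · rw [hG0]
          have : 0 ≤ 26 * ((m : ℝ) + 1) * τ * L ^ 2 := by positivity
          linarith
      set s := |G i| with hs
      have hs0 : 0 < s := abs_pos.2 hG0
      have hsL : s ≤ L := hGL i
      have hxp : dist x p < ρ := hx
      have hzp : dist z p ≤ S.card * L + dist x p := by
        have := dist_triangle_left z p x
        linarith
      have hzr : dist z p + s < r := by linarith
      have hzb : z ∈ ball p r := by rw [mem_ball]; linarith
      have hyb : y ∈ ball p r := ball_subset_ball hρr' hy
      obtain ⟨σ, hσ, hσG⟩ : ∃ σ : ℝ, (σ = 1 ∨ σ = -1) ∧ σ * s = G i := by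
        rcases abs_choice (G i) with h1 | h1
        · exact ⟨1, Or.inl rfl, by rw [hs, h1, one_mul]⟩
        · exact ⟨-1, Or.inr rfl, by rw [hs, h1]; ring⟩
      obtain ⟨q, hzq, hq, hmv⟩ := h.move hA i hs0 hzr σ hσ
      have hds : δ * s ≤ δ * L := mul_le_mul_of_nonneg_left hsL hδ.le
      have hSd : 0 ≤ S.card * (δ * L) := by positivity
      have hfz := abs_le.1 (hzj i)
      simp only [hi, if_false, sub_zero] at hfz
      have hstep : dist q y ^ 2 ≤ dist z y ^ 2 + s ^ 2 -
          2 * s * ((s - 4 * δ * (S.card * L)) - 9 * τ * dist z y) := by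
        have hmi := hmv i
        simp only [if_true] at hmi
        have h1 := abs_le.1 hmi.1
        have h2 := abs_le.1 hmi.2
        have h3 := abs_le.1 (h.sum_le hA i hzb hyb)
        have h4 : 0 ≤ δ * dist z y := by positivity
        have hGi : G i = dist (a i) y - dist (a i) x := rfl
        rcases hσ with rfl | rfl
        · exact h.sq_dist_le hA hτ hδτ hδτ2 (h.far_a i) hs0 hzb hq hyb hzq (by linarith)
            (by linarith)
        · exact h.sq_dist_le hA hτ hδτ hδτ2 (h.far_b i) hs0 hzb hq hyb hzq (by linarith)
            (by linarith)
      refine ⟨q, ?_, fun j => ?_, ?_⟩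
      · have := dist_triangle x z q
        rw [hzq] at this
        linarith
      · have h1 := abs_le.1 (hzj j)
        have h2 := abs_le.1 (hmv j).1
        rw [hσG] at h2
        by_cases hj : j = i
        · subst hj
          simp only [hi, if_false, if_true, Finset.mem_insert_self] at h1 h2 ⊢
          rw [abs_le]; constructor <;> linarith
        · simp only [hj, if_false, Finset.mem_insert, false_or] at h1 h2 ⊢
          rw [abs_le]; constructor <;> linarith
      · have e1 : s ^ 2 = G i ^ 2 := sq_abs _
        have e2 : dist z y ≤ (m + 1) * L := by
          have := dist_triangle_left z y x
          rw [← hL] at this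
          linarith
        have e3 : 4 * δ * (S.card * L) + 9 * τ * dist z y ≤ 13 * τ * ((m + 1) * L) := by
          have k1 : 9 * τ * dist z y ≤ 9 * τ * ((m + 1) * L) :=
            mul_le_mul_of_nonneg_left e2 (by positivity)
          have k2 : 4 * δ * (S.card * L) ≤ 4 * τ * ((m + 1) * L) :=
            mul_le_mul (by linarith) (by linarith) (by positivity) (by positivity)
          linarith
        have e4 : 2 * s * (4 * δ * (S.card * L) + 9 * τ * dist z y) ≤
            2 * L * (13 * τ * ((m + 1) * L)) :=
          mul_le_mul (by linarith) e3 (by positivity) (by positivity)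
        linarith
  obtain ⟨z, -, -, hz⟩ := key Finset.univ
  rw [Finset.card_univ, Fintype.card_fin] at hz
  have := sq_nonneg (dist z y)
  linarith

end

section
variable {X : Type*} [MetricSpace X] {κ : ℝ} {C₀ R : ℝ} {m : ℕ} {a b : Fin m → X} {p : X}
  {r C δ : ℝ}

/-! ### The intrinsic metric -/

lemma edist_le_intrinsicEDist (E : Set X) (x y : X) : edist x y ≤ intrinsicEDist E x y := by
  unfold intrinsicEDist
  refine le_iInf fun γ => le_iInf fun _ => le_iInf fun h0 => le_iInf fun h1 => le_iInf fun _ => ?_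
  rw [← h0, ← h1]
  exact eVariationOn.edist_le γ (by simp) (by simp)

lemma intrinsicEDist_le_of_lipschitz {E : Set X} {x y : X} {γ : ℝ → X} {K : ℝ≥0}
    (hγ : LipschitzOnWith K γ (Icc 0 1)) (h0 : γ 0 = x) (h1 : γ 1 = y)
    (hE : ∀ t ∈ Icc (0 : ℝ) 1, γ t ∈ E) : intrinsicEDist E x y ≤ K := by
  unfold intrinsicEDist
  refine iInf_le_of_le γ (iInf_le_of_le hγ.continuousOn (iInf_le_of_le h0 (iInf_le_of_le h1
    (iInf_le_of_le hE ?_))))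
  have e1 := hγ.comp_eVariationOn_le (g := id) (s := Icc (0 : ℝ) 1) (fun t ht => ht)
  have e2 := ((monotone_id.monotoneOn (Icc (0 : ℝ) 1)).eVariationOn_eq
    (left_mem_Icc.2 zero_le_one) (right_mem_Icc.2 zero_le_one)).le
  rw [Icc_inter_Icc, max_self, min_self] at e2
  simp only [id, sub_zero, ENNReal.ofReal_one] at e2
  exact e1.trans (mul_le_of_le_one_right' e2)

/-- The intrinsic distance is controlled by the strainer map. -/
lemma SData.exists_intrinsicEDist_le (hA : IsAlexandrov X κ) {E : Set X} (hE : IsExtremal κ E)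
    (h : SData κ C₀ R a b p r C δ) (hcpt : ∀ (p : X) (r : ℝ), r < R → IsCompact (closedBall p r))
    (hδm : 28 * δ * m ≤ 1) {r₁ θ : ℝ} (hr₁ : 0 < r₁) (hθ : 0 < θ)
    (hlow : ∀ x ∈ E ∩ ball p r₁, ∀ y ∈ E ∩ ball p r₁,
      (θ * dist x y) ^ 2 ≤ ∑ i, (dist (a i) y - dist (a i) x) ^ 2) :
    ∃ r₂ > 0, ∀ x ∈ E ∩ ball p r₂, ∀ y ∈ E ∩ ball p r₂,
      intrinsicEDist E x y ≤
        ENNReal.ofReal (√(∑ i, (dist (a i) y - dist (a i) x) ^ 2) / θ) := by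
  have := hA.1
  have hr := h.hr
  set ρ := min r₁ (r / 3) with hρ
  have hρ0 : 0 < ρ := by positivity
  set d := ρ / (16 * m + 2) with hd
  have hd0 : 0 < d := by positivity
  have hdρ : d * (16 * m + 2) = ρ := by rw [hd]; field_simp
  have hρ1 := min_le_left r₁ (r / 3)
  have hρ2 := min_le_right r₁ (r / 3)
  refine ⟨d, hd0, fun x hx y hy => ?_⟩
  have hxp : dist x p < d := hx.2
  have hyp : dist y p < d := hy.2
  have hxy : dist x y < 2 * d := dist_lt_of_mem_ball hx.2 hy.2
  have hdm : 0 ≤ d * m := by positivity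
  set F : Fin m → ℝ := fun i => dist (a i) y - dist (a i) x with hF
  have hle : ∑ j, |F j| ≤ m * dist x y := by
    calc ∑ j, |F j| ≤ ∑ _j : Fin m, dist x y :=
          Finset.sum_le_sum fun j _ => by
            have := abs_dist_sub_le y x (a j)
            rwa [dist_comm y, dist_comm x, dist_comm y x] at this
      _ = m * dist x y := by simp
  have hmd : (m : ℝ) * dist x y ≤ m * (2 * d) := mul_le_mul_of_nonneg_left hxy.le (by positivity)
  have hlift : ∀ t ∈ Icc (0 : ℝ) 1, ∃ z ∈ E ∩ ball p r₁, ∀ i, dist (a i) z = dist (a i) x + t * F i := by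
    intro t ht
    have hs : ∑ j, |dist (a j) x + t * F j - dist (a j) x| ≤ ∑ j, |F j| :=
      Finset.sum_le_sum fun j _ => by
        rw [add_sub_cancel_left, abs_mul, abs_of_nonneg ht.1]
        exact mul_le_of_le_one_left (abs_nonneg _) ht.2
    obtain ⟨z, hzE, hz, hxz⟩ := (h.hasMoves hA hE hcpt).exists_eq (x := x)
      (by fun_prop) hE.1 (by rw [Fintype.card_fin]; linarith) hx.1
      (T := fun j => dist (a j) x + t * F j) (by linarith)
    refine ⟨z, ⟨hzE, ?_⟩, congrFun hz⟩
    rw [mem_ball]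
    have := dist_triangle_left z p x
    linarith
  have hinj : ∀ u ∈ E ∩ ball p r₁, ∀ v ∈ E ∩ ball p r₁, (∀ i, dist (a i) u = dist (a i) v) →
      u = v := fun u hu v hv huv => by
    have := hlow u hu v hv
    simp only [huv, sub_self, ne_eq, OfNat.ofNat_ne_zero, not_false_eq_true, zero_pow,
      Finset.sum_const_zero] at this
    have h0 : θ * dist u v = 0 := pow_eq_zero_iff (two_ne_zero) |>.1 (le_antisymm this (sq_nonneg _))
    exact dist_eq_zero.1 ((mul_eq_zero.1 h0).resolve_left hθ.ne')
  have : Nonempty X := ⟨x⟩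
  choose! γ hγE hγ using hlift
  have hdr₁ : d ≤ r₁ := by linarith
  have hx₁ : x ∈ E ∩ ball p r₁ := ⟨hx.1, ball_subset_ball hdr₁ hx.2⟩
  have hy₁ : y ∈ E ∩ ball p r₁ := ⟨hy.1, ball_subset_ball hdr₁ hy.2⟩
  have h01 : (0 : ℝ) ∈ Icc (0 : ℝ) 1 := left_mem_Icc.2 zero_le_one
  have h11 : (1 : ℝ) ∈ Icc (0 : ℝ) 1 := right_mem_Icc.2 zero_le_one
  refine intrinsicEDist_le_of_lipschitz (γ := γ) (LipschitzOnWith.of_dist_le_mul fun s hs t ht => ?_)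
    (hinj _ (hγE 0 h01) _ hx₁ fun i => by rw [hγ 0 h01 i]; ring)
    (hinj _ (hγE 1 h11) _ hy₁ fun i => by rw [hγ 1 h11 i]; simp only [hF]; ring)
    fun t ht => (hγE t ht).1
  rw [Real.coe_toNNReal _ (by positivity), Real.dist_eq, div_mul_eq_mul_div, le_div_iff₀ hθ]
  have key := hlow _ (hγE s hs) _ (hγE t ht)
  have e1 : ∑ i, (dist (a i) (γ t) - dist (a i) (γ s)) ^ 2 =
      (√(∑ i, F i ^ 2) * |s - t|) ^ 2 := by
    rw [mul_pow, Real.sq_sqrt (Finset.sum_nonneg fun i _ => sq_nonneg _), sq_abs, Finset.sum_mul]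
    exact Finset.sum_congr rfl fun i _ => by rw [hγ t ht i, hγ s hs i]; ring
  rw [e1] at key
  have := (le_abs_self _).trans (abs_le_of_sq_le_sq key (by positivity))
  linarith

/-- The map into Euclidean space given by the distances to finitely many points. -/
noncomputable def distEuclid (a : Fin m → X) (x : X) : EuclideanSpace ℝ (Fin m) :=
  WithLp.toLp 2 fun i => dist (a i) x

lemma dist_distEuclid (a : Fin m → X) (x y : X) :
    dist (distEuclid a x) (distEuclid a y) = √(∑ i, (dist (a i) y - dist (a i) x) ^ 2) := by
  rw [EuclideanSpace.dist_eq]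
  congr 1
  exact Finset.sum_congr rfl fun i _ => by
    rw [Real.dist_eq, sq_abs]
    simp only [distEuclid]
    ring

lemma SData.isOpen_image (hA : IsAlexandrov X κ) {E : Set X} (hE : IsExtremal κ E)
    (h : SData κ C₀ R a b p r C δ) (hcpt : ∀ (p : X) (r : ℝ), r < R → IsCompact (closedBall p r))
    (hδm : 28 * δ * m ≤ 1) {r₁ : ℝ} (hr₁ : r₁ ≤ r / 3) :
    IsOpen (distEuclid a '' (E ∩ ball p r₁)) := by
  have := hA.1
  have e : distEuclid a '' (E ∩ ball p r₁) = (EuclideanSpace.equiv (Fin m) ℝ).symm ''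
      ((fun x i => dist (a i) x) '' (E ∩ ball p r₁)) := by
    rw [image_image]; rfl
  rw [e]
  refine (EuclideanSpace.equiv (Fin m) ℝ).symm.toHomeomorph.isOpenMap _ (isOpen_iff_mem_nhds.2 ?_)
  rintro _ ⟨x, hx, rfl⟩
  have hxp : dist x p < r₁ := hx.2
  refine Filter.mem_of_superset ((h.hasMoves hA hE hcpt).image_mem_nhds (continuous_distMap a) hE.1
    (by rw [Fintype.card_fin]; linarith) (ball_subset_ball hr₁ hx.2) hx.1 (sub_pos.2 hxp))
    (image_mono (inter_subset_inter_right _ (ball_subset_ball' (by linarith))))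

/-- Numerical consequences of the smallness of `δ`. -/
lemma smallness {n m : ℕ} {δ : ℝ} (hδ : 0 < δ) (hδ₀ : δ * (1000 * ((n : ℝ) + 2) ^ 2) < 1)
    (hmn : m ≤ n) :
    δ ≤ 1 / 1000 ∧ 28 * δ * m ≤ 1 ∧ 32 * δ * (28 * (n + 1)) ≤ 1 ∧
      120 * ((m : ℝ) + 2) * (m + 1) * δ ≤ 120 * (n + 2) * (n + 1) * δ ∧
      120 * ((n : ℝ) + 2) * (n + 1) * δ < 1 ∧ 26 * (m : ℝ) * (m + 1) ≤ 120 * (n + 2) * (n + 1) := by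
  have hmn' : (m : ℝ) ≤ n := by exact_mod_cast hmn
  have hm0 : (0 : ℝ) ≤ m := Nat.cast_nonneg m
  have hn0 : (0 : ℝ) ≤ n := Nat.cast_nonneg n
  have hnδ : 0 ≤ n * δ := by positivity
  have hnδ2 : 0 ≤ n * (n * δ) := by positivity
  have hmδ : m * δ ≤ n * δ := mul_le_mul_of_nonneg_right hmn' hδ.le
  have hδ₀' : 1000 * (n * (n * δ)) + 4000 * (n * δ) + 4000 * δ < 1 := by linarith
  have hmm : ((m : ℝ) + 2) * (m + 1) ≤ (n + 2) * (n + 1) :=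
    mul_le_mul (by linarith) (by linarith) (by positivity) (by positivity)
  refine ⟨by linarith, by linarith, by linarith, ?_, by linarith, ?_⟩
  · have := mul_le_mul_of_nonneg_right hmm hδ.le
    linarith
  · have := mul_nonneg hm0 hm0
    linarith

/-- The local estimates for the strainer map at a point of an extremal subset at which there are
no longer strainers. -/
lemma exists_almost_isometry (hA : IsAlexandrov X κ) {n : ℕ} (hn : dimH (univ : Set X) = n)
    {E : Set X} (hE : IsExtremal κ E) (hδ : 0 < δ) (hδ₀ : δ * (1000 * ((n : ℝ) + 2) ^ 2) < 1)
    (hab : IsStrainer κ a b p δ) {U : Set X} (hU : U ∈ nhds p)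
    (hUno : ∀ q ∈ U ∩ E, ¬ IsStrainedPt κ (m + 1) δ q) :
    ∃ r > 0, IsOpen (distEuclid a '' (E ∩ ball p r)) ∧
      ∀ x ∈ E ∩ ball p r, ∀ y ∈ E ∩ ball p r,
        (1 - 120 * (n + 2) * (n + 1) * δ) * dist x y ≤ dist (distEuclid a x) (distEuclid a y) ∧
        dist (distEuclid a x) (distEuclid a y) ≤
          (1 + 120 * (n + 2) * (n + 1) * √δ) * dist x y ∧
        intrinsicEDist E x y ≤ ENNReal.ofReal (dist (distEuclid a x) (distEuclid a y) /
          (1 - 120 * (n + 2) * (n + 1) * δ)) := by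
  have hn0 : (0 : ℝ) ≤ n := Nat.cast_nonneg n
  have hmn : m ≤ n := IsStrainedPt.le_dim hA hn hδ (by nlinarith) ⟨a, b, hab⟩
  have hmn' : (m : ℝ) ≤ n := by exact_mod_cast hmn
  have hm0 : (0 : ℝ) ≤ m := Nat.cast_nonneg m
  obtain ⟨hδ1, hδm, hδη, hmK, hε1, h26⟩ := smallness hδ hδ₀ hmn
  obtain ⟨C₀, R₁, hKC₁⟩ := exists_KC κ
  obtain ⟨R₀, hR₀, hcpt₀⟩ := exists_isCompact_closedBall hA hn
  have hR₁ := hKC₁.1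
  have hKC : KC κ C₀ (min R₁ R₀) := hKC₁.mono (by positivity) (min_le_left _ _)
  have hcpt : ∀ (p : X) (r : ℝ), r < min R₁ R₀ → IsCompact (closedBall p r) := fun p r hr =>
    hcpt₀ p r (hr.trans_le (min_le_right _ _))
  -- no long strainers of a fixed quality near `p`
  set η : ℝ := 1 / (28 * (n + 1)) with hη
  have hη0 : 0 < η := by positivity
  have hηn : η * (28 * (n + 1)) = 1 := by rw [hη]; field_simp
  have hη1 : η ≤ 1 := by rw [hη, div_le_one (by positivity)]; linarith
  have hδη : 32 * δ ≤ η := by rw [hη, le_div_iff₀ (by positivity)]; exact hδη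
  have hno := not_isStrainedPt_of_forall hA hn hE hKC hcpt isOpen_interior hδ (by linarith) hδm hη0
    hη1 (by
      have : η * m ≤ η * n := mul_le_mul_of_nonneg_left hmn' hη0.le
      linarith) (U := interior U) fun z hz => hUno z ⟨interior_subset hz.2, hz.1⟩
  obtain ⟨ρU, hρU, hρUU⟩ := Metric.isOpen_iff.1 isOpen_interior p (mem_interior_iff_mem_nhds.2 hU)
  obtain ⟨r₀, C, hS₀⟩ := exists_sdata hKC hδ (by linarith) hab
  have hr₀ := hS₀.hr
  have hS := hS₀.mono (p' := p) (r' := min r₀ ρU) (by positivity) (min_le_left _ _)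
    (ball_subset_ball (min_le_left _ _))
  set r := min r₀ ρU with hr_def
  have hr : 0 < r := hS.hr
  have hno' : ∀ z ∈ E ∩ ball p r, ¬ IsStrainedPt κ (m + 1) η z := fun z hz =>
    hno z ⟨hz.1, hρUU (ball_subset_ball (min_le_right _ _) hz.2)⟩
  -- the estimates
  obtain ⟨r', hr', hiso⟩ := hS.isolated hA hn hη0 hη1 (by linarith) hno'
  obtain ⟨ρ, hρ, hdim⟩ := hS.exists_dimH_le hA hn hE hcpt hδm hη0 hη1 hδη hno'
  set ε : ℝ := 120 * (n + 2) * (n + 1) * δ with hε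
  have hε0 : 0 < ε := by positivity
  obtain ⟨r₁, hr₁, hlow⟩ := hS.exists_le_sum_sq hA hE hcpt hr' hiso hρ hdim (ε := ε) hε1.le hmK
  have hlow' : ∀ x ∈ E ∩ ball p r₁, ∀ y ∈ E ∩ ball p r₁,
      ((1 - ε) * dist x y) ^ 2 ≤ ∑ i, (dist (a i) y - dist (a i) x) ^ 2 := fun x hx y hy => by
    refine le_trans ?_ (hlow x hx y hy)
    rw [mul_pow]
    exact mul_le_mul_of_nonneg_right (pow_le_of_le_one (by linarith) (by linarith) two_ne_zero)
      (sq_nonneg _)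
  obtain ⟨r₂, hr₂, hintr⟩ := hS.exists_intrinsicEDist_le hA hE hcpt hδm hr₁ (θ := 1 - ε)
    (by linarith) hlow'
  have hτ : 0 < √δ := Real.sqrt_pos.2 hδ
  have hτ2 : √δ ^ 2 = δ := Real.sq_sqrt hδ.le
  have hτ1 : √δ ≤ 1 := Real.sqrt_le_one.2 (by linarith)
  have hδτ : δ ≤ √δ := Real.le_sqrt_of_sq_le
    (pow_le_of_le_one hδ.le (by linarith) two_ne_zero)
  set r₃ := min (min r₁ r₂) (min (r / 3) (r / (2 * m + 4))) with hr₃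
  have h31 : r₃ ≤ r₁ := (min_le_left _ _).trans (min_le_left _ _)
  have h32 : r₃ ≤ r₂ := (min_le_left _ _).trans (min_le_right _ _)
  have h33 : r₃ ≤ r / 3 := (min_le_right _ _).trans (min_le_left _ _)
  have h34 : r₃ ≤ r / (2 * m + 4) := (min_le_right _ _).trans (min_le_right _ _)
  refine ⟨r₃, by positivity, hS.isOpen_image hA hE hcpt hδm h33, ?_⟩
  intro x hx y hy
  have hintr' := hintr x ⟨hx.1, ball_subset_ball h32 hx.2⟩ y ⟨hy.1, ball_subset_ball h32 hy.2⟩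
  rw [← dist_distEuclid] at hintr'
  refine ⟨?_, ?_, hintr'⟩
  · rw [dist_distEuclid]
    exact Real.le_sqrt_of_sq_le (hlow' x ⟨hx.1, ball_subset_ball h31 hx.2⟩ y
      ⟨hy.1, ball_subset_ball h31 hy.2⟩)
  · rw [dist_distEuclid]
    refine Real.sqrt_le_iff.2 ⟨by positivity, ?_⟩
    refine (hS.sum_sq_le hA hτ hδτ hτ2.ge (ball_subset_ball h34 hx.2)
      (ball_subset_ball h34 hy.2)).trans ?_
    rw [mul_pow]
    refine mul_le_mul_of_nonneg_right ?_ (sq_nonneg _)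
    have h2 := mul_le_mul_of_nonneg_right h26 hτ.le
    nlinarith [sq_nonneg (120 * ((n : ℝ) + 2) * (n + 1) * √δ)]

end

/-- near a point of an extremal subset admitting an `(m,δ)`-strainer
with `m` the local `δ`-strainer number, the distance map from the strainer is a
`κ(δ)`-almost isometry onto an open subset of `ℝ^m`, with respect to both the
extrinsic and the intrinsic metrics of `E`. -/
theorem stmt6 (n : ℕ) (κ₀ : ℝ) :
    ∃ (κf : ℝ → ℝ) (δ₀ : ℝ), 0 < δ₀ ∧
      (∀ ε > (0:ℝ), ∃ δ₁ > (0:ℝ), ∀ δ : ℝ, 0 < δ → δ < δ₁ → κf δ < ε) ∧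
      ∀ (X : Type) (_ : MetricSpace X), IsAlexandrov X κ₀ →
        dimH (Set.univ : Set X) = n →
        ∀ E : Set X, IsExtremal κ₀ E →
        ∀ p ∈ E, ∀ δ : ℝ, 0 < δ → δ < δ₀ →
        ∀ (m : ℕ) (a b : Fin m → X), IsStrainer κ₀ a b p δ →
        (∀ U ∈ nhds p, ∃ q ∈ U ∩ E, IsStrainedPt κ₀ m δ q) →
        (∃ U ∈ nhds p, ∀ q ∈ U ∩ E, ¬ IsStrainedPt κ₀ (m + 1) δ q) →
        ∃ r > (0:ℝ), ∃ f : X → EuclideanSpace ℝ (Fin m),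
          (∀ x, f x = fun i => dist (a i) x) ∧
          IsOpen (f '' (E ∩ Metric.ball p r)) ∧
          ∀ x ∈ E ∩ Metric.ball p r, ∀ y ∈ E ∩ Metric.ball p r, x ≠ y →
            ((1 - κf δ) * dist x y < dist (f x) (f y) ∧
              dist (f x) (f y) < (1 + κf δ) * dist x y) ∧
            (ENNReal.ofReal (1 - κf δ) * intrinsicEDist E x y <
                ENNReal.ofReal (dist (f x) (f y)) ∧
              ENNReal.ofReal (dist (f x) (f y)) <
                ENNReal.ofReal (1 + κf δ) * intrinsicEDist E x y) := by
  set K : ℝ := 120 * (n + 2) * (n + 1) with hK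
  have hn0 : (0 : ℝ) ≤ n := Nat.cast_nonneg n
  have hK0 : 0 < K := by positivity
  refine ⟨fun δ => 2 * K * √δ, 1 / (1000 * (n + 2) ^ 2), by positivity, fun ε hε => ?_, ?_⟩
  · refine ⟨(ε / (2 * K)) ^ 2, by positivity, fun δ _ hδ => ?_⟩
    have h1 : √δ < ε / (2 * K) := (Real.sqrt_lt' (by positivity)).2 hδ
    rw [lt_div_iff₀ (by positivity)] at h1
    change 2 * K * √δ < ε
    linarith
  intro X _ hA hn E hE p hp δ hδ hδ₀ m a b hab _ ⟨U, hU, hUno⟩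
  rw [lt_div_iff₀ (by positivity)] at hδ₀
  obtain ⟨hδ1, -, -, -, hε1, -⟩ := smallness hδ hδ₀ le_rfl
  rw [← hK] at hε1
  have hτ2 : √δ ^ 2 = δ := Real.sq_sqrt hδ.le
  have hτ : 0 < √δ := Real.sqrt_pos.2 hδ
  have hδτ : δ ≤ √δ := Real.le_sqrt_of_sq_le
    (pow_le_of_le_one hδ.le (by linarith) two_ne_zero)
  have hKτ : 0 < K * √δ := by positivity
  have hετ : K * δ ≤ K * √δ := mul_le_mul_of_nonneg_left hδτ hK0.le
  obtain ⟨r, hr, hopen, hest⟩ := exists_almost_isometry hA hn hE hδ hδ₀ hab hU hUno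
  refine ⟨r, hr, distEuclid a, fun x => rfl, hopen, fun x hx y hy hxy => ?_⟩
  obtain ⟨hlo, hup, hintr⟩ := hest x hx y hy
  rw [← hK] at hlo hup hintr
  have hL : 0 < dist x y := dist_pos.2 hxy
  have hD : 0 < dist (distEuclid a x) (distEuclid a y) :=
    (mul_pos (by linarith) hL).trans_le hlo
  have hlo' : (1 - 2 * K * √δ) * dist x y < dist (distEuclid a x) (distEuclid a y) :=
    (mul_lt_mul_of_pos_right (by linarith) hL).trans_le hlo
  have hup' : dist (distEuclid a x) (distEuclid a y) < (1 + 2 * K * √δ) * dist x y :=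
    hup.trans_lt (mul_lt_mul_of_pos_right (by linarith) hL)
  refine ⟨⟨hlo', hup'⟩, ?_, ?_⟩
  · refine (mul_le_mul_right hintr _).trans_lt ?_
    rcases le_or_gt (1 - 2 * K * √δ) 0 with h2 | h2
    · rw [ENNReal.ofReal_of_nonpos h2, zero_mul]
      exact ENNReal.ofReal_pos.2 hD
    · rw [← ENNReal.ofReal_mul h2.le]
      refine (ENNReal.ofReal_lt_ofReal_iff hD).2 ?_
      rw [mul_div_assoc', div_lt_iff₀ (by linarith), mul_comm]
      exact mul_lt_mul_of_pos_left (by linarith) hD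
  · refine lt_of_lt_of_le ?_ (mul_le_mul_right (edist_le_intrinsicEDist E x y) _)
    rw [edist_dist, ← ENNReal.ofReal_mul (by positivity)]
    exact (ENNReal.ofReal_lt_ofReal_iff (by positivity)).2 hup'
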